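/- For q = 5 and n ≥ 3, we have (5,n) ∈ B(3,2) for all n ≥ 13 and for n ∈ {7, 9, 10, 11}. -/

import Mathlib

open Polynomial

noncomputable section

/-- An element of a finite field is *primitive* if it generates the multiplicative group. -/
def IsPrimitiveElem {L : Type} [Field L] [Fintype L] (α : L) : Prop :=
  orderOf α = Fintype.card L - 1

/-- `β` is a *normal element* of `L` over `K`, where `n = [L : K]`:
the conjugates `β, β^q, …, β^(q^(n-1))` form a `K`-basis of `L`. -/
def IsNormalElem (K : Type) {L : Type} [Field K] [Fintype K] [Field L] [Algebra K L]
    (n : ℕ) (β : L) : Prop :=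
  LinearIndependent K (fun i : Fin n => β ^ Fintype.card K ^ (i : ℕ)) ∧
    Submodule.span K (Set.range fun i : Fin n => β ^ Fintype.card K ^ (i : ℕ)) = ⊤

/-- The set `Υ_Q(m₁, m₂)` of rational functions over the field `F` with `Q` elements. -/
def Upsilon (F : Type) [Field F] [Fintype F] (m₁ m₂ : ℕ) : Set (RatFunc F) :=
  {f | ∃ f₁ f₂ : F[X], f₂ ≠ 0 ∧
      f = algebraMap F[X] (RatFunc F) f₁ / algebraMap F[X] (RatFunc F) f₂ ∧
      f₁.natDegree ≤ m₁ ∧ f₂.natDegree ≤ m₂ ∧ IsCoprime f₁ f₂ ∧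
      ∃ (k : ℕ) (g : F[X]), 0 < k ∧ g.Monic ∧ Irreducible g ∧ g ≠ X ∧
        Nat.gcd k (Fintype.card F - 1) = 1 ∧
        g ^ k ∣ f₁ * f₂ ∧ ¬ g ^ (k + 1) ∣ f₁ * f₂}

/-- Evaluation of a rational function at a point of the same field (`0` if undefined). -/
def ratEval {F : Type} [Field F] (f : RatFunc F) (α : F) : F :=
  f.eval (RingHom.id F) α

/-- `α` is `s`-free. -/
def IsFree {F : Type} [Field F] (s : ℕ) (α : F) : Prop :=
  α ≠ 0 ∧ ∀ d : ℕ, d ∣ s → d ≠ 1 → ¬ ∃ β : F, β ^ d = α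

/-- The `F_q[x]`-module action `h ∘ β = ∑ hᵢ β^(qⁱ)` on `L`. -/
def polyAct {K L : Type} [Field K] [Fintype K] [Field L] [Algebra K L]
    (h : K[X]) (β : L) : L :=
  h.sum fun i a => algebraMap K L a * β ^ Fintype.card K ^ i

/-- `α` is `g`-free with respect to the `F_q[x]`-module structure of `L`. -/
def IsPolyFree (K : Type) {L : Type} [Field K] [Fintype K] [Field L] [Algebra K L]
    (g : K[X]) (α : L) : Prop :=
  ∀ h : K[X], h.Monic → h ∣ g → (∃ lam : L, α = polyAct h lam) → h = 1

/-- `N_f(e₁, e₂, g)`: the number of `α ∈ L` such that `α` is `e₁`-free,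
`f(α)` is `e₂`-free and `α` is `g`-free. -/
def NElems (K : Type) {L : Type} [Field K] [Fintype K] [Field L] [Fintype L] [Algebra K L]
    (f : RatFunc L) (e₁ e₂ : ℕ) (g : K[X]) : ℕ :=
  Nat.card {α : L | IsFree e₁ α ∧ IsFree e₂ (ratEval f α) ∧ IsPolyFree K g α}

/-- `W(ℓ)`: the number of squarefree divisors of `ℓ`. -/
def Wnat (ℓ : ℕ) : ℕ := (ℓ.divisors.filter Squarefree).card

/-- `W_q(g)`: the number of monic squarefree divisors of `g` in `F_q[x]`. -/
def Wpoly {K : Type} [Field K] (g : K[X]) : ℕ :=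
  Nat.card {h : K[X] // h.Monic ∧ Squarefree h ∧ h ∣ g}

/-- `Φ(g) = |(F_q[x]/(g))ˣ|`. -/
def PhiPoly {K : Type} [Field K] (g : K[X]) : ℕ :=
  Nat.card ((K[X] ⧸ Ideal.span ({g} : Set K[X]))ˣ)

/-- `(q, n) ∈ B(m₁, m₂)`: for every `f ∈ Υ_{qⁿ}(m₁, m₂)` there is a primitive element
`α` of `F_{qⁿ}`, normal over `F_q`, with `f(α)` also primitive. -/
def memB (m₁ m₂ q n : ℕ) : Prop :=
  ∀ (K L : Type) [Field K] [Field L] [Fintype K] [Fintype L] [Algebra K L],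
    Fintype.card K = q → Fintype.card L = q ^ n →
    ∀ f ∈ Upsilon L m₁ m₂,
      ∃ α : L, IsPrimitiveElem α ∧ IsNormalElem K n α ∧ IsPrimitiveElem (ratEval f α)

/-- `𝔑(q, n)`: the number of primitive elements of `F_{qⁿ}` that are normal over `F_q`. -/
def NNum (K L : Type) [Field K] [Fintype K] [Field L] [Fintype L] [Algebra K L] (n : ℕ) : ℕ :=
  Nat.card {α : L | IsPrimitiveElem α ∧ IsNormalElem K n α}

end

open Polynomial

namespace W

lemma digits_zero {E : Type} [Field E] (P : ℕ) :
    ∀ (m : ℕ) (B : E[X][X]), B.natDegree ≤ m → (∀ j, (B.coeff j).degree < P) →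
      B.eval (X ^ P) = 0 → B = 0 := by
  have key : ∀ (B : E[X][X]), (∀ j, (B.coeff j).degree < P) →
      B.eval (X ^ P) = 0 → B.coeff 0 = 0 ∧ B.divX.eval (X ^ P) = 0 := by
    intro B hB h
    have h1 : B.eval (X ^ P) = B.divX.eval (X ^ P) * X ^ P + B.coeff 0 := by
      conv_lhs => rw [← divX_mul_X_add B]
      simp
    rw [h] at h1
    have h2 : B.coeff 0 = 0 := by
      by_contra hne
      have h3 : (X ^ P : E[X]) ∣ B.coeff 0 := ⟨-B.divX.eval (X ^ P), by
        linear_combination -h1⟩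
      have := degree_le_of_dvd h3 hne
      rw [degree_X_pow] at this
      exact absurd (hB 0) (not_lt.mpr this)
    refine ⟨h2, ?_⟩
    rw [h2, add_zero] at h1
    have : (X ^ P : E[X]) ≠ 0 := pow_ne_zero _ X_ne_zero
    exact (mul_eq_zero.mp h1.symm).resolve_right this
  intro m
  induction m with
  | zero =>
    intro B hd hB h
    obtain ⟨h2, -⟩ := key B hB h
    rw [eq_C_of_natDegree_le_zero hd, h2, C_0]
  | succ m ih =>
    intro B hd hB h
    obtain ⟨h2, h3⟩ := key B hB h
    have h4 := ih B.divX (by rw [natDegree_divX_eq_natDegree_tsub_one]; omega)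
      (fun j => by rw [coeff_divX]; exact hB _) h3
    rw [← divX_mul_X_add B, h2, h4]; simp

lemma zindep {D : Type} [CommRing D] [IsDomain D] (Q : ℕ) (hQ : 0 < Q) (S : D[X]) (hS : S.natDegree = Q)
    (v : Fin Q → D[X]) (h : ∑ l, (v l).comp S * X ^ (l : ℕ) = 0) : ∀ l, v l = 0 := by
  classical
  have hdeg : ∀ l, (v l).comp S ≠ 0 → ((v l).comp S * X ^ (l : ℕ)).degree
      = (((v l).natDegree * Q + l : ℕ) : WithBot ℕ) := by
    intro l hl
    rw [degree_eq_natDegree (mul_ne_zero hl (pow_ne_zero _ X_ne_zero)), natDegree_mul hl (pow_ne_zero _ X_ne_zero), natDegree_X_pow,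
      natDegree_comp, hS]
  have h1 := degree_sum_eq_of_disjoint (fun l => (v l).comp S * X ^ (l : ℕ)) Finset.univ (by
    intro i hi j hj hij
    have hi' : (v i).comp S ≠ 0 := fun h0 => hi.2 (by simp [h0])
    have hj' : (v j).comp S ≠ 0 := fun h0 => hj.2 (by simp [h0])
    simp only [Function.onFun, Function.comp]
    rw [hdeg i hi', hdeg j hj']
    intro heq
    have heq' : (v i).natDegree * Q + i = (v j).natDegree * Q + j := by exact_mod_cast heq
    apply hij
    have := congrArg (· % Q) heq'
    simp only [Nat.mul_add_mod_self_right, Nat.mod_eq_of_lt i.2, Nat.mod_eq_of_lt j.2] at this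
    exact Fin.ext this)
  rw [h, degree_zero] at h1
  intro l
  have h2 : ((v l).comp S * X ^ (l : ℕ)).degree ≤ ⊥ := by
    rw [h1]; exact Finset.le_sup (f := fun l => ((v l).comp S * X ^ (l : ℕ)).degree) (Finset.mem_univ l)
  have h3 : (v l).comp S = 0 := by
    by_contra h0
    rw [hdeg l h0] at h2
    exact absurd (le_bot_iff.mp h2) (WithBot.coe_ne_bot)
  rcases comp_eq_zero_iff.mp h3 with h4 | ⟨_, h5⟩
  · exact h4
  · rw [h5, natDegree_C] at hS; omega

lemma kummer_deg {K Ω : Type} [Field K] [Field Ω] [Algebra K Ω] (d : ℕ) (hd : 0 < d) (ζ : K)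
    (hζ : IsPrimitiveRoot ζ d) (a : K) (ha : a ≠ 0) (w : Ω) (hw : w ^ d = algebraMap K Ω a)
    (hp : ∀ e, e ∣ d → ∀ b : K, b ^ e = a → e = 1) : d ≤ (minpoly K w).natDegree := by
  have hw0 : w ≠ 0 := by
    rintro rfl
    rw [zero_pow hd.ne'] at hw
    exact ha ((map_eq_zero _).mp hw.symm)
  have hintg : IsIntegral K w := IsIntegral.of_pow hd (hw ▸ isIntegral_algebraMap)
  set μ := minpoly K w
  have hdvd : μ.map (algebraMap K Ω) ∣ X ^ d - C (algebraMap K Ω a) := by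
    have : μ ∣ X ^ d - C a := minpoly.dvd _ _ (by simp [hw])
    simpa using Polynomial.map_dvd (algebraMap K Ω) this
  have hζ' := hζ.map_of_injective (algebraMap K Ω).injective
  have hne : (X ^ d - C (algebraMap K Ω a)) ≠ 0 := X_pow_sub_C_ne_zero hd _
  have hspl : (μ.map (algebraMap K Ω)).Splits :=
    (X_pow_sub_C_splits_of_isPrimitiveRoot hζ' hw).of_dvd hne hdvd
  have hmon : (μ.map (algebraMap K Ω)).Monic := (minpoly.monic hintg).map _
  have hc := hspl.coeff_zero_eq_prod_roots_of_monic hmon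
  have hcard := hspl.natDegree_eq_card_roots
  rw [natDegree_map] at hcard
  have hroots : ∀ s : Multiset Ω, (∀ r ∈ s, r ^ d = algebraMap K Ω a) →
      ∃ u : K, u ≠ 0 ∧ s.prod = algebraMap K Ω u * w ^ s.card := by
    intro s
    induction s using Multiset.induction with
    | empty => intro _; exact ⟨1, one_ne_zero, by simp⟩
    | cons r s ih =>
      intro h
      obtain ⟨u, hu, hs⟩ := ih (fun r hr => h r (Multiset.mem_cons_of_mem hr))
      have hr := h r (Multiset.mem_cons_self r s)
      have h1 : (r / w) ^ d = 1 := by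
        rw [div_pow, hr, hw, div_self]; rw [← hw]; exact pow_ne_zero _ hw0
      have : NeZero d := ⟨hd.ne'⟩
      obtain ⟨i, -, hi⟩ := hζ'.eq_pow_of_pow_eq_one h1
      refine ⟨ζ ^ i * u, mul_ne_zero (pow_ne_zero _ (hζ.ne_zero hd.ne')) hu, ?_⟩
      rw [Multiset.prod_cons, hs, Multiset.card_cons]
      have : r = algebraMap K Ω ζ ^ i * w := by rw [hi]; field_simp
      rw [this]; simp; ring
  obtain ⟨u, hu, hprod⟩ := hroots (μ.map (algebraMap K Ω)).roots (by
    intro r hr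
    have h1 := (mem_roots'.mp hr).2
    have h2 : IsRoot (X ^ d - C (algebraMap K Ω a)) r := h1.dvd hdvd
    simpa [sub_eq_zero] using h2)
  rw [← hcard] at hprod
  rw [hprod, coeff_map, hmon.natDegree_map (RingHom.id Ω) |>.symm] at hc
  have hwm : ∃ b : K, b ≠ 0 ∧ w ^ μ.natDegree = algebraMap K Ω b := by
    have hs : ((-1 : Ω) ^ (((μ.map (algebraMap K Ω)).map (RingHom.id Ω)).natDegree)) ≠ 0 := by simp
    have hu' : algebraMap K Ω u ≠ 0 := by simpa using hu
    have hb : w ^ μ.natDegree = algebraMap K Ω (μ.coeff 0 * ((-1) ^ (((μ.map (algebraMap K Ω)).map (RingHom.id Ω)).natDegree))⁻¹ * u⁻¹) := by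
      rw [map_mul, map_mul, hc, map_inv₀, map_inv₀, map_pow, map_neg, map_one]
      field_simp
    refine ⟨_, ?_, hb⟩
    intro h0
    rw [h0, map_zero] at hb
    exact pow_ne_zero _ hw0 hb
  obtain ⟨b, hb0, hb⟩ := hwm
  set m := μ.natDegree
  have hg : ∃ b' : K, w ^ (Nat.gcd m d) = algebraMap K Ω b' := by
    refine ⟨b ^ (Nat.gcdA m d) * a ^ (Nat.gcdB m d), ?_⟩
    rw [map_mul, map_zpow₀, map_zpow₀, ← hb, ← hw, ← zpow_natCast w m, ← zpow_natCast w d, ← zpow_mul,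
      ← zpow_mul, ← zpow_add₀ hw0, ← Nat.gcd_eq_gcd_ab, zpow_natCast]
  obtain ⟨b', hb'⟩ := hg
  have h1 := hp (d / Nat.gcd m d) (Nat.div_dvd_of_dvd (Nat.gcd_dvd_right m d)) b' (by
    apply (algebraMap K Ω).injective
    rw [map_pow, ← hb', ← pow_mul, Nat.mul_div_cancel' (Nat.gcd_dvd_right m d), hw])
  have h2 : Nat.gcd m d = d := by
    have := Nat.div_mul_cancel (Nat.gcd_dvd_right m d)
    rw [h1, one_mul] at this; exact this
  have h3 : d ∣ m := h2 ▸ Nat.gcd_dvd_left m d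
  exact Nat.le_of_dvd (minpoly.natDegree_pos hintg) h3

lemma kummer_indep {K Ω : Type} [Field K] [Field Ω] [Algebra K Ω] (d : ℕ) (hd : 0 < d) (ζ : K)
    (hζ : IsPrimitiveRoot ζ d) (a : K) (ha : a ≠ 0) (w : Ω) (hw : w ^ d = algebraMap K Ω a)
    (hp : ∀ e, e ∣ d → ∀ b : K, b ^ e = a → e = 1) (c : Fin d → K)
    (h : ∑ i, algebraMap K Ω (c i) * w ^ (i : ℕ) = 0) : ∀ i, c i = 0 := by
  have hmin := kummer_deg d hd ζ hζ a ha w hw hp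
  have hintg : IsIntegral K w := IsIntegral.of_pow hd (hw ▸ isIntegral_algebraMap)
  set p : K[X] := ∑ i : Fin d, C (c i) * X ^ (i : ℕ) with hpdef
  have hp0 : aeval w p = 0 := by
    simp only [hpdef, map_sum, map_mul, aeval_C, map_pow, aeval_X]; exact h
  have hpz : p = 0 := by
    by_contra hne
    have h1 := minpoly.degree_le_of_ne_zero K w hne hp0
    have h2 : p.degree < d := by
      rw [hpdef]; exact degree_sum_fin_lt c
    have h3 : ((d : ℕ) : WithBot ℕ) ≤ (minpoly K w).degree := by
      rw [degree_eq_natDegree (minpoly.ne_zero hintg)]; exact_mod_cast hmin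
    exact absurd (lt_of_le_of_lt (h3.trans h1) h2) (lt_irrefl _)
  intro i
  have := congrArg (fun p => p.coeff i) hpz
  simp only [hpdef, finsetSum_coeff, coeff_C_mul, coeff_X_pow, coeff_zero] at this
  rw [Finset.sum_eq_single i] at this
  · simpa using this
  · intro j _ hj
    rw [if_neg]; simp
    intro h; exact hj (Fin.ext h.symm)
  · simp
end W

open Polynomial
namespace W

lemma inv_comp {F E : Type} [Field F] [Fintype F] [Field E] [Algebra F E] (Q : ℕ)
    (hQ : Fintype.card F = Q) : ∀ m (b : E[X]), b.natDegree ≤ m →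
    (∀ t : F, b.comp (X + C (algebraMap F E t)) = b) → ∃ h : E[X], b = h.comp (X ^ Q - X) := by
  have hQ1 : 1 < Q := hQ ▸ Fintype.one_lt_card
  set S : E[X] := X ^ Q - X with hS
  have hSm : S.Monic := by
    apply monic_X_pow_sub
    rw [degree_X]; exact_mod_cast hQ1
  have hSd : S.natDegree = Q := by
    rw [hS]; exact FiniteField.X_pow_card_sub_X_natDegree_eq E hQ1
  have htQ : ∀ t : F, (algebraMap F E t) ^ Q = algebraMap F E t := by
    intro t; rw [← map_pow, ← hQ, FiniteField.pow_card]
  have hinj : Function.Injective (algebraMap F E) := (algebraMap F E).injective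
  obtain ⟨p, hp⟩ := CharP.exists F
  have : Fact p.Prime := ⟨CharP.char_is_prime F p⟩
  have : CharP E p := (RingHom.charP_iff (algebraMap F E) hinj p).1 hp
  obtain ⟨n, -, hn⟩ := FiniteField.card F p
  have hQp : Q = p ^ (n : ℕ) := by rw [← hQ, hn]
  have hSt : ∀ t : F, S.comp (X + C (algebraMap F E t)) = S := by
    intro t
    simp only [hS, sub_comp, pow_comp, X_comp]
    rw [hQp, add_pow_char_pow, ← hQp, ← C_pow, htQ]; ring
  intro m
  induction m with
  | zero =>
    intro b hb _
    refine ⟨b, ?_⟩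
    rw [eq_C_of_natDegree_le_zero hb, C_comp]
  | succ m ih =>
    intro b hb hinv
    have hdvd : S ∣ b - C (b.eval 0) := by
      rw [← modByMonic_eq_zero_iff_dvd hSm]
      apply eq_zero_of_natDegree_lt_card_of_eval_eq_zero _ (f := fun t : F => algebraMap F E t) hinj
      · intro t
        have h1 : ∀ t : F, S.eval (algebraMap F E t) = 0 := by
          intro t; simp [hS, htQ]
        have h2 : (b - C (b.eval 0)).eval (algebraMap F E t) = 0 := by
          have := congrArg (eval 0) (hinv t)
          simp at this
          simp [this]
        have h3 := congrArg (eval (algebraMap F E t)) (modByMonic_add_div (b - C (b.eval 0)) S)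
        rw [eval_add, eval_mul, h1, zero_mul, add_zero, h2] at h3
        exact h3
      · rw [hQ, ← hSd]
        apply natDegree_modByMonic_lt _ hSm
        intro h; rw [h] at hSd; simp at hSd; omega
    obtain ⟨g, hg⟩ := hdvd
    have hS0 : S ≠ 0 := hSm.ne_zero
    have hginv : ∀ t : F, g.comp (X + C (algebraMap F E t)) = g := by
      intro t
      have := congrArg (fun u => u.comp (X + C (algebraMap F E t))) hg
      simp only [sub_comp, C_comp, mul_comp, hinv, hSt] at this
      rw [hg] at this
      exact (mul_left_cancel₀ hS0 this).symm
    have hgd : g.natDegree ≤ m := by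
      by_cases hg0 : g = 0
      · simp [hg0]
      have h1 : (b - C (b.eval 0)).natDegree ≤ m + 1 := by
        rw [natDegree_sub_C]; exact hb
      rw [hg, natDegree_mul hS0 hg0, hSd] at h1
      omega
    obtain ⟨h, hh⟩ := ih g hgd hginv
    refine ⟨X * h + C (b.eval 0), ?_⟩
    rw [add_comp, mul_comp, X_comp, C_comp, ← hh, ← hg]; ring

lemma not_power {F E : Type} [Field F] [Fintype F] [Field E] [Algebra F E] (Q : ℕ)
    (hQ : Fintype.card F = Q) (f : E[X]) (hf : f.Monic) (e : ℕ) (he : e ≠ 0)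
    (x0 : E) (c : E) (hc : c ≠ 0) (b : E[X])
    (hb : b ^ e = f.comp (X ^ Q - X + C x0) * C c) : ∃ g : E[X], g.Monic ∧ g ^ e = f := by
  have hQ1 : 1 < Q := hQ ▸ Fintype.one_lt_card
  set S : E[X] := X ^ Q - X + C x0 with hS
  have hSm : S.Monic := by
    have : S = X ^ Q - (X - C x0) := by rw [hS]; ring
    rw [this]
    apply monic_X_pow_sub
    rw [degree_X_sub_C]; exact_mod_cast hQ1
  have hSd : S.natDegree = Q := by
    rw [hS, natDegree_add_C]; exact FiniteField.X_pow_card_sub_X_natDegree_eq E hQ1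
  have hfS : (f.comp S).Monic := hf.comp hSm (by omega)
  have hlc : b.leadingCoeff ^ e = c := by
    have := congrArg leadingCoeff hb
    rw [leadingCoeff_pow, leadingCoeff_mul, hfS.leadingCoeff, leadingCoeff_C, one_mul] at this
    exact this
  have hb0 : b ≠ 0 := by
    rintro rfl; simp [he] at hlc; exact hc hlc.symm
  set b' := b * C (b.leadingCoeff⁻¹) with hb'
  have hb'm : b'.Monic := monic_mul_leadingCoeff_inv hb0
  have hb'e : b' ^ e = f.comp S := by
    rw [hb', mul_pow, hb, ← C_pow, inv_pow, hlc, mul_assoc, ← C_mul, mul_inv_cancel₀ hc]; simp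
  obtain ⟨p, hp⟩ := CharP.exists F
  have : Fact p.Prime := ⟨CharP.char_is_prime F p⟩
  have : CharP E p := (RingHom.charP_iff (algebraMap F E) (algebraMap F E).injective p).1 hp
  obtain ⟨n, -, hn⟩ := FiniteField.card F p
  have hQp : Q = p ^ (n : ℕ) := by rw [← hQ, hn]
  have hSt : ∀ t : F, S.comp (X + C (algebraMap F E t)) = S := by
    intro t
    simp only [hS, sub_comp, add_comp, pow_comp, X_comp, C_comp]
    rw [hQp, add_pow_char_pow, ← hQp, ← C_pow, ← map_pow, ← hQ, FiniteField.pow_card]; ring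
  have hinv : ∀ t : F, b'.comp (X + C (algebraMap F E t)) = b' := by
    intro t
    have h1 : (b'.comp (X + C (algebraMap F E t))) ^ e = b' ^ e := by
      rw [← pow_comp, hb'e, comp_assoc, hSt]
    apply eq_of_monic_of_associated _ hb'm
    · apply associated_of_dvd_dvd
      · rw [← UniqueFactorizationMonoid.pow_dvd_pow_iff_dvd he, h1]
      · rw [← UniqueFactorizationMonoid.pow_dvd_pow_iff_dvd he, h1]
    · exact hb'm.comp_X_add_C _
  obtain ⟨h, hh⟩ := inv_comp Q hQ _ b' le_rfl hinv
  have hh2 : b' = (h.comp (X - C x0)).comp S := by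
    rw [comp_assoc, hh]; congr 1; simp [hS]
  refine ⟨h.comp (X - C x0), ?_, ?_⟩
  · have := congrArg leadingCoeff hh2
    rw [leadingCoeff_comp (by omega), hSm.leadingCoeff, one_pow, mul_one, hb'm.leadingCoeff] at this
    exact this.symm
  · have h1 : ((h.comp (X - C x0)) ^ e - f).comp S = 0 := by
      rw [sub_comp, pow_comp, ← hh2, hb'e, sub_self]
    rw [comp_eq_zero_iff] at h1
    rcases h1 with h1 | h1
    · exact sub_eq_zero.1 h1
    · have := h1.2
      rw [this] at hSd; simp at hSd; omega

/-- the basic element -/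
noncomputable def aY {E : Type} [Field E] (f : E[X]) (d : ℕ) : E[X][X] :=
  f.map C * C (f ^ (d - 1))

lemma indep {F E : Type} [Field F] [Fintype F] [Field E] [Algebra F E] (Q : ℕ)
    (hQ : Fintype.card F = Q) (f : E[X]) (hf : f.Monic) (d : ℕ) (hd : 0 < d)
    (ζ : E) (hζ : IsPrimitiveRoot ζ d) (x0 : E) (hx0 : f.eval x0 ≠ 0)
    (hpow : ∀ e, e ∣ d → ∀ g : E[X], g.Monic → g ^ e = f → e = 1) :
    ∃ (Ω : Type) (_ : Field Ω) (ρ : E[X][X] →+* Ω) (w z : Ω),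
      w ^ d = ρ (aY f d) ∧ z ^ Q = z + ρ (X - C X) ∧
      ∀ c : Fin d → Fin Q → E[X][X], ∑ i, ∑ l, ρ (c i l) * w ^ (i : ℕ) * z ^ (l : ℕ) = 0 →
        ∀ i l, c i l = 0 := by
  have hQ1 : 1 < Q := hQ ▸ Fintype.one_lt_card
  let A := E[X][X]
  let S : A := X ^ Q - X + C X
  have hSd : S.natDegree = Q := by
    show (X ^ Q - X + C X : E[X][X]).natDegree = Q
    rw [natDegree_add_C, natDegree_sub_eq_left_of_natDegree_lt] <;> simp [hQ1]
  let K := FractionRing A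
  let Ω := AlgebraicClosure K
  let ρA : A →+* Ω := (algebraMap K Ω).comp (algebraMap A K)
  let θ : A →+* A := compRingHom S
  let a : A := θ (aY f d)
  have ha_def : a = (f.map C).comp S * C (f ^ (d-1)) := by
    have : ∀ u, θ u = u.comp S := fun u => rfl
    simp only [a, this, aY, mul_comp, C_comp]
  have hx0' : ∀ u : E[X], (evalRingHom x0) u = u.eval x0 := fun u => rfl
  have hspec : (mapRingHom (evalRingHom x0)) a = f.comp (X ^ Q - X + C x0) * C ((f.eval x0) ^ (d-1)) := by
    have hfe : (f.map C).map (evalRingHom x0) = f := by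
      rw [map_map]
      have : (evalRingHom x0).comp C = RingHom.id E := by ext; simp
      rw [this, map_id]
    rw [ha_def, map_mul, coe_mapRingHom, map_comp, hfe]
    have : map (evalRingHom x0) S = (X ^ Q - X + C x0) := by
      show map (evalRingHom x0) (X ^ Q - X + C X) = _
      simp
    rw [this]; simp
  have hc0 : (f.eval x0) ^ (d-1) ≠ 0 := pow_ne_zero _ hx0
  have ha0 : a ≠ 0 := by
    intro h
    rw [h, map_zero] at hspec
    have := hspec.symm
    rw [mul_eq_zero] at this
    rcases this with h | h
    · rw [comp_eq_zero_iff] at h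
      rcases h with h | h
      · exact hf.ne_zero h
      · have h2 := congrArg natDegree h.2
        rw [natDegree_add_C, FiniteField.X_pow_card_sub_X_natDegree_eq E hQ1] at h2
        rw [natDegree_C] at h2; omega
    · simp at h; exact hc0 (by simpa using h)
  have hKinj : Function.Injective (algebraMap A K) := IsFractionRing.injective A K
  let aK : K := algebraMap A K a
  have hpK : ∀ e, e ∣ d → ∀ b : K, b ^ e = aK → e = 1 := by
    intro e he b hb
    have he0 : 0 < e := Nat.pos_of_dvd_of_pos he hd
    obtain ⟨y, hy⟩ := IsIntegrallyClosed.exists_algebraMap_eq_of_isIntegral_pow (R := A) (K := K) (x := b) he0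
      (by rw [hb]; exact isIntegral_algebraMap)
    have hy2 : y ^ e = a := by
      apply hKinj; rw [map_pow, hy, hb]
    have hy3 := congrArg (mapRingHom (evalRingHom x0)) hy2
    rw [hspec, map_pow] at hy3
    obtain ⟨g, hg, hge⟩ := not_power Q hQ f hf e he0.ne' x0 _ hc0 _ hy3
    exact hpow e he g hg hge
  obtain ⟨w, hw⟩ := IsAlgClosed.exists_pow_nat_eq (algebraMap K Ω aK) hd
  let z : Ω := ρA X
  have hζK : IsPrimitiveRoot (algebraMap A K (C (C ζ))) d := by
    have h1 : Function.Injective ((algebraMap A K).comp ((C : E[X] →+* A).comp C)) := by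
      exact hKinj.comp ((C_injective).comp C_injective)
    exact hζ.map_of_injective (f := (algebraMap A K).comp ((C : E[X] →+* A).comp C)) h1
  refine ⟨Ω, inferInstance, ρA.comp θ, w, z, hw, ?_, ?_⟩
  · show (ρA X) ^ Q = ρA X + ρA (θ (X - C X))
    rw [← map_pow, ← map_add]
    congr 1
    have : θ (X - C X) = (X - C X : A).comp S := rfl
    rw [this, sub_comp, X_comp, C_comp]
    show X ^ Q = X + ((X ^ Q - X + C X) - C X)
    ring
  · intro c hc
    have h1 := kummer_indep d hd _ hζK aK (by
      intro h; exact ha0 (hKinj (by rw [map_zero]; exact h))) w hw hpK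
      (fun i => algebraMap A K (∑ l, θ (c i l) * X ^ (l : ℕ))) (by
        rw [← hc]
        apply Finset.sum_congr rfl
        intro i _
        rw [map_sum, map_sum, Finset.sum_mul]
        apply Finset.sum_congr rfl
        intro l _
        simp only [map_mul, map_pow, RingHom.comp_apply, ρA, z]
        ring)
    intro i
    have h2 := h1 i
    have h3 : ∑ l, (c i l).comp S * X ^ (l : ℕ) = 0 := by
      apply hKinj
      rw [map_zero]
      exact h2
    exact zindep Q (by omega) S hSd (c i) h3

end W

open Polynomial
namespace W

/-- inner degree bound -/
def Ideg {E : Type} [Field E] (B : E[X][X]) (a : ℕ) : Prop := ∀ j, (B.coeff j).natDegree ≤ a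

lemma Ideg.mono {E : Type} [Field E] {B : E[X][X]} {a b : ℕ} (h : Ideg B a) (hab : a ≤ b) : Ideg B b :=
  fun j => (h j).trans hab

lemma Ideg.zero {E : Type} [Field E] (a : ℕ) : Ideg (0 : E[X][X]) a := by intro j; simp

lemma Ideg.one {E : Type} [Field E] (a : ℕ) : Ideg (1 : E[X][X]) a := by
  intro j; rw [coeff_one]; split_ifs <;> simp

lemma Ideg.add {E : Type} [Field E] {B B' : E[X][X]} {a : ℕ} (h : Ideg B a) (h' : Ideg B' a) :
    Ideg (B + B') a := by
  intro j; rw [coeff_add]; exact natDegree_add_le_of_degree_le (h j) (h' j)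

lemma Ideg.neg {E : Type} [Field E] {B : E[X][X]} {a : ℕ} (h : Ideg B a) :
    Ideg (-B) a := by
  intro j; rw [coeff_neg, natDegree_neg]; exact h j

lemma Ideg.sum {E : Type} [Field E] {ι : Type} {s : Finset ι} {B : ι → E[X][X]} {a : ℕ}
    (h : ∀ i ∈ s, Ideg (B i) a) : Ideg (∑ i ∈ s, B i) a := by
  intro j; rw [finsetSum_coeff]; exact natDegree_sum_le_of_forall_le _ _ (fun i hi => h i hi j)

lemma Ideg.mul {E : Type} [Field E] {B B' : E[X][X]} {a b : ℕ} (h : Ideg B a) (h' : Ideg B' b) :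
    Ideg (B * B') (a + b) := by
  intro j; rw [coeff_mul]
  exact natDegree_sum_le_of_forall_le _ _ (fun i hi => natDegree_mul_le_of_le (h _) (h' _))

lemma Ideg.prod {E : Type} [Field E] {ι : Type} {s : Finset ι} {B : ι → E[X][X]} {a : ℕ}
    (h : ∀ i ∈ s, Ideg (B i) a) : Ideg (∏ i ∈ s, B i) (s.card * a) := by
  classical
  induction s using Finset.induction_on with
  | empty => simpa using Ideg.one 0
  | insert i s hi ih =>
    rw [Finset.prod_insert hi, Finset.card_insert_of_notMem hi, add_mul, one_mul, add_comm]
    exact (h i (by simp)).mul (ih fun j hj => h j (by simp [hj]))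

lemma Ideg.C {E : Type} [Field E] {u : E[X]} {a : ℕ} (h : u.natDegree ≤ a) : Ideg (C u) a := by
  intro j; rw [coeff_C]; split_ifs <;> simp [h]

section red
variable {R : Type} [CommRing R]

def redW (d : ℕ) (a : R) (m i : ℕ) : R :=
  if m < d then (if m = i then 1 else 0) else (if m - d = i then a else 0)

def redZ (Q : ℕ) (s : R) (m l : ℕ) : R :=
  if m < Q then (if m = l then 1 else 0) else
    ((if m - Q + 1 = l then 1 else 0) + (if m - Q = l then s else 0))

lemma redW_spec {S : Type} [CommRing S] (ρ : R →+* S) (d : ℕ) (a : R) (w : S) (hw : w ^ d = ρ a)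
    (m : ℕ) (hm : m < 2 * d) : ∑ i : Fin d, ρ (redW d a m i) * w ^ (i : ℕ) = w ^ m := by
  rw [Fin.sum_univ_eq_sum_range (fun i => ρ (redW d a m i) * w ^ i)]
  unfold redW
  split_ifs with h
  · rw [Finset.sum_eq_single m]
    · simp
    · intro b _ hb; rw [if_neg (Ne.symm hb)]; simp
    · intro h2; simp at h2; omega
  · rw [Finset.sum_eq_single (m - d)]
    · rw [if_pos rfl, ← hw, ← pow_add]; congr 1; omega
    · intro b _ hb; rw [if_neg (Ne.symm hb)]; simp
    · intro h2; simp at h2; omega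

lemma redZ_spec {S : Type} [CommRing S] (ρ : R →+* S) (Q : ℕ) (s : R) (z : S) (hz : z ^ Q = z + ρ s)
    (m : ℕ) (hm : m + 1 < 2 * Q) : ∑ i : Fin Q, ρ (redZ Q s m i) * z ^ (i : ℕ) = z ^ m := by
  rw [Fin.sum_univ_eq_sum_range (fun i => ρ (redZ Q s m i) * z ^ i)]
  unfold redZ
  split_ifs with h
  · rw [Finset.sum_eq_single m]
    · simp
    · intro b _ hb; rw [if_neg (Ne.symm hb)]; simp
    · intro h2; simp at h2; omega
  · simp only [map_add, add_mul, Finset.sum_add_distrib]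
    rw [Finset.sum_eq_single (m - Q + 1), Finset.sum_eq_single (m - Q)]
    · rw [if_pos rfl, if_pos rfl]
      have : m = (m - Q) + Q := by omega
      conv_rhs => rw [this, pow_add, hz]
      simp; ring
    · intro b _ hb; rw [if_neg (Ne.symm hb)]; simp
    · intro h2; simp at h2; omega
    · intro b _ hb; rw [if_neg (Ne.symm hb)]; simp
    · intro h2; simp at h2; omega

def mulMat (d Q : ℕ) (a s : R) (c : Fin d → Fin Q → R) : Matrix (Fin d × Fin Q) (Fin d × Fin Q) R :=
  fun x y => ∑ i : Fin d, ∑ l : Fin Q, c i l * redW d a (x.1 + i) y.1 * redZ Q s (x.2 + l) y.2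

lemma mulMat_spec {S : Type} [CommRing S] (ρ : R →+* S) (d Q : ℕ) (a s : R)
    (c : Fin d → Fin Q → R) (w z : S) (hw : w ^ d = ρ a) (hz : z ^ Q = z + ρ s)
    (x : Fin d × Fin Q) :
    ∑ y : Fin d × Fin Q, ρ (mulMat d Q a s c x y) * (w ^ (y.1 : ℕ) * z ^ (y.2 : ℕ)) =
    (w ^ (x.1 : ℕ) * z ^ (x.2 : ℕ)) * ∑ i, ∑ l, ρ (c i l) * w ^ (i : ℕ) * z ^ (l : ℕ) := by
  have h1 : ∀ y : Fin d × Fin Q, ρ (mulMat d Q a s c x y) * (w ^ (y.1 : ℕ) * z ^ (y.2 : ℕ)) =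
    ∑ i : Fin d, ∑ l : Fin Q, ρ (c i l) * (ρ (redW d a (x.1 + i) y.1) * w ^ (y.1 : ℕ)) *
      (ρ (redZ Q s (x.2 + l) y.2) * z ^ (y.2 : ℕ)) := by
    intro y
    simp only [mulMat, map_sum, Finset.sum_mul, map_mul]
    refine Finset.sum_congr rfl fun i _ => Finset.sum_congr rfl fun l _ => ?_
    ring
  simp_rw [h1]
  rw [Finset.sum_comm, Finset.mul_sum]
  refine Finset.sum_congr rfl fun i _ => ?_
  rw [Finset.sum_comm, Finset.mul_sum]
  refine Finset.sum_congr rfl fun l _ => ?_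
  rw [Fintype.sum_prod_type]
  simp_rw [← Finset.mul_sum]
  simp_rw [redZ_spec ρ Q s z hz (x.2 + l) (by omega)]
  rw [← Finset.sum_mul, ← Finset.mul_sum, redW_spec ρ d a w hw (x.1 + i) (by omega)]
  rw [pow_add, pow_add]; ring

end red

lemma nonvanish {F E : Type} [Field F] [Fintype F] [Field E] [Algebra F E] (Q : ℕ)
    (hQ : Fintype.card F = Q) (f : E[X]) (hf : f.Monic) (d : ℕ) (hd : 0 < d)
    (ζ : E) (hζ : IsPrimitiveRoot ζ d) (x0 : E) (hx0 : f.eval x0 ≠ 0)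
    (hpow : ∀ e, e ∣ d → ∀ g : E[X], g.Monic → g ^ e = f → e = 1)
    (P : ℕ) (hP : 0 < P) (r : ℕ) (hr : P = r * d + 1) (hfP : f.comp (X ^ P) = f ^ P)
    (T : E[X]) (hT : T ^ Q = T + (X ^ P - X)) (A : ℕ)
    (hA : d * Q * (A + 2 * (d * f.natDegree) + 1) < P)
    (B : Fin d → Fin Q → E[X][X]) (hB : ∀ i l, Ideg (B i l) A)
    (hG : ∑ i, ∑ l, (B i l).eval (X ^ P) * f ^ (r * (i : ℕ)) * T ^ (l : ℕ) = 0) :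
    ∀ i l, B i l = 0 := by
  classical
  have hQ1 : 1 < Q := hQ ▸ Fintype.one_lt_card
  obtain ⟨Ω, _, ρ, w, z, hw, hz, hind⟩ := indep Q hQ f hf d hd ζ hζ x0 hx0 hpow
  set D := f.natDegree with hD
  let c : Fin d → Fin Q → E[X][X] := fun i l => B i l * C (f ^ (d - 1 - (i : ℕ)))
  let s : E[X][X] := X - C X
  let M := mulMat d Q (aY f d) s c
  by_contra hB0
  have hcB : ¬ ∀ i l, c i l = 0 := by
    intro h
    apply hB0
    intro i l
    have h1 := h i l
    rcases mul_eq_zero.1 h1 with h1 | h1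
    · exact h1
    · exfalso
      rw [C_eq_zero] at h1
      exact pow_ne_zero _ hf.ne_zero h1
  have hdet : M.det ≠ 0 := by
    intro h
    obtain ⟨u, hu0, hu⟩ := Matrix.exists_vecMul_eq_zero_iff.2 h
    have h1 : (∑ x, ρ (u x) * (w ^ (x.1 : ℕ) * z ^ (x.2 : ℕ))) *
        ∑ i, ∑ l, ρ (c i l) * w ^ (i : ℕ) * z ^ (l : ℕ) = 0 := by
      rw [Finset.sum_mul]
      simp_rw [mul_assoc (ρ (u _)), ← mulMat_spec ρ d Q (aY f d) s c w z hw hz, Finset.mul_sum]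
      rw [Finset.sum_comm]
      apply Finset.sum_eq_zero
      intro y _
      have h2 := congrFun hu y
      simp only [Matrix.vecMul, dotProduct, Pi.zero_apply] at h2
      have h3 := congrArg ρ h2
      rw [map_sum, map_zero] at h3
      simp_rw [← mul_assoc, ← Finset.sum_mul]
      simp_rw [map_mul] at h3
      rw [h3]; simp
    rcases mul_eq_zero.1 h1 with h1 | h1
    · apply hu0
      rw [Fintype.sum_prod_type] at h1
      have := hind (fun i l => u (i, l)) (by simpa only [mul_assoc] using h1)
      ext ⟨i, l⟩ : 1
      exact this i l
    · exact hcB (hind c h1)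
  -- degree bound
  have haY : Ideg (aY f d) (d * D) := by
    have h1 : Ideg (f.map (C : E →+* E[X])) 0 := by
      intro j; rw [coeff_map]; simp
    have h2 : Ideg (C (f ^ (d - 1)) : E[X][X]) (d * D) := by
      apply Ideg.C
      rw [natDegree_pow]
      exact Nat.mul_le_mul (by omega) le_rfl
    have := h1.mul h2
    rwa [zero_add] at this
  have hs : Ideg s 1 := by
    have h1 : Ideg (X : E[X][X]) 1 := by
      intro j; rw [coeff_X]; split_ifs <;> simp
    have h2 : Ideg (C X : E[X][X]) 1 := Ideg.C (by simp)
    have := h1.add h2.neg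
    rwa [← sub_eq_add_neg] at this
  have hc : ∀ i l, Ideg (c i l) (A + d * D) := by
    intro i l
    apply (hB i l).mul
    apply Ideg.C
    rw [natDegree_pow]
    exact Nat.mul_le_mul (by omega) le_rfl
  have hrW : ∀ m i, Ideg (redW d (aY f d) m i) (d * D) := by
    intro m i
    unfold redW
    split_ifs
    exacts [Ideg.one _, Ideg.zero _, haY, Ideg.zero _]
  have hrZ : ∀ m i, Ideg (redZ Q s m i) 1 := by
    intro m i
    unfold redZ
    split_ifs
    exacts [Ideg.one _, Ideg.zero _, (Ideg.one _).add hs, (Ideg.one _).add (Ideg.zero _),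
      (Ideg.zero _).add hs, (Ideg.zero _).add (Ideg.zero _)]
  have hM : ∀ x y, Ideg (M x y) (A + 2 * (d * D) + 1) := by
    intro x y
    apply Ideg.sum; intro i _
    apply Ideg.sum; intro l _
    exact (((hc i l).mul (hrW _ _)).mul (hrZ _ _)).mono (by omega)
  have hMd : Ideg M.det (d * Q * (A + 2 * (d * D) + 1)) := by
    rw [Matrix.det_apply']
    apply Ideg.sum; intro σ _
    have h1 : Ideg (∏ i, M (σ i) i) (d * Q * (A + 2 * (d * D) + 1)) := by
      have := Ideg.prod (s := Finset.univ) (B := fun i => M (σ i) i) (fun i _ => hM _ _)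
      simpa using this
    rcases Int.units_eq_one_or (Equiv.Perm.sign σ) with h | h <;> rw [h]
    · simpa using h1
    · have e : (((-1 : ℤˣ) : ℤ) : E[X][X]) = C (-1) := by simp
      rw [e]
      have h3 := (Ideg.C (E := E) (u := -1) (a := 0) (by simp)).mul h1
      rwa [zero_add] at h3
  -- specialisation
  let σ : E[X][X] →+* E[X] := evalRingHom (X ^ P)
  let w' : E[X] := f ^ (1 + r)
  have hw' : w' ^ d = σ (aY f d) := by
    have h1 : σ (f.map C) = f ^ P := by
      rw [← hfP]
      show eval (X ^ P) (f.map C) = _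
      rw [eval_map]; rfl
    have h2 : σ (C (f ^ (d - 1))) = f ^ (d - 1) := by
      show eval _ (C _) = _
      rw [eval_C]
    unfold aY
    rw [map_mul, h1, h2, ← pow_mul, ← pow_add]
    congr 1
    rw [hr]
    obtain ⟨k, rfl⟩ : ∃ k, d = k + 1 := ⟨d - 1, by omega⟩
    simp; ring
  have hz' : T ^ Q = T + σ s := by
    rw [hT]; simp [σ, s]
  have hσc : ∑ i, ∑ l, σ (c i l) * w' ^ (i : ℕ) * T ^ (l : ℕ) = 0 := by
    have : ∀ i l, σ (c i l) * w' ^ (i : ℕ) * T ^ (l : ℕ) =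
      f ^ (d - 1) * ((B i l).eval (X ^ P) * f ^ (r * (i : ℕ)) * T ^ (l : ℕ)) := by
      intro i l
      have h2 : σ (c i l) = (B i l).eval (X ^ P) * f ^ (d - 1 - (i : ℕ)) := by
        show eval _ (B i l * C _) = _
        rw [eval_mul, eval_C]
      have h3 : f ^ (d - 1 - (i : ℕ)) * w' ^ (i : ℕ) = f ^ (d - 1) * f ^ (r * (i : ℕ)) := by
        rw [← pow_mul, ← pow_add, ← pow_add]
        congr 1
        have := i.2
        have : (1 + r) * (i : ℕ) = i + r * i := by ring
        omega
      rw [h2, mul_assoc _ (f ^ _) (w' ^ _), h3]; ring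
    simp_rw [this, ← Finset.mul_sum]
    rw [hG, mul_zero]
  have hdet0 : σ M.det = 0 := by
    rw [RingHom.map_det]
    apply Matrix.exists_mulVec_eq_zero_iff.1
    refine ⟨fun y => w' ^ (y.1 : ℕ) * T ^ (y.2 : ℕ), ?_, ?_⟩
    · intro h
      have := congrFun h (⟨0, hd⟩, ⟨0, by omega⟩)
      simp at this
    · ext1 x
      have := mulMat_spec σ d Q (aY f d) s c w' T hw' hz' x
      rw [hσc, mul_zero] at this
      exact this
  apply hdet
  apply digits_zero P _ M.det le_rfl _ hdet0
  intro j
  apply lt_of_le_of_lt degree_le_natDegree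
  exact_mod_cast lt_of_le_of_lt (hMd j) hA

end W

open Polynomial
namespace W

lemma frob_sum {F R : Type} [Field F] [Fintype F] [CommRing R] [Nontrivial R] [Algebra F R] (Q : ℕ)
    (hQ : Fintype.card F = Q) (m : ℕ) {ι : Type} (s : Finset ι) (g : ι → R) :
    (∑ i ∈ s, g i) ^ (Q ^ m) = ∑ i ∈ s, g i ^ (Q ^ m) := by
  obtain ⟨p, hp⟩ := CharP.exists F
  have : Fact p.Prime := ⟨CharP.char_is_prime F p⟩
  have : CharP R p := (RingHom.charP_iff (algebraMap F R) (algebraMap F R).injective p).1 hp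
  obtain ⟨n, -, hn⟩ := FiniteField.card F p
  have hQp : Q = p ^ (n : ℕ) := by rw [← hQ, hn]
  rw [hQp, ← pow_mul, sum_pow_char_pow]

/-- the trace polynomial as a function -/
def Tr (Q m : ℕ) {R : Type} [CommRing R] (x : R) : R := ∑ i ∈ Finset.range m, x ^ (Q ^ i)

lemma Tr_frob {F R : Type} [Field F] [Fintype F] [CommRing R] [Nontrivial R] [Algebra F R] (Q : ℕ)
    (hQ : Fintype.card F = Q) (m : ℕ) (x : R) : (Tr Q m x) ^ Q = Tr Q m x + (x ^ (Q ^ m) - x) := by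
  unfold Tr
  have := frob_sum Q hQ 1 (Finset.range m) (fun i => x ^ (Q ^ i))
  rw [pow_one] at this
  rw [this]
  simp_rw [← pow_mul, ← pow_succ]
  have h1 := Finset.sum_range_succ (fun i => x ^ Q ^ i) m
  rw [Finset.sum_range_succ'] at h1
  simp at h1
  linear_combination h1

lemma Tr_split {F R : Type} [Field F] [Fintype F] [CommRing R] [Nontrivial R] [Algebra F R] (Q : ℕ)
    (hQ : Fintype.card F = Q) (m v : ℕ) (x : R) : Tr Q (m + v) x = Tr Q m x + (Tr Q v x) ^ (Q ^ m) := by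
  unfold Tr
  rw [frob_sum Q hQ, Finset.sum_range_add]
  congr 1
  refine Finset.sum_congr rfl fun i _ => ?_
  rw [← pow_mul, ← pow_add, add_comm]

lemma comp_pow_pow {E : Type} [Field E] (Q : ℕ) (f : E[X]) (hfQ : f.comp (X ^ Q) = f ^ Q) (m : ℕ) :
    f.comp (X ^ (Q ^ m)) = f ^ (Q ^ m) := by
  induction m with
  | zero => simp
  | succ m ih =>
    have : (X ^ (Q ^ (m+1)) : E[X]) = (X ^ (Q ^ m)).comp (X ^ Q) := by
      rw [pow_comp, X_comp, ← pow_mul]; congr 1; ring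
    rw [this, ← comp_assoc, ih, pow_comp, hfQ, ← pow_mul]; congr 1; ring

lemma Tr_natDegree {E : Type} [Field E] (Q : ℕ) (hQ : 1 < Q) (m l : ℕ) (hl : l < Q) :
    ((Tr Q m (X : E[X])) ^ l).natDegree ≤ Q ^ m := by
  rcases m with _ | m
  · rcases l with _ | l <;> simp [Tr]
  have h1 : (Tr Q (m+1) (X : E[X])).natDegree ≤ Q ^ m := by
    apply natDegree_sum_le_of_forall_le
    intro i hi
    rw [natDegree_X_pow]
    exact Nat.pow_le_pow_right (by omega) (by simp at hi; omega)
  calc _ ≤ l * Q ^ m := natDegree_pow_le_of_le l h1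
    _ ≤ Q * Q ^ m := Nat.mul_le_mul_right _ hl.le
    _ = _ := by ring

lemma count {F E : Type} [Field F] [Fintype F] [Field E] [Fintype E] [DecidableEq E] [Algebra F E] (Q : ℕ)
    (hQ : Fintype.card F = Q) (f : E[X]) (hf : f.Monic) (d : ℕ) (hd : 0 < d)
    (ζ : E) (hζ : IsPrimitiveRoot ζ d) (x0 : E) (hx0 : f.eval x0 ≠ 0)
    (hpow : ∀ e, e ∣ d → ∀ g : E[X], g.Monic → g ^ e = f → e = 1)
    (hfQ : f.comp (X ^ Q) = f ^ Q)
    (μ v r r' : ℕ) (hr : Q ^ v = r * d + 1) (hr' : Q ^ μ = r' * d + 1)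
    (hE : Fintype.card E = Q ^ (μ + v)) (ζ0 t : E) (A J : ℕ)
    (hA : d * Q * (A + 2 * (d * f.natDegree) + 1) < Q ^ v)
    (hJ : (A + f.natDegree + 1) * Q ^ μ + J < d * Q * J * A) :
    (Finset.univ.filter (fun α : E => f.eval α ≠ 0 ∧ f.eval α ^ (Q ^ μ * r + r') = ζ0 ∧
      Tr Q (μ + v) α = t)).card ≤ A + (J + f.natDegree) * Q ^ v := by
  classical
  have hQ1 : 1 < Q := hQ ▸ Fintype.one_lt_card
  set D := f.natDegree with hD
  set P := Q ^ v with hP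
  set M := Q ^ μ with hM
  have hM0 : 0 < M := by positivity
  have hP0 : 0 < P := by positivity
  let ι := Fin d × Fin Q × Fin J × Fin A
  let N0 := (A + D + 1) * M + J
  let bas : ι → E[X] := fun x => X ^ ((x.2.2.2 : ℕ) * M + x.2.2.1) * C (ζ0 ^ (x.1 : ℕ)) *
    f ^ ((d - x.1) * r') * (C t - Tr Q μ X) ^ (x.2.1 : ℕ)
  have hbas : ∀ x, (bas x).degree < N0 := by
    intro x
    obtain ⟨i, l, j, a⟩ := x
    apply lt_of_le_of_lt degree_le_natDegree
    have h1 : (bas (i, l, j, a)).natDegree ≤ ((a : ℕ) * M + j) + 0 + (M - 1) * D + M := by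
      refine natDegree_mul_le_of_le (natDegree_mul_le_of_le (natDegree_mul_le_of_le ?_ ?_) ?_) ?_
      · simp
      · simp
      · rw [natDegree_pow]
        apply Nat.mul_le_mul_right
        calc (d - (i : ℕ)) * r' ≤ d * r' := Nat.mul_le_mul_right _ (by omega)
          _ = M - 1 := by rw [hr', mul_comm]; simp
      · show (natDegree ((C t - Tr Q μ X) ^ (l : ℕ)) : ℕ) ≤ M
        rcases Nat.eq_zero_or_pos μ with h0 | h0
        · have : (C t - Tr Q μ X : E[X]) = C t := by rw [h0]; simp [Tr]
          rw [this, ← C_pow, natDegree_C]; omega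
        · have h2 : (Tr Q μ (X : E[X])).natDegree ≤ Q ^ (μ - 1) := by
            apply natDegree_sum_le_of_forall_le
            intro i hi
            rw [natDegree_X_pow]
            exact Nat.pow_le_pow_right (by omega) (by simp at hi; omega)
          have h3 : (C t - Tr Q μ (X : E[X])).natDegree ≤ Q ^ (μ - 1) := by
            have h4 := natDegree_sub_le_of_le (natDegree_C t).le h2
            simpa using h4
          calc _ ≤ (l : ℕ) * Q ^ (μ - 1) := natDegree_pow_le_of_le _ h3
            _ ≤ Q * Q ^ (μ - 1) := Nat.mul_le_mul_right _ l.2.le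
            _ = M := by rw [← pow_succ', hM]; congr 1; omega
    have h2 : ((a : ℕ) + 1) * M ≤ A * M := Nat.mul_le_mul_right _ (by omega)
    have h3 : (M - 1) * D ≤ D * M := by rw [mul_comm]; exact Nat.mul_le_mul_left _ (by omega)
    have h4 : N0 = A * M + D * M + M + J := by simp only [N0]; ring
    have h5 : ((a : ℕ) + 1) * M = a * M + M := by ring
    have := j.2
    exact_mod_cast (by omega : (bas (i, l, j, a)).natDegree < N0)
  let φ : (ι → E) →ₗ[E] degreeLT E N0 :=
    { toFun := fun κ => ⟨∑ x, κ x • bas x, by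
        apply Submodule.sum_mem
        intro x _
        apply Submodule.smul_mem
        exact mem_degreeLT.2 (hbas x)⟩
      map_add' := by
        intro κ κ'
        ext1
        simp [add_smul, Finset.sum_add_distrib]
      map_smul' := by
        intro c κ
        ext1
        simp only [Pi.smul_apply, smul_eq_mul, RingHom.id_apply, SetLike.val_smul, Finset.smul_sum, mul_smul] }
  have hker : LinearMap.ker φ ≠ ⊥ := by
    apply LinearMap.ker_ne_bot_of_finrank_lt
    rw [LinearEquiv.finrank_eq (degreeLTEquiv E N0)]
    simp only [Module.finrank_fintype_fun_eq_card, ι, Fintype.card_prod, Fintype.card_fin]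
    calc N0 < d * Q * J * A := hJ
      _ = _ := by ring
  obtain ⟨κ, hκ, hκ0⟩ := (Submodule.ne_bot_iff _).1 hker
  have hH : ∑ x, κ x • bas x = 0 := by
    have := congrArg Subtype.val (LinearMap.mem_ker.1 hκ)
    simpa [φ] using this
  -- auxiliary polynomial
  let B : Fin d → Fin Q → E[X][X] := fun i l =>
    ∑ j : Fin J, C (∑ a : Fin A, C (κ (i, l, j, a) ^ P) * X ^ (a : ℕ)) * X ^ (j : ℕ)
  let T : E[X] := Tr Q v X
  let G := ∑ i, ∑ l, (B i l).eval (X ^ P) * f ^ (r * (i : ℕ)) * T ^ (l : ℕ)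
  have hBcoeff : ∀ i l (j : Fin J), (B i l).coeff j = ∑ a : Fin A, C (κ (i, l, j, a) ^ P) * X ^ (a : ℕ) := by
    intro i l j
    simp only [B, finsetSum_coeff, coeff_C_mul, coeff_X_pow]
    rw [Finset.sum_eq_single j]
    · simp
    · intro b _ hb
      rw [if_neg]
      · simp
      · intro h; exact hb (Fin.ext h.symm)
    · simp
  have hin : ∀ i l (j : Fin J), (∑ a : Fin A, C (κ (i, l, j, a) ^ P) * X ^ (a : ℕ) : E[X]).natDegree ≤ A := by
    intro i l j
    apply natDegree_sum_le_of_forall_le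
    intro a _
    exact (natDegree_C_mul_X_pow_le _ _).trans a.2.le
  have hB : ∀ i l, Ideg (B i l) A := by
    intro i l
    apply Ideg.sum
    intro j _
    have h1 : Ideg (X ^ (j : ℕ) : E[X][X]) 0 := by
      intro k; rw [coeff_X_pow]; split_ifs <;> simp
    exact ((Ideg.C (hin i l j)).mul h1).mono (by omega)
  have hG0 : G ≠ 0 := by
    intro hG
    have hz := nonvanish Q hQ f hf d hd ζ hζ x0 hx0 hpow P hP0 r hr (comp_pow_pow Q f hfQ v) T
      (Tr_frob Q hQ v X) A hA B hB hG
    apply hκ0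
    ext ⟨i, l, j, a⟩
    have h1 := hBcoeff i l j
    rw [hz i l, coeff_zero] at h1
    have h2 := congrArg (fun u => coeff u (a : ℕ)) h1
    simp only [coeff_zero, finsetSum_coeff, coeff_C_mul, coeff_X_pow] at h2
    rw [Finset.sum_eq_single a] at h2
    · simpa [hP0.ne'] using h2.symm
    · intro b _ hb
      rw [if_neg]
      · simp
      · intro h; exact hb (Fin.ext h.symm)
    · simp
  have hGdeg : G.natDegree ≤ A + (J + D) * P := by
    apply natDegree_sum_le_of_forall_le
    intro i _
    apply natDegree_sum_le_of_forall_le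
    intro l _
    have h1 : ((B i l).eval (X ^ P)).natDegree ≤ A + (J - 1) * P := by
      simp only [B, eval_finsetSum, eval_mul, eval_C, eval_pow, eval_X]
      apply natDegree_sum_le_of_forall_le
      intro j _
      apply natDegree_mul_le_of_le (hin i l j)
      rw [← pow_mul, natDegree_X_pow, mul_comm]
      exact Nat.mul_le_mul_right _ (by omega)
    have h2 : (f ^ (r * (i : ℕ))).natDegree ≤ P * D := by
      rw [natDegree_pow]
      apply Nat.mul_le_mul_right
      rw [hr]
      have : r * (i : ℕ) ≤ r * d := Nat.mul_le_mul_left _ (by omega)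
      omega
    have h3 : (T ^ (l : ℕ)).natDegree ≤ P := Tr_natDegree Q hQ1 v l l.2
    have h4 := natDegree_mul_le_of_le (natDegree_mul_le_of_le h1 h2) h3
    have hJ0 : 0 < J := by
      rcases Nat.eq_zero_or_pos J with h | h
      · exfalso; rw [h] at hJ; simp at hJ
      · exact h
    obtain ⟨J', rfl⟩ : ∃ J', J = J' + 1 := ⟨J - 1, by omega⟩
    refine h4.trans (le_of_eq ?_)
    simp; ring
  have hfr : ∀ (s : Finset ι) (g : ι → E), (∑ x ∈ s, g x) ^ M = ∑ x ∈ s, g x ^ M :=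
    fun s g => frob_sum Q hQ μ s g
  have hGx : ∀ α : E, G.eval α = ∑ x : ι, κ x ^ P * α ^ ((x.2.2.2 : ℕ) + P * x.2.2.1) *
      f.eval α ^ (r * (x.1 : ℕ)) * (Tr Q v α) ^ (x.2.1 : ℕ) := by
    intro α
    have hTe : T.eval α = Tr Q v α := by simp [T, Tr, eval_finsetSum]
    simp only [G, B, ι, Fintype.sum_prod_type, eval_finsetSum, eval_mul, eval_C, eval_pow, eval_X, hTe,
      Finset.sum_mul]
    refine Finset.sum_congr rfl fun i _ => Finset.sum_congr rfl fun l _ => Finset.sum_congr rfl fun j _ =>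
      Finset.sum_congr rfl fun a _ => ?_
    ring
  have hroot : ∀ α : E, f.eval α ≠ 0 → f.eval α ^ (M * r + r') = ζ0 → Tr Q (μ + v) α = t →
      G.eval α = 0 := by
    intro α h1 h2 h3
    have hαq : α ^ (P * M) = α := by
      have := FiniteField.pow_card α
      rw [hE, pow_add, mul_comm] at this
      exact this
    have h5 : (Tr Q v α) ^ M = t - Tr Q μ α := by
      rw [Tr_split Q hQ] at h3
      rw [← h3]; ring
    have h4 : (G.eval α) ^ M * f.eval α ^ (r' * d) = 0 := by
      have h6 := congrArg (eval α) hH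
      rw [eval_zero] at h6
      rw [← h6, hGx, hfr, Finset.sum_mul, eval_finsetSum]
      refine Finset.sum_congr rfl fun x _ => ?_
      obtain ⟨i, l, j, a⟩ := x
      have hTe : (Tr Q μ (X : E[X])).eval α = Tr Q μ α := by simp [Tr, eval_finsetSum]
      have hκq : (κ (i, l, j, a) ^ P) ^ M = κ (i, l, j, a) := by
        have := FiniteField.pow_card (κ (i, l, j, a))
        rw [hE, pow_add, mul_comm, pow_mul] at this
        exact this
      simp only [eval_smul, bas, eval_mul, eval_pow, eval_X, eval_C, eval_sub, smul_eq_mul, hTe, mul_pow, hκq]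
      rw [← pow_mul α, add_mul, show P * (j : ℕ) * M = (P * M) * j by ring, pow_add α (_ * M), pow_mul α (P * M), hαq,
        ← pow_mul (Tr Q v α), mul_comm (l : ℕ) M, pow_mul (Tr Q v α) M, h5]
      have h7 : (eval α f ^ (r * (i : ℕ))) ^ M * eval α f ^ (r' * d) = ζ0 ^ (i : ℕ) * eval α f ^ ((d - (i : ℕ)) * r') := by
        rw [← h2, ← pow_mul, ← pow_mul, ← pow_add, ← pow_add]
        congr 1
        have : d * r' = (d - (i : ℕ)) * r' + i * r' := by
          rw [← add_mul]; congr 1; omega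
        rw [mul_comm r' d, this]; ring
      rw [pow_add α]
      linear_combination (κ (i, l, j, a) * α ^ ((a : ℕ) * M) * α ^ (j : ℕ) * (t - Tr Q μ α) ^ (l : ℕ)) * h7
    have h8 := (mul_eq_zero.1 h4).resolve_right (pow_ne_zero _ h1)
    exact pow_eq_zero_iff hM0.ne' |>.1 h8
  calc _ ≤ G.roots.toFinset.card := by
        apply Finset.card_le_card
        intro α hα
        rw [Finset.mem_filter] at hα
        rw [Multiset.mem_toFinset, mem_roots hG0]
        exact hroot α hα.2.1 hα.2.2.1 hα.2.2.2
    _ ≤ Multiset.card G.roots := Multiset.toFinset_card_le _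
    _ ≤ G.natDegree := card_roots' G
    _ ≤ _ := hGdeg

end W

open Polynomial
namespace W

/-- the Stepanov constant -/
noncomputable def Cst (Q d D : ℕ) : ℝ :=
  (2 * (d * Q * (2 * (d * D) + 3)) + (2 * (D + (2 * (d * D) + 1) + 3) + 2) + D + 1) * √(Q : ℝ)

lemma exists_r (Q d : ℕ) (hQ : 0 < Q) (hd : d ∣ Q - 1) (v : ℕ) : ∃ r, Q ^ v = r * d + 1 := by
  have h1 : d ∣ Q ^ v - 1 := hd.trans (by simpa using Nat.sub_dvd_pow_sub_pow Q 1 v)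
  obtain ⟨r, hr⟩ := h1
  refine ⟨r, ?_⟩
  have : 0 < Q ^ v := by positivity
  rw [mul_comm r]; omega

lemma arith_aux (s m M P A D K : ℤ) (e1 : P ≤ s * (A + K + 1)) (e2 : s * A ≤ P) (e3 : M < s * (m + 1))
    (e4 : 1 ≤ s) (e5 : 2 * (s * (K + 2)) ≤ P) (e6 : M ≤ P) (e9 : 0 < M) (hD : 0 ≤ D) (hK : 0 ≤ K)
    (hm : 0 ≤ m) : (A + D + 1) * M + (m + (2 * (D + K + 3) + 2)) < s * (m + (2 * (D + K + 3) + 2)) * A := by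
  set W := P - s * (K + 2) with hW
  have g1 : W ≤ s * A - 1 := by rw [hW]; linarith
  have hsK : 0 < s * (K + 2) := mul_pos (by linarith) (by linarith)
  have g0 : 0 < W := by linarith
  set U := 2 * (D + K + 3) + 1 with hU
  have hU0 : 0 < U := by linarith
  have g2 : M + s * U ≤ s * (m + (U + 1)) := by linarith
  have g3 : (M + s * U) * W ≤ s * (m + (U + 1)) * (s * A - 1) := by
    apply mul_le_mul g2 g1 g0.le
    exact mul_nonneg (by linarith) (by linarith)
  have g4 : s * ((A + D + 1) * M) ≤ (P + s * (D + 1)) * M := by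
    have := mul_le_mul_of_nonneg_right e2 e9.le
    linarith
  have g5 : (P + s * (D + 1)) * M < (M + s * U) * W := by
    have h1 : M ≤ 2 * W := by linarith
    have h2 : s * (D + K + 3) * M ≤ s * (D + K + 3) * (2 * W) := by
      apply mul_le_mul_of_nonneg_left h1
      apply mul_nonneg <;> linarith
    have h3 : 0 < s * W := mul_pos (by linarith) g0
    have h4 : (M + s * U) * W = M * P - s * (K + 2) * M + s * (D + K + 3) * (2 * W) + s * W := by
      rw [hW, hU]; ring
    rw [h4]
    linarith
  have g6 : s * ((A + D + 1) * M) < s * ((m + (U + 1)) * (s * A - 1)) := by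
    calc _ ≤ _ := g4
      _ < _ := g5
      _ ≤ _ := g3
      _ = _ := by ring
  have g7 := lt_of_mul_lt_mul_left g6 (by linarith)
  have : U + 1 = 2 * (D + K + 3) + 2 := by rw [hU]; ring
  rw [← this]
  linarith

lemma stepanov {F E : Type} [Field F] [Fintype F] [Field E] [Fintype E] [DecidableEq E] [Algebra F E] (Q : ℕ)
    (hQ : Fintype.card F = Q) (f : E[X]) (hf : f.Monic) (d : ℕ) (hd : 0 < d) (hdQ : d ∣ Q - 1)
    (ζ : E) (hζ : IsPrimitiveRoot ζ d)
    (hpow : ∀ e, e ∣ d → ∀ g : E[X], g.Monic → g ^ e = f → e = 1)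
    (hfQ : f.comp (X ^ Q) = f ^ Q) (k : ℕ)
    (hE : Fintype.card E = Q ^ k) (ζ0 t : E) :
    ((Finset.univ.filter (fun α : E => f.eval α ≠ 0 ∧ f.eval α ^ ((Q ^ k - 1) / d) = ζ0 ∧
      Tr Q k α = t)).card : ℝ) ≤ (Q : ℝ) ^ k / (d * Q) + Cst Q d f.natDegree * (√(Q : ℝ)) ^ k := by
  have hQ1 : 1 < Q := hQ ▸ Fintype.one_lt_card
  set D := f.natDegree with hD
  obtain ⟨μ, v, hk, hμv, hvμ⟩ : ∃ μ v, k = μ + v ∧ μ ≤ v ∧ v ≤ μ + 1 :=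
    ⟨k / 2, k - k / 2, by omega, by omega, by omega⟩
  obtain ⟨r, hr⟩ := exists_r Q d (by omega) hdQ v
  obtain ⟨r', hr'⟩ := exists_r Q d (by omega) hdQ μ
  have hexp : (Q ^ k - 1) / d = Q ^ μ * r + r' := by
    apply Nat.div_eq_of_eq_mul_left hd
    rw [hk, pow_add, hr]
    rw [mul_add, mul_one]
    conv_lhs => rw [add_comm, hr']
    rw [hr']
    have : r' * d + 1 + (r' * d + 1) * (r * d) - 1 = r' * d + (r' * d + 1) * (r * d) := by omega
    rw [this]; ring
  set P := Q ^ v with hP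
  set M := Q ^ μ with hM
  have hMP : M ≤ P := Nat.pow_le_pow_right (by omega) hμv
  have hM0 : 0 < M := by positivity
  set K1 := 2 * (d * D) + 1 with hK1
  set c1 := d * Q * (K1 + 2) with hc1
  set J1 := 2 * (D + K1 + 3) + 2 with hJ1
  have hC : Cst Q d D = (2 * c1 + J1 + D + 1 : ℕ) * √(Q : ℝ) := by
    unfold Cst; rw [hc1, hJ1, hK1]; push_cast; ring
  have hs0 : (0 : ℝ) ≤ √(Q : ℝ) := Real.sqrt_nonneg _
  have hs1 : (1 : ℝ) ≤ √(Q : ℝ) := by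
    rw [Real.one_le_sqrt]; exact_mod_cast hQ1.le
  have hPs : (P : ℝ) ≤ √(Q : ℝ) * √(Q : ℝ) ^ k := by
    rw [hP]; push_cast
    have h1 : (Q : ℝ) = √(Q : ℝ) ^ 2 := (Real.sq_sqrt (by positivity)).symm
    conv_lhs => rw [h1]
    rw [← pow_mul, ← pow_succ']
    exact pow_le_pow_right₀ hs1 (by omega)
  have hq : (Q : ℝ) ^ k = M * P := by rw [hk, hM, hP]; push_cast; ring
  have hpos : (0 : ℝ) ≤ (Q : ℝ) ^ k / (d * Q) := by positivity
  suffices hS : ((Finset.univ.filter (fun α : E => f.eval α ≠ 0 ∧ f.eval α ^ ((Q ^ k - 1) / d) = ζ0 ∧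
      Tr Q k α = t)).card : ℝ) ≤ (Q : ℝ) ^ k / (d * Q) + (2 * c1 + J1 + D + 1 : ℕ) * P by
    refine hS.trans ?_
    rw [hC, mul_assoc]
    gcongr
  by_cases hPc : P < 2 * c1
  · have h1 : (Finset.univ.filter (fun α : E => f.eval α ≠ 0 ∧ f.eval α ^ ((Q ^ k - 1) / d) = ζ0 ∧
      Tr Q k α = t)).card ≤ Fintype.card E := Finset.card_le_univ _
    have h2 : Fintype.card E ≤ (2 * c1 + J1 + D + 1) * P := by
      rw [hE, hk, pow_add]
      apply Nat.mul_le_mul_right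
      rw [← hM]; omega
    have h3 : ((Finset.univ.filter (fun α : E => f.eval α ≠ 0 ∧ f.eval α ^ ((Q ^ k - 1) / d) = ζ0 ∧
      Tr Q k α = t)).card : ℝ) ≤ (2 * c1 + J1 + D + 1 : ℕ) * P := by exact_mod_cast h1.trans h2
    linarith
  · push Not at hPc
    have hdQ0 : 0 < d * Q := by positivity
    have hDE : D < Fintype.card E := by
      have h1 : P ≤ Fintype.card E := by
        rw [hE, hk, hP]; exact Nat.pow_le_pow_right (by omega) (by omega)
      have h2 : K1 + 2 ≤ c1 := Nat.le_mul_of_pos_left _ hdQ0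
      have h3 : D ≤ d * D := Nat.le_mul_of_pos_left _ hd
      omega
    obtain ⟨x0, hx0⟩ : ∃ x0, f.eval x0 ≠ 0 := by
      by_contra hcon
      push Not at hcon
      exact hf.ne_zero (eq_zero_of_natDegree_lt_card_of_eval_eq_zero f (f := id) Function.injective_id hcon hDE)
    set A0 := (P - 1) / (d * Q) with hA0
    have hA1 : d * Q * A0 ≤ P - 1 := Nat.mul_div_le _ _
    have hA2 : P - 1 < d * Q * (A0 + 1) := by
      exact Nat.lt_mul_div_succ _ hdQ0
    have hK1A : K1 ≤ A0 := by
      by_contra h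
      have : A0 + 1 ≤ K1 + 2 := by omega
      have := Nat.mul_le_mul_left (d * Q) this
      have hc10 : 0 < c1 := by positivity
      omega
    obtain ⟨A, hA⟩ : ∃ A, A0 = A + K1 := ⟨A0 - K1, by omega⟩
    have hMdiv := Nat.lt_mul_div_succ M hdQ0
    have hMdiv2 := Nat.mul_div_le M (d * Q)
    set m := M / (d * Q) with hm
    have hJ : (A + D + 1) * M + (m + J1) < d * Q * (m + J1) * A := by
      have e1 : (P : ℤ) ≤ (d * Q : ℕ) * (A + K1 + 1) := by
        rw [hA] at hA2
        have : P ≤ d * Q * (A + K1 + 1) := by omega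
        exact_mod_cast this
      have e2 : ((d * Q : ℕ) * A : ℤ) ≤ P := by
        have : d * Q * A ≤ d * Q * A0 := Nat.mul_le_mul_left _ (by omega)
        have : d * Q * A ≤ P := by omega
        exact_mod_cast this
      have e3 : (M : ℤ) < (d * Q : ℕ) * (m + 1) := by exact_mod_cast hMdiv
      have e4 : (1 : ℤ) ≤ (d * Q : ℕ) := by exact_mod_cast hdQ0
      have e5 : (2 * ((d * Q : ℕ) * (K1 + 2)) : ℤ) ≤ P := by exact_mod_cast hPc
      have e6 : (M : ℤ) ≤ P := by exact_mod_cast hMP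
      have e9 : (0 : ℤ) < M := by exact_mod_cast hM0
      have := arith_aux (d * Q : ℕ) m M P A D K1 e1 e2 e3 e4 e5 e6 e9 (by positivity) (by positivity) (by positivity)
      rw [hJ1]
      exact_mod_cast this
    have hAA : d * Q * (A + 2 * (d * D) + 1) < P := by
      have : A + 2 * (d * D) + 1 = A0 := by omega
      rw [this]
      have : 0 < P := by omega
      omega
    have hfin := count Q hQ f hf d hd ζ hζ x0 hx0 hpow hfQ μ v r r' hr hr' (hk ▸ hE) ζ0 t A (m + J1) hAA hJ
    rw [hexp, hk]
    have hfin' : (((Finset.univ.filter (fun α : E => f.eval α ≠ 0 ∧ f.eval α ^ (M * r + r') = ζ0 ∧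
      Tr Q (μ + v) α = t)).card : ℕ) : ℝ) ≤ A + (m + J1 + D) * P := by exact_mod_cast hfin
    refine hfin'.trans ?_
    rw [← hk, hq]
    have hdQr : (0 : ℝ) < d * Q := by exact_mod_cast hdQ0
    have k1 : (m : ℝ) ≤ M / (d * Q) := by
      rw [le_div_iff₀ hdQr, mul_comm]; exact_mod_cast hMdiv2
    have k2 : (A : ℝ) ≤ P := by
      have : A ≤ P := by
        have : A0 ≤ d * Q * A0 := Nat.le_mul_of_pos_left _ hdQ0
        omega
      exact_mod_cast this
    have hP0 : (0 : ℝ) ≤ P := by positivity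
    have k3 : (m : ℝ) * P ≤ M * P / (d * Q) := by
      rw [mul_div_right_comm]; gcongr
    push_cast
    have hc0 : (0 : ℝ) ≤ c1 * P := by positivity
    nlinarith

end W

open Polynomial
namespace W

lemma mem_range_of_pow {F E : Type} [Field F] [Fintype F] [Field E] [Algebra F E]
    (x : E) (hx : x ^ Fintype.card F = x) : ∃ y : F, algebraMap F E y = x := by
  classical
  by_contra hcon
  push Not at hcon
  have hQ1 : 1 < Fintype.card F := Fintype.one_lt_card
  have h0 : (X ^ Fintype.card F - X : E[X]) ≠ 0 := FiniteField.X_pow_card_sub_X_ne_zero E hQ1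
  apply h0
  apply eq_zero_of_natDegree_lt_card_of_eval_eq_zero _
    (f := fun o : Option F => o.elim x (algebraMap F E))
  · rintro (_ | a) (_ | b) h
    · rfl
    · exact absurd h.symm (hcon b)
    · exact absurd h (hcon a)
    · simp at h; rw [h]
  · rintro (_ | a)
    · simp [hx]
    · simp [← map_pow, FiniteField.pow_card]
  · rw [FiniteField.X_pow_card_sub_X_natDegree_eq E hQ1, Fintype.card_option]; omega

lemma monic_pow_inj {E : Type} [Field E] {a b : E[X]} (ha : a.Monic) (hb : b.Monic) {e : ℕ} (he : e ≠ 0)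
    (h : a ^ e = b ^ e) : a = b := by
  apply eq_of_monic_of_associated ha hb
  apply associated_of_dvd_dvd
  · rw [← UniqueFactorizationMonoid.pow_dvd_pow_iff_dvd he, h]
  · rw [← UniqueFactorizationMonoid.pow_dvd_pow_iff_dvd he, h]

lemma descent {F E : Type} [Field F] [Fintype F] [Field E] [Algebra F E] (f : F[X])
    (e : ℕ) (he : e ≠ 0) (g : E[X]) (hg : g.Monic) (h : g ^ e = f.map (algebraMap F E)) :
    ∃ g0 : F[X], g0.Monic ∧ g0 ^ e = f := by
  obtain ⟨p, hp⟩ := CharP.exists F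
  have : Fact p.Prime := ⟨CharP.char_is_prime F p⟩
  have : CharP E p := (RingHom.charP_iff (algebraMap F E) (algebraMap F E).injective p).1 hp
  obtain ⟨n, -, hn⟩ := FiniteField.card F p
  let φ : E →+* E := iterateFrobenius E p n
  have hφ : ∀ x, φ x = x ^ Fintype.card F := by
    intro x; rw [hn]; exact iterateFrobenius_def p n x
  have h1 : g.map φ = g := by
    apply monic_pow_inj (hg.map φ) hg he
    rw [← Polynomial.map_pow, h, map_map]
    congr 1
    ext x
    simp [hφ, ← map_pow, FiniteField.pow_card]
  have h2 : ∀ i, ∃ y : F, algebraMap F E y = g.coeff i := by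
    intro i
    apply mem_range_of_pow
    rw [← hφ, ← coeff_map, h1]
  have h3 : g ∈ lifts (algebraMap F E) := by
    rw [lifts_iff_coeff_lifts]
    intro i; exact h2 i
  obtain ⟨g0, hg0, -, hm⟩ := lifts_and_degree_eq_and_monic h3 hg
  refine ⟨g0, hm, ?_⟩
  apply map_injective (algebraMap F E) (algebraMap F E).injective
  rw [Polynomial.map_pow, hg0, h]

/-- the character sum over an extension -/
noncomputable def cs {F : Type} [Field F] [Fintype F] (χ : MulChar F ℂ) (ψ : AddChar F ℂ) (f : F[X])
    (E : Type) [Field E] [Fintype E] [Algebra F E] : ℂ :=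
  ∑ α : E, χ (Algebra.norm F (aeval α f)) * ψ (Algebra.trace F E α)

lemma MulChar_norm_le {F : Type} [Field F] [Fintype F] (χ : MulChar F ℂ) (x : F) : ‖χ x‖ ≤ 1 := by
  by_cases hx : x = 0
  · rw [hx, MulChar.map_nonunit _ (by simp)]; simp
  · have : (χ x) ^ (Fintype.card F - 1) = 1 := by
      rw [← map_pow, FiniteField.pow_card_sub_one_eq_one x hx, map_one]
    have h2 : Fintype.card F - 1 ≠ 0 := by have := Fintype.one_lt_card (α := F); omega
    rw [Complex.norm_eq_one_of_pow_eq_one this h2]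

lemma AddChar_norm {F : Type} [Field F] [Fintype F] (ψ : AddChar F ℂ) (x : F) : ‖ψ x‖ = 1 := by
  exact AddChar.norm_apply ψ x

lemma cs_bound {F : Type} [Field F] [Fintype F] (χ : MulChar F ℂ) (hχ : ∀ u : F, u ≠ 0 → χ u = 1 → u = 1)
    (ψ : AddChar F ℂ) (f : F[X]) (hf : f.Monic)
    (hnt : ψ ≠ 1 ∨ ¬ ∃ g : F[X], g.Monic ∧ g ^ (Fintype.card F - 1) = f) :
    ∃ C : ℝ, ∀ (k : ℕ) (E : Type) [Field E] [Fintype E] [Algebra F E], Fintype.card E = Fintype.card F ^ k →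
      ‖cs χ ψ f E‖ ≤ C * √(Fintype.card F : ℝ) ^ k := by
  classical
  have hQ1 : 1 < Fintype.card F := Fintype.one_lt_card
  set Q := Fintype.card F with hQ
  -- maximal e
  have hex : ∃ e, 0 < e ∧ (e ∣ Q - 1 ∧ ∃ g : F[X], g.Monic ∧ g ^ e = f) ∧
      ∀ e', (e' ∣ Q - 1 ∧ ∃ g : F[X], g.Monic ∧ g ^ e' = f) → e' ≤ e := by
    let s := (Q - 1).divisors.filter (fun e => ∃ g : F[X], g.Monic ∧ g ^ e = f)
    have hs : s.Nonempty := ⟨1, by simp [s]; exact ⟨by omega, hf⟩⟩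
    obtain ⟨e, he, hmax⟩ := s.exists_max_image id hs
    simp only [s, Finset.mem_filter, Nat.mem_divisors] at he
    refine ⟨e, Nat.pos_of_dvd_of_pos he.1.1 (by omega), ⟨he.1.1, he.2⟩, ?_⟩
    intro e' he'
    apply hmax e'
    simp only [s, Finset.mem_filter, Nat.mem_divisors]
    exact ⟨⟨he'.1, by omega⟩, he'.2⟩
  obtain ⟨e, he0, ⟨⟨d, hed⟩, f0, hf0, hf0e⟩, hmax⟩ := hex
  have hd0 : 0 < d := by
    rcases Nat.eq_zero_or_pos d with h | h
    · rw [h] at hed; omega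
    · exact h
  have hdQ : d ∣ Q - 1 := ⟨e, by rw [hed, mul_comm]⟩
  -- primitive root
  obtain ⟨ζ, hζ⟩ : ∃ ζ : F, IsPrimitiveRoot ζ d := by
    obtain ⟨g, hg⟩ := IsCyclic.exists_monoid_generator (α := Fˣ)
    have hg1 : orderOf g = Q - 1 := by
      rw [orderOf_eq_card_of_forall_mem_powers hg, Nat.card_eq_fintype_card, Fintype.card_units]
    have h1 : IsPrimitiveRoot (g : F) (Q - 1) := by
      rw [IsPrimitiveRoot.coe_units_iff, ← hg1]; exact IsPrimitiveRoot.orderOf g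
    exact ⟨_, h1.pow (by omega) hed⟩
  let Z := (Finset.univ.filter (fun u : F => u ^ d = 1)) ×ˢ (Finset.univ : Finset F)
  have hZ0 : ∑ x ∈ Z, χ x.1 * ψ x.2 = 0 := by
    rw [Finset.sum_product]
    simp_rw [← Finset.mul_sum, ← Finset.sum_mul]
    by_cases hψ : ψ = 1
    · have hd1 : d ≠ 1 := by
        rintro rfl
        rcases hnt with h | h
        · exact h hψ
        · exact h ⟨f0, hf0, by rw [hed, mul_one]; exact hf0e⟩
      have hζ1 : ζ ≠ 1 := by
        rintro rfl
        exact hd1 (hζ.unique IsPrimitiveRoot.one)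
      have hζ0 : ζ ≠ 0 := hζ.ne_zero hd0.ne'
      have h1 : χ ζ * ∑ u : F with u ^ d = 1, χ u = ∑ u : F with u ^ d = 1, χ u := by
        rw [Finset.mul_sum]
        apply Finset.sum_nbij' (fun u => ζ * u) (fun u => ζ⁻¹ * u)
        · intro u hu; simp only [Finset.mem_filter, Finset.mem_univ, true_and] at hu ⊢
          rw [mul_pow, hζ.pow_eq_one, hu, one_mul]
        · intro u hu; simp only [Finset.mem_filter, Finset.mem_univ, true_and] at hu ⊢
          rw [mul_pow, inv_pow, hζ.pow_eq_one, hu]; simp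
        · intro u _; field_simp
        · intro u _; field_simp
        · intro u _; rw [map_mul]
      have h2 : (χ ζ - 1) * ∑ u : F with u ^ d = 1, χ u = 0 := by rw [sub_mul, h1]; ring
      rcases mul_eq_zero.1 h2 with h3 | h3
      · exact absurd (hχ ζ hζ0 (sub_eq_zero.1 h3)) hζ1
      · rw [h3, zero_mul]
    · rw [AddChar.sum_eq_zero_of_ne_one hψ, mul_zero]
  have hZcard : Z.card = d * Q := by
    rw [Finset.card_product, Finset.card_univ, ← hQ]
    congr 1
    have := hζ.card_nthRootsFinset
    refine Eq.trans ?_ this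
    congr 1
    ext u
    simp [mem_nthRootsFinset hd0]
  refine ⟨d * Q * Cst Q d f0.natDegree + f0.natDegree, ?_⟩
  intro k E _ _ _ hE
  have hinj := (algebraMap F E).injective
  have hfr : Module.finrank F E = k := by
    have h1 := Module.card_eq_pow_finrank (K := F) (V := E)
    rw [hE] at h1
    exact (Nat.pow_right_injective hQ1 h1).symm
  set fE := f0.map (algebraMap F E) with hfE
  have hfEm : fE.Monic := hf0.map _
  have hfEd : fE.natDegree = f0.natDegree := natDegree_map _
  have hpowE : ∀ e', e' ∣ d → ∀ g : E[X], g.Monic → g ^ e' = fE → e' = 1 := by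
    intro e' he' g hg hge
    have he'0 : 0 < e' := Nat.pos_of_dvd_of_pos he' hd0
    obtain ⟨g0, hg0, hg0e⟩ := descent f0 e' he'0.ne' g hg hge
    have h1 := hmax (e * e') ⟨by rw [hed]; exact Nat.mul_dvd_mul_left _ he', g0, hg0, by
      rw [mul_comm, pow_mul, hg0e, hf0e]⟩
    nlinarith
  have hfQ : fE.comp (X ^ Q) = fE ^ Q := by
    have := congrArg (map (algebraMap F E)) (FiniteField.expand_card f0)
    rw [Polynomial.map_pow, map_expand, expand_eq_comp_X_pow] at this
    exact this
  have hζE : IsPrimitiveRoot (algebraMap F E ζ) d := hζ.map_of_injective hinj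
  let N : F × F → ℕ := fun x => (Finset.univ.filter (fun α : E => fE.eval α ≠ 0 ∧
    fE.eval α ^ ((Q ^ k - 1) / d) = algebraMap F E x.1 ∧ Tr Q k α = algebraMap F E x.2)).card
  set s := √(Q : ℝ) with hs
  set U : ℝ := (Q : ℝ) ^ k / (d * Q) + Cst Q d f0.natDegree * s ^ k with hU
  have hNU : ∀ x, (N x : ℝ) ≤ U := by
    intro x
    have := stepanov Q rfl fE hfEm d hd0 hdQ _ hζE hpowE hfQ k hE (algebraMap F E x.1) (algebraMap F E x.2)
    rw [hfEd] at this
    exact this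
  -- class map
  let cl : E → F × F := fun α => (Algebra.norm F (aeval α f0) ^ e, Algebra.trace F E α)
  have hclnorm : ∀ α : E, algebraMap F E (Algebra.norm F (aeval α f0) ^ e) = fE.eval α ^ ((Q ^ k - 1) / d) := by
    intro α
    rw [map_pow, FiniteField.algebraMap_norm_eq_pow_sum, hfr, Nat.card_eq_fintype_card, ← hQ, ← pow_mul,
      hfE, eval_map_algebraMap]
    congr 1
    rw [Nat.geomSum_eq (by omega)]
    symm
    apply Nat.div_eq_of_eq_mul_left hd0
    have h1 : (Q - 1) ∣ Q ^ k - 1 := by simpa using Nat.sub_dvd_pow_sub_pow Q 1 k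
    rw [mul_assoc, ← hed, Nat.div_mul_cancel h1]
  have hcltr : ∀ α : E, algebraMap F E (Algebra.trace F E α) = Tr Q k α := by
    intro α
    rw [FiniteField.algebraMap_trace_eq_sum_pow, hfr, Nat.card_eq_fintype_card]; rfl
  let G := Finset.univ.filter (fun α : E => fE.eval α ≠ 0)
  have hclZ : ∀ α ∈ G, cl α ∈ Z := by
    intro α hα
    simp only [G, Finset.mem_filter, Finset.mem_univ, true_and] at hα
    simp only [Z, cl, Finset.mem_product, Finset.mem_filter, Finset.mem_univ, true_and, and_true]
    rw [← pow_mul, ← hed]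
    apply FiniteField.pow_card_sub_one_eq_one
    rw [Ne, Algebra.norm_eq_zero_iff]
    rwa [hfE, eval_map_algebraMap] at hα
  have hNcl : ∀ x, N x = (G.filter (fun α => cl α = x)).card := by
    intro x
    simp only [N, G, Finset.filter_filter]
    congr 1
    ext α
    simp only [Finset.mem_filter, Finset.mem_univ, true_and]
    constructor
    · rintro ⟨h1, h2, h3⟩
      refine ⟨h1, Prod.ext ?_ ?_⟩
      · apply hinj; rw [← h2]; exact hclnorm α
      · apply hinj; rw [← h3]; exact hcltr α
    · rintro ⟨h1, rfl⟩
      exact ⟨h1, (hclnorm α).symm, (hcltr α).symm⟩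
  have hGcard : (Fintype.card E : ℝ) - f0.natDegree ≤ G.card := by
    have h1 := Finset.card_filter_add_card_filter_not (s := (Finset.univ : Finset E)) (fun α : E => fE.eval α ≠ 0)
    have h2 : (Finset.univ.filter (fun α : E => ¬ fE.eval α ≠ 0)).card ≤ f0.natDegree := by
      rw [← hfEd]
      calc _ ≤ fE.roots.toFinset.card := by
            apply Finset.card_le_card
            intro α hα
            simp only [Finset.mem_filter, Finset.mem_univ, true_and, not_not] at hα
            rw [Multiset.mem_toFinset, mem_roots hfEm.ne_zero]; exact hα
        _ ≤ _ := Multiset.toFinset_card_le _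
        _ ≤ _ := card_roots' _
    rw [Finset.card_univ] at h1
    have h3 : (Fintype.card E : ℝ) ≤ G.card + f0.natDegree := by
      have : Fintype.card E ≤ G.card + f0.natDegree := by
        have : G.card = (Finset.univ.filter (fun α : E => fE.eval α ≠ 0)).card := rfl
        omega
      exact_mod_cast this
    linarith
  have hsumN : ∑ x ∈ Z, (N x : ℝ) = G.card := by
    rw [Finset.card_eq_sum_card_fiberwise (f := cl) (t := Z) hclZ]
    push_cast
    refine Finset.sum_congr rfl fun x _ => ?_
    rw [hNcl]
  have hcs : cs χ ψ f E = ∑ x ∈ Z, (N x : ℂ) * (χ x.1 * ψ x.2) := by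
    have h1 : cs χ ψ f E = ∑ α ∈ G, χ (cl α).1 * ψ (cl α).2 := by
      unfold cs
      rw [Finset.sum_filter]
      refine Finset.sum_congr rfl fun α _ => ?_
      split_ifs with h
      · simp only [cl]
        rw [← hf0e, map_pow, map_pow]
      · push Not at h
        rw [hfE, eval_map_algebraMap] at h
        rw [← hf0e, map_pow, h, zero_pow he0.ne', Algebra.norm_zero, MulChar.map_nonunit _ (by simp)]; simp
    rw [h1, ← Finset.sum_fiberwise_of_maps_to hclZ]
    refine Finset.sum_congr rfl fun x _ => ?_
    rw [hNcl, ← nsmul_eq_mul, ← Finset.sum_const]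
    refine Finset.sum_congr rfl fun α hα => ?_
    rw [(Finset.mem_filter.1 hα).2]
  have hcs2 : cs χ ψ f E = ∑ x ∈ Z, ((N x : ℂ) - (U : ℂ)) * (χ x.1 * ψ x.2) := by
    simp_rw [sub_mul]
    rw [Finset.sum_sub_distrib, ← Finset.mul_sum, hZ0, mul_zero, sub_zero, hcs]
  rw [hcs2]
  calc _ ≤ ∑ x ∈ Z, ‖((N x : ℂ) - (U : ℂ)) * (χ x.1 * ψ x.2)‖ := norm_sum_le _ _
    _ ≤ ∑ x ∈ Z, (U - N x) := by
      refine Finset.sum_le_sum fun x _ => ?_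
      rw [norm_mul, norm_mul, AddChar_norm, mul_one]
      have h1 : ‖((N x : ℂ) - (U : ℂ))‖ = U - N x := by
        rw [norm_sub_rev, ← Complex.ofReal_natCast, ← Complex.ofReal_sub, Complex.norm_real, Real.norm_of_nonneg]
        linarith [hNU x]
      rw [h1]
      exact mul_le_of_le_one_right (by linarith [hNU x]) (MulChar_norm_le χ _)
    _ = d * Q * U - G.card := by
      rw [Finset.sum_sub_distrib, hsumN, Finset.sum_const, hZcard]; simp
    _ ≤ (d * Q * Cst Q d f0.natDegree) * s ^ k + f0.natDegree := by
      have h1 : (d * Q : ℝ) * U = (Q : ℝ) ^ k + d * Q * (Cst Q d f0.natDegree * s ^ k) := by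
        rw [hU, mul_add, mul_div_cancel₀]
        have : 0 < d * Q := by positivity
        exact_mod_cast this.ne'
      rw [h1]
      rw [hE] at hGcard
      push_cast at hGcard
      linarith
    _ ≤ _ := by
      rw [add_mul]
      have : (1 : ℝ) ≤ s ^ k := by
        apply one_le_pow₀
        rw [hs, Real.one_le_sqrt]; exact_mod_cast hQ1.le
      have h2 : (0 : ℝ) ≤ f0.natDegree := by positivity
      nlinarith

end W

open Polynomial
namespace W

theorem expo_sum_zero (w : ℂ) (B : ℝ) (hB : 0 < B) (hw : B < ‖w‖) (V : Finset ℂ) :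
    ∀ (c : ℂ → ℂ) (C : ℝ), w ∉ V →
    (∀ k : ℕ, 1 ≤ k → ‖c w * w ^ k + ∑ v ∈ V, c v * v ^ k‖ ≤ C * B ^ k) → c w = 0 := by
  classical
  induction V using Finset.induction_on with
  | empty =>
    intro c C _ h
    by_contra hc
    have hc' : 0 < ‖c w‖ := norm_pos_iff.mpr hc
    have h1 : 1 < ‖w‖ / B := (one_lt_div hB).mpr hw
    obtain ⟨k, hk⟩ := pow_unbounded_of_one_lt (C / ‖c w‖) h1
    have hk2 : C / ‖c w‖ < (‖w‖ / B) ^ (k+1) :=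
      hk.trans_le (pow_le_pow_right₀ h1.le (Nat.le_succ k))
    have h2 := h (k+1) (by omega)
    simp only [Finset.sum_empty, add_zero, norm_mul, norm_pow] at h2
    rw [div_pow, div_lt_div_iff₀ hc' (by positivity)] at hk2
    nlinarith
  | insert u V hu ih =>
    intro c C hw' h
    have hne : w ≠ u := fun h' => hw' (by simp [h'])
    have := ih (fun v => c v * (v - u)) (C * B + ‖u‖ * C) (fun h' => hw' (by simp [h'])) (by
      intro k hk
      have e : c w * (w - u) * w ^ k + ∑ v ∈ V, c v * (v - u) * v ^ k
         = (c w * w ^ (k+1) + ∑ v ∈ insert u V, c v * v ^ (k+1))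
           - u * (c w * w ^ k + ∑ v ∈ insert u V, c v * v ^ k) := by
        rw [Finset.sum_insert hu, Finset.sum_insert hu]
        have : ∑ v ∈ V, c v * (v - u) * v ^ k = ∑ v ∈ V, c v * v ^ (k+1) - u * ∑ v ∈ V, c v * v ^ k := by
          rw [Finset.mul_sum, ← Finset.sum_sub_distrib]
          exact Finset.sum_congr rfl fun v _ => by ring
        rw [this]; ring
      rw [e]
      refine (norm_sub_le _ _).trans ?_
      rw [norm_mul]
      have h1 := h (k+1) (by omega)
      have h2 := mul_le_mul_of_nonneg_left (h k hk) (norm_nonneg u)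
      calc _ ≤ C * B ^ (k+1) + ‖u‖ * (C * B ^ k) := add_le_add h1 h2
        _ = _ := by ring)
    rcases mul_eq_zero.mp this with h1 | h1
    · exact h1
    · exact absurd (sub_eq_zero.mp h1) hne

open PowerSeries in
theorem psp (v : ℂ) : (1 - PowerSeries.C v * PowerSeries.X) * PowerSeries.mk (fun k => if k = 0 then 0 else v ^ k)
    = PowerSeries.C v * PowerSeries.X := by
  ext k
  rw [sub_mul, one_mul, mul_assoc]
  rcases k with _ | k
  · simp
  · simp only [map_sub, PowerSeries.coeff_mk, PowerSeries.coeff_C_mul, PowerSeries.coeff_succ_X_mul]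
    rcases k with _ | k
    · simp [PowerSeries.coeff_X]
    · simp [PowerSeries.coeff_X, pow_succ]; ring

noncomputable def pp (v : ℂ) : PowerSeries ℂ := PowerSeries.mk (fun k => if k = 0 then 0 else v ^ k)

noncomputable def DD (A : PowerSeries ℂ) : PowerSeries ℂ := PowerSeries.X * PowerSeries.derivative ℂ A

theorem DD_mul (A B) : DD (A * B) = DD A * B + A * DD B := by
  simp only [DD, Derivation.leibniz, smul_eq_mul]; ring

theorem DD_coeff (A) (k) : PowerSeries.coeff k (DD A) = k * PowerSeries.coeff k A := by
  unfold DD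
  rcases k with _ | k
  · simp
  · rw [PowerSeries.coeff_succ_X_mul, PowerSeries.coeff_derivative]
    push_cast; ring

theorem DD_lin (v : ℂ) : DD (1 - PowerSeries.C v * PowerSeries.X) = - (pp v) * (1 - PowerSeries.C v * PowerSeries.X) := by
  have := psp v
  rw [neg_mul, mul_comm (pp v), pp, this]
  unfold DD
  simp [Derivation.leibniz, PowerSeries.derivative_C, PowerSeries.derivative_X]
  ring

theorem DD_prod (Ω : Multiset ℂ) :
    DD (Ω.map fun v => 1 - PowerSeries.C v * PowerSeries.X).prod
     = - (Ω.map pp).sum * (Ω.map fun v => 1 - PowerSeries.C v * PowerSeries.X).prod := by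
  induction Ω using Multiset.induction_on with
  | empty => simp [DD]
  | cons a s ih =>
    simp only [Multiset.map_cons, Multiset.prod_cons, Multiset.sum_cons]
    rw [DD_mul, ih, DD_lin]; ring

theorem factor_ps (b : ℕ → ℂ) (N : ℕ) (h0 : b 0 = 1) (hb : ∀ d, N < d → b d = 0) :
    ∃ Ω : Multiset ℂ, Ω.card ≤ N ∧
      PowerSeries.mk b = (Ω.map fun v => 1 - PowerSeries.C v * PowerSeries.X).prod := by
  set B : ℂ[X] := ∑ d ∈ Finset.range (N+1), Polynomial.C (b d) * Polynomial.X ^ d with hBdef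
  have hBc : ∀ d, B.coeff d = b d := by
    intro d
    rw [hBdef, finsetSum_coeff]
    simp only [coeff_C_mul, coeff_X_pow, mul_ite, mul_one, mul_zero]
    rw [Finset.sum_ite_eq]
    split_ifs with h
    · rfl
    · rw [hb d (by simpa using h)]
  have hdeg : B.natDegree ≤ N := by
    rw [natDegree_le_iff_coeff_eq_zero]
    intro d hd
    rw [hBc, hb d hd]
  have hspl : B.Splits := IsAlgClosed.splits B
  have hfac := hspl.eq_prod_roots
  have he0 : B.eval 0 = 1 := by rw [← coeff_zero_eq_eval_zero, hBc, h0]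
  have hr0 : (0:ℂ) ∉ B.roots := by
    intro h
    have := (mem_roots'.mp h).2
    rw [IsRoot, he0] at this
    exact one_ne_zero this
  have hfe : B.leadingCoeff * (B.roots.map fun r => -r).prod = 1 := by
    rw [← he0]
    conv_rhs => rw [hfac]
    rw [eval_mul, eval_C, eval_multiset_prod, Multiset.map_map]
    simp
  have hms : (B.roots.map fun a => (Polynomial.X - Polynomial.C a)) =
      B.roots.map fun r => Polynomial.C (-r) * (1 - Polynomial.C r⁻¹ * Polynomial.X) := by
    refine Multiset.map_congr rfl fun r hr => ?_
    have hrne : r ≠ 0 := fun h => hr0 (h ▸ hr)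
    rw [mul_sub, ← mul_assoc, ← Polynomial.C_mul]
    rw [show -r * r⁻¹ = -1 by field_simp]
    simp; ring
  have hB2 : B = (B.roots.map fun r => (1 - Polynomial.C r⁻¹ * Polynomial.X)).prod := by
    conv_lhs => rw [hfac]
    rw [hms, Multiset.prod_map_mul, ← mul_assoc]
    have : (B.roots.map fun r => Polynomial.C (-r)).prod = Polynomial.C ((B.roots.map fun r => -r).prod) := by
      rw [map_multiset_prod, Multiset.map_map]; rfl
    rw [this, ← Polynomial.C_mul, hfe]; simp
  refine ⟨B.roots.map fun r => r⁻¹, ?_, ?_⟩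
  · rw [Multiset.card_map]
    exact (card_roots' B).trans hdeg
  · rw [Multiset.map_map]
    have h1 : PowerSeries.mk b = (B : PowerSeries ℂ) := by
      ext d; simp [hBc]
    rw [h1]
    conv_lhs => rw [hB2]
    rw [← Polynomial.coeToPowerSeries.ringHom_apply, map_multiset_prod, Multiset.map_map]
    congr 1
    refine Multiset.map_congr rfl fun r _ => ?_
    simp

theorem newton (a S : ℕ → ℂ) (q : ℂ) (N : ℕ) (h0 : a 0 = 1) (hS0 : S 0 = 0)
    (hrec : ∀ d : ℕ, (d : ℂ) * a d = ∑ x ∈ Finset.HasAntidiagonal.antidiagonal d, S x.1 * a x.2)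
    (hq : ∀ d, N ≤ d → a (d+1) = q * a d) :
    ∃ Ω : Multiset ℂ, Ω.card ≤ N ∧ ∀ k, 1 ≤ k → S k = q ^ k - (Ω.map fun v => v ^ k).sum := by
  set A := PowerSeries.mk a
  have hA : DD A = PowerSeries.mk S * A := by
    ext d
    rw [DD_coeff, PowerSeries.coeff_mul]
    simp [A, hrec]
  obtain ⟨Ω, hΩ, hB⟩ := factor_ps (fun d => a d - if d = 0 then 0 else q * a (d-1)) N (by simp [h0]) (by
    intro d hd
    obtain ⟨e, rfl⟩ : ∃ e, d = e + 1 := ⟨d-1, by omega⟩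
    simp [hq e (by omega)])
  have hB' : (1 - PowerSeries.C q * PowerSeries.X) * A = (Ω.map fun v => 1 - PowerSeries.C v * PowerSeries.X).prod := by
    rw [← hB]
    ext d
    rw [sub_mul, one_mul, mul_assoc]
    rcases d with _ | d
    · simp [A]
    · simp [A, PowerSeries.coeff_C_mul, PowerSeries.coeff_succ_X_mul]
  have h1 := DD_prod Ω
  rw [← hB', DD_mul, DD_lin, hA] at h1
  have hA0 : A ≠ 0 := by
    intro h
    have := congrArg (PowerSeries.coeff 0) h
    simp [A, h0] at this
  have hl0 : (1 - PowerSeries.C q * PowerSeries.X : PowerSeries ℂ) ≠ 0 := by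
    intro h
    have := congrArg (PowerSeries.coeff 0) h
    simp at this
  have h2 : PowerSeries.mk S = pp q - (Ω.map pp).sum := by
    apply mul_right_cancel₀ hA0
    apply mul_left_cancel₀ hl0
    linear_combination h1
  refine ⟨Ω, hΩ, fun k hk => ?_⟩
  have h3 := congrArg (PowerSeries.coeff k) h2
  have hk0 : k ≠ 0 := by omega
  rw [map_sub, map_multiset_sum, Multiset.map_map] at h3
  have h4 : (PowerSeries.coeff k ∘ pp) = fun v => v ^ k := by
    funext v; simp [pp, hk0]
  rw [h4] at h3
  simpa [pp, hk0] using h3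

theorem sum_bound (S : ℕ → ℂ) (q : ℝ) (hq : 1 < q) (Ω : Multiset ℂ) (C : ℝ)
    (h : ∀ k, 1 ≤ k → S k = (q : ℂ) ^ k - (Ω.map fun v => v ^ k).sum)
    (hS : ∀ k, 1 ≤ k → ‖S k‖ ≤ C * √q ^ k) : ‖S 1‖ + √q ≤ Ω.card * √q := by
  classical
  have key : ∀ w : ℂ, √q < ‖w‖ → (if w = (q:ℂ) then (1:ℂ) else 0) - Ω.count w = 0 := by
    intro w hw
    refine expo_sum_zero w (√q) (by positivity) hw ((insert (q:ℂ) (insert w Ω.toFinset)).erase w)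
      (fun w => (if w = (q:ℂ) then (1:ℂ) else 0) - Ω.count w) C (by simp) ?_
    intro k hk
    rw [Finset.add_sum_erase _ (fun w : ℂ => ((if w = (q:ℂ) then (1:ℂ) else 0) - Ω.count w) * w ^ k) (by simp)]
    refine le_of_eq_of_le ?_ (hS k hk)
    congr 1
    rw [h k hk]
    simp only [sub_mul, Finset.sum_sub_distrib, ite_mul, one_mul, zero_mul]
    congr 1
    · simp
    · rw [Finset.sum_multiset_map_count]
      symm
      refine (Finset.sum_subset (fun x hx => by simp at hx ⊢; tauto) ?_).trans (Finset.sum_congr rfl fun x _ => by simp)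
      intro x _ hx
      simp only [Multiset.mem_toFinset] at hx
      simp [Multiset.count_eq_zero_of_notMem hx]
  have hqq : √q < q := by
    rw [Real.sqrt_lt' (by linarith)]; nlinarith
  have hqn : ‖(q:ℂ)‖ = q := by simp; linarith
  have h1 := key q (by rw [hqn]; exact hqq)
  simp only [if_true] at h1
  have hc : Ω.count (q:ℂ) = 1 := by
    have : (Ω.count (q:ℂ) : ℂ) = 1 := by linear_combination -h1
    exact_mod_cast this
  have hmem : (q:ℂ) ∈ Ω := by rw [← Multiset.one_le_count_iff_mem]; omega
  obtain ⟨Ω', rfl⟩ := Multiset.exists_cons_of_mem hmem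
  have hle : ∀ w ∈ Ω', ‖w‖ ≤ √q := by
    intro w hw
    by_contra hcon
    push Not at hcon
    have h2 := key w hcon
    by_cases hwq : w = q
    · subst hwq
      rw [Multiset.count_cons_self] at hc
      have := Multiset.one_le_count_iff_mem.mpr hw
      omega
    · rw [if_neg hwq, Multiset.count_cons_of_ne hwq] at h2
      have := Multiset.one_le_count_iff_mem.mpr hw
      have h3 : (Ω'.count w : ℂ) = 0 := by linear_combination -h2
      have : Ω'.count w = 0 := by exact_mod_cast h3
      omega
  have hS1 := h 1 le_rfl
  simp only [pow_one, Multiset.map_id', Multiset.sum_cons] at hS1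
  have : ‖S 1‖ ≤ Ω'.card * √q := by
    rw [hS1]
    have : (q:ℂ) - (q + Ω'.sum) = - Ω'.sum := by ring
    rw [this, norm_neg]
    refine (norm_multiset_sum_le _).trans ?_
    have := Multiset.sum_le_card_nsmul (Ω'.map norm) (√q) (by simpa using hle)
    simpa using this
  rw [Multiset.card_cons]; push_cast; linarith

end W

open Polynomial
namespace W
open UniqueFactorizationMonoid
section
variable {F : Type} [Field F] [Fintype F]

lemma finite_le (d : ℕ) : {h : F[X] | h.natDegree ≤ d}.Finite := by
  have : Finite (degreeLT F (d+1)) := Finite.of_equiv _ (degreeLTEquiv F (d+1)).symm.toEquiv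
  refine Set.Finite.subset (Set.toFinite (degreeLT F (d+1) : Set F[X])) ?_
  intro h hh
  simp only [Set.mem_ofPred_eq] at hh
  simp only [SetLike.mem_coe, mem_degreeLT]
  exact lt_of_le_of_lt degree_le_natDegree (by exact_mod_cast Nat.lt_succ_of_le hh)

variable (F) in
noncomputable def Mon (d : ℕ) : Finset F[X] :=
  (Set.Finite.subset (t := {h : F[X] | h.Monic ∧ h.natDegree = d}) (finite_le d) (fun _ hh => hh.2.le)).toFinset

lemma mem_Mon {d : ℕ} {h : F[X]} : h ∈ Mon F d ↔ h.Monic ∧ h.natDegree = d := by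
  simp [Mon]

variable (F) in
noncomputable def IrrD (k : ℕ) : Finset F[X] :=
  (Set.Finite.subset (t := {h : F[X] | h.Monic ∧ Irreducible h ∧ h.natDegree ≤ k ∧ h.natDegree ∣ k})
    (finite_le k) (fun _ hh => hh.2.2.1)).toFinset

lemma mem_IrrD {d : ℕ} {h : F[X]} : h ∈ IrrD F d ↔ h.Monic ∧ Irreducible h ∧ h.natDegree ≤ d ∧ h.natDegree ∣ d := by
  simp [IrrD]

noncomputable def TT (Λ : F[X] → ℂ) (k : ℕ) : ℂ := ∑ P ∈ IrrD F k, (P.natDegree : ℂ) * Λ P ^ (k / P.natDegree)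

open Classical in
lemma deg_count (h : F[X]) (hm : h.Monic) (d : ℕ) (hd : h.natDegree = d) :
    (d : ℂ) = ∑ k ∈ Finset.Icc 1 d, ∑ P ∈ IrrD F k, if P ^ (k / P.natDegree) ∣ h then (P.natDegree : ℂ) else 0 := by
  classical
  have hpr : (normalizedFactors h).prod = h := by
    rw [prod_normalizedFactors_eq hm.ne_zero, hm.normalize_eq_self]
  have hmem : ∀ P ∈ normalizedFactors h, P.Monic ∧ Irreducible P := by
    intro P hP
    have := irreducible_of_normalized_factor P hP
    refine ⟨?_, this⟩
    have h2 := normalize_normalized_factor P hP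
    rw [← h2]
    exact Polynomial.monic_normalize this.ne_zero
  have hdeg : d = ∑ P ∈ (normalizedFactors h).toFinset, (normalizedFactors h).count P * P.natDegree := by
    rw [← hd]
    conv_lhs => rw [← hpr]
    rw [natDegree_multiset_prod_of_monic _ (fun P hP => (hmem P hP).1), Finset.sum_multiset_map_count]
    simp
  have hcount : ∀ P, P ∈ normalizedFactors h → ∀ j, P ^ j ∣ h ↔ j ≤ (normalizedFactors h).count P := by
    intro P hP j
    rw [pow_dvd_iff_le_emultiplicity, emultiplicity_eq_count_normalizedFactors (hmem P hP).2 hm.ne_zero,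
      (hmem P hP).1.normalize_eq_self]
    exact Nat.cast_le
  -- rewrite inner sums
  have hinner : ∀ k ∈ Finset.Icc 1 d, (∑ P ∈ IrrD F k, if P ^ (k / P.natDegree) ∣ h then (P.natDegree : ℂ) else 0)
      = ∑ P ∈ (normalizedFactors h).toFinset,
          if P.natDegree ∣ k ∧ P ^ (k / P.natDegree) ∣ h then (P.natDegree : ℂ) else 0 := by
    intro k hk
    rw [Finset.mem_Icc] at hk
    rw [← Finset.sum_filter, ← Finset.sum_filter]
    apply Finset.sum_congr _ fun _ _ => rfl
    ext P
    simp only [Finset.mem_filter, mem_IrrD, Multiset.mem_toFinset]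
    constructor
    · rintro ⟨⟨h1, h2, h3, h4⟩, h5⟩
      refine ⟨?_, h4, h5⟩
      rw [UniqueFactorizationMonoid.mem_normalizedFactors_iff' hm.ne_zero]
      refine ⟨h2, h1.normalize_eq_self, ?_⟩
      refine (dvd_pow_self P ?_).trans h5
      have := Nat.div_pos h3 h2.natDegree_pos
      omega
    · rintro ⟨h1, h2, h3⟩
      exact ⟨⟨(hmem P h1).1, (hmem P h1).2, Nat.le_of_dvd (by omega) h2, h2⟩, h3⟩
  rw [Finset.sum_congr rfl hinner, Finset.sum_comm]
  conv_lhs => rw [hdeg]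
  push_cast
  refine Finset.sum_congr rfl fun P hP => ?_
  rw [Multiset.mem_toFinset] at hP
  rw [← Finset.sum_filter, Finset.sum_const, nsmul_eq_mul]
  congr 2
  have hp0 := (hmem P hP).2.natDegree_pos
  have : (Finset.Icc 1 d).filter (fun k => P.natDegree ∣ k ∧ P ^ (k / P.natDegree) ∣ h)
     = (Finset.Icc 1 ((normalizedFactors h).count P)).image (fun j => P.natDegree * j) := by
    ext k
    simp only [Finset.mem_filter, Finset.mem_Icc, Finset.mem_image]
    constructor
    · rintro ⟨⟨h1, h2⟩, ⟨j, rfl⟩, h4⟩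
      rw [Nat.mul_div_cancel_left _ hp0, hcount P hP] at h4
      refine ⟨j, ⟨Nat.pos_of_ne_zero (by rintro rfl; simp at h1), h4⟩, rfl⟩
    · rintro ⟨j, ⟨h1, h2⟩, rfl⟩
      refine ⟨⟨Nat.mul_pos hp0 h1, ?_⟩, dvd_mul_right _ _, ?_⟩
      · have := natDegree_le_of_dvd ((hcount P hP j).mpr h2) hm.ne_zero
        rw [natDegree_pow, hd] at this
        linarith
      · rw [Nat.mul_div_cancel_left _ hp0]; exact (hcount P hP j).mpr h2
  rw [this, Finset.card_image_of_injective _ (fun a b hab => Nat.eq_of_mul_eq_mul_left hp0 hab)]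
  simp

lemma Lam_pow (Λ : F[X] → ℂ) (h1 : Λ 1 = 1) (hmul : ∀ g h : F[X], g.Monic → h.Monic → Λ (g * h) = Λ g * Λ h)
   (g : F[X]) (hg : g.Monic) (j : ℕ) : Λ (g ^ j) = Λ g ^ j := by
  induction j with
  | zero => simp [h1]
  | succ j ih => rw [pow_succ, hmul _ _ (hg.pow j) hg, ih, pow_succ]

lemma Lrec (Λ : F[X] → ℂ) (h1 : Λ 1 = 1) (hmul : ∀ g h : F[X], g.Monic → h.Monic → Λ (g * h) = Λ g * Λ h)
    (d : ℕ) : (d : ℂ) * ∑ h ∈ Mon F d, Λ h =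
      ∑ x ∈ Finset.HasAntidiagonal.antidiagonal d, (if x.1 = 0 then 0 else TT Λ x.1) * ∑ h ∈ Mon F x.2, Λ h := by
  classical
  have e1 : (d : ℂ) * ∑ h ∈ Mon F d, Λ h = ∑ h ∈ Mon F d, ∑ k ∈ Finset.Icc 1 d, ∑ P ∈ IrrD F k,
      (if P ^ (k / P.natDegree) ∣ h then (P.natDegree : ℂ) * Λ h else 0) := by
    rw [Finset.mul_sum]
    refine Finset.sum_congr rfl fun h hh => ?_
    rw [mem_Mon] at hh
    rw [deg_count h hh.1 d hh.2, Finset.sum_mul]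
    refine Finset.sum_congr rfl fun k _ => ?_
    rw [Finset.sum_mul]
    refine Finset.sum_congr rfl fun P _ => ?_
    split_ifs <;> simp
  rw [e1, Finset.sum_comm]
  have e2 : ∀ k ∈ Finset.Icc 1 d, (∑ h ∈ Mon F d, ∑ P ∈ IrrD F k,
      (if P ^ (k / P.natDegree) ∣ h then (P.natDegree : ℂ) * Λ h else 0)) = TT Λ k * ∑ h ∈ Mon F (d-k), Λ h := by
    intro k hk
    rw [Finset.mem_Icc] at hk
    rw [Finset.sum_comm, TT, Finset.sum_mul]
    refine Finset.sum_congr rfl fun P hP => ?_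
    rw [mem_IrrD] at hP
    obtain ⟨hm, hirr, hle, hdv⟩ := hP
    rw [← Finset.sum_filter, Finset.mul_sum]
    symm
    have hdd : (P ^ (k / P.natDegree)).natDegree = k := by
      rw [natDegree_pow, Nat.div_mul_cancel hdv]
    have hmp := hm.pow (k / P.natDegree)
    refine Finset.sum_bij (fun g _ => P ^ (k / P.natDegree) * g) ?_ ?_ ?_ ?_
    · intro g hg
      rw [mem_Mon] at hg
      rw [Finset.mem_filter, mem_Mon]
      refine ⟨⟨hmp.mul hg.1, ?_⟩, dvd_mul_right _ _⟩
      rw [hmp.natDegree_mul hg.1, hdd, hg.2]; omega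
    · intro a _ b _ hab
      exact mul_left_cancel₀ hmp.ne_zero hab
    · intro b hb
      rw [Finset.mem_filter, mem_Mon] at hb
      obtain ⟨⟨hb1, hb2⟩, g, rfl⟩ := hb
      have hg : g.Monic := hmp.of_mul_monic_left hb1
      refine ⟨g, ?_, rfl⟩
      rw [mem_Mon]
      refine ⟨hg, ?_⟩
      rw [hmp.natDegree_mul hg, hdd] at hb2; omega
    · intro g hg
      rw [mem_Mon] at hg
      rw [hmul _ _ hmp hg.1, Lam_pow Λ h1 hmul P hm]; ring
  rw [Finset.sum_congr rfl e2, Finset.Nat.sum_antidiagonal_eq_sum_range_succ_mk, Finset.sum_range_succ']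
  simp only [if_true, zero_mul, add_zero, Nat.add_eq_zero_iff, one_ne_zero, and_false, if_false]
  rw [Finset.range_eq_Ico, Finset.sum_Ico_add' (fun k => TT Λ k * ∑ h ∈ Mon F (d - k), Λ h)]
  rfl

lemma card_fiber (E : Type) [Field E] [Fintype E] [Algebra F E] (k : ℕ) (hk : 1 ≤ k)
    (hE : Fintype.card E = Fintype.card F ^ k) [DecidableEq F[X]] (P : F[X]) (hP : P ∈ IrrD F k) :
    (Finset.univ.filter (fun α : E => minpoly F α = P)).card = P.natDegree := by
  classical
  rw [mem_IrrD] at hP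
  obtain ⟨hm, hirr, hle, hdv⟩ := hP
  have hPne : P.map (algebraMap F E) ≠ 0 := (hm.map _).ne_zero
  have e : Finset.univ.filter (fun α : E => minpoly F α = P) = (P.map (algebraMap F E)).roots.toFinset := by
    ext α
    simp only [Finset.mem_filter, Finset.mem_univ, true_and, Multiset.mem_toFinset, mem_roots hPne, IsRoot,
      eval_map_algebraMap]
    constructor
    · rintro rfl; exact minpoly.aeval F α
    · intro h; exact (minpoly.eq_of_irreducible_of_monic hirr h hm).symm
  have hdvd : P ∣ X ^ (Nat.card F) ^ k - X := (hirr.natDegree_dvd_iff_dvd_X_pow_card_pow_sub_X).mp hdv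
  have hspl : (P.map (algebraMap F E)).Splits := by
    have h1 : (X ^ Fintype.card E - X : E[X]).Splits := by
      rw [splits_iff_card_roots, FiniteField.roots_X_pow_card_sub_X,
        FiniteField.X_pow_card_sub_X_natDegree_eq E Fintype.one_lt_card]; rfl
    refine h1.of_dvd (FiniteField.X_pow_card_sub_X_ne_zero E Fintype.one_lt_card) ?_
    have := Polynomial.map_dvd (algebraMap F E) hdvd
    rw [Nat.card_eq_fintype_card, ← hE] at this
    simpa using this
  have hsep : (P.map (algebraMap F E)).Separable := (PerfectField.separable_of_irreducible hirr).map
  rw [e, Multiset.toFinset_card_of_nodup (nodup_roots hsep), ← natDegree_map (algebraMap F E), hspl.natDegree_eq_card_roots]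

lemma minpoly_mem (E : Type) [Field E] [Fintype E] [Algebra F E] (k : ℕ) (hk : 1 ≤ k)
    (hE : Fintype.card E = Fintype.card F ^ k) (α : E) : minpoly F α ∈ IrrD F k := by
  have : FiniteDimensional F E := Module.Finite.of_finite
  have hr : Module.finrank F E = k := by
    have := Module.card_eq_pow_finrank (K := F) (V := E)
    rw [hE] at this
    exact (Nat.pow_right_injective Fintype.one_lt_card this).symm
  have hintg : IsIntegral F α := Algebra.IsIntegral.isIntegral α
  have hd : (minpoly F α).natDegree ∣ k := by rw [← hr]; exact minpoly.degree_dvd hintg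
  rw [mem_IrrD]
  exact ⟨minpoly.monic hintg, minpoly.irreducible hintg, Nat.le_of_dvd hk hd, hd⟩

lemma TT_eq (Λ : F[X] → ℂ) (h1 : Λ 1 = 1) (hmul : ∀ g h : F[X], g.Monic → h.Monic → Λ (g * h) = Λ g * Λ h)
    (E : Type) [Field E] [Fintype E] [Algebra F E] (k : ℕ) (hk : 1 ≤ k)
    (hE : Fintype.card E = Fintype.card F ^ k) :
    TT Λ k = ∑ α : E, Λ (minpoly F α ^ (k / (minpoly F α).natDegree)) := by
  classical
  rw [← Finset.sum_fiberwise_of_maps_to (t := IrrD F k) (g := fun α : E => minpoly F α)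
    (fun α _ => minpoly_mem E k hk hE α), TT]
  refine Finset.sum_congr rfl fun P hP => ?_
  rw [Finset.sum_congr rfl (g := fun _ => Λ P ^ (k / P.natDegree)), Finset.sum_const, card_fiber E k hk hE P hP, nsmul_eq_mul]
  intro α hα
  rw [Finset.mem_filter] at hα
  rw [hα.2, Lam_pow Λ h1 hmul P (mem_IrrD.mp hP).1]

end
end W

open Polynomial
namespace W
open UniqueFactorizationMonoid
section
variable {F : Type} [Field F] [Fintype F]

lemma frobQ (E : Type) [Field E] [Algebra F E] :
    ∃ φ : E →+* E, (∀ x, φ x = x ^ Fintype.card F) ∧ ∀ y : F, φ (algebraMap F E y) = algebraMap F E y := by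
  obtain ⟨p, hp⟩ := CharP.exists F
  have : Fact p.Prime := ⟨CharP.char_is_prime F p⟩
  have : CharP E p := (RingHom.charP_iff (algebraMap F E) (algebraMap F E).injective p).1 hp
  obtain ⟨n, -, hn⟩ := FiniteField.card F p
  have hφ : ∀ x : E, iterateFrobenius E p n x = x ^ Fintype.card F := by
    intro x; rw [hn]; exact iterateFrobenius_def p n x
  refine ⟨iterateFrobenius E p n, hφ, fun y => ?_⟩
  rw [hφ, ← map_pow, FiniteField.pow_card]

lemma aeval_pow_Q (E : Type) [Field E] [Algebra F E] (f : F[X]) (α : E) (i : ℕ) :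
    aeval (α ^ Fintype.card F ^ i) f = (aeval α f) ^ Fintype.card F ^ i := by
  obtain ⟨φ, h1, h2⟩ := frobQ (F := F) E
  induction i with
  | zero => simp
  | succ i ih =>
    rw [pow_succ, pow_mul, pow_mul, ← ih, ← h1, ← h1]
    have : (⟨φ, h2⟩ : E →ₐ[F] E) (aeval (α ^ Fintype.card F ^ i) f) = aeval (φ (α ^ Fintype.card F ^ i)) f :=
      (aeval_algHom_apply (⟨φ, h2⟩ : E →ₐ[F] E) _ f).symm
    rw [← this]; rfl

lemma minpoly_pow_map (E : Type) [Field E] [Fintype E] [Algebra F E] (k : ℕ) (hk : 1 ≤ k)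
    (hE : Fintype.card E = Fintype.card F ^ k) (α : E) :
    (minpoly F α ^ (k / (minpoly F α).natDegree)).map (algebraMap F E)
      = ∏ i ∈ Finset.range k, (X - C (α ^ Fintype.card F ^ i)) := by
  classical
  obtain ⟨φ, h1, h2⟩ := frobQ (F := F) E
  set T : E[X] := ∏ i ∈ Finset.range k, (X - C (α ^ Fintype.card F ^ i)) with hT
  have hTm : T.Monic := monic_prod_of_monic _ _ fun i _ => monic_X_sub_C _
  have hTdeg : T.natDegree = k := by
    rw [hT, natDegree_prod_of_monic _ _ (fun i _ => monic_X_sub_C _)]; simp only [natDegree_X_sub_C]; simp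
  have hTφ : T.map φ = T := by
    have : T.map φ = ∏ i ∈ Finset.range k, (X - C (α ^ Fintype.card F ^ (i+1))) := by
      rw [hT, Polynomial.map_prod]
      refine Finset.prod_congr rfl fun i _ => ?_
      rw [Polynomial.map_sub, map_X, map_C, h1, ← pow_mul, pow_succ]
    rw [this, hT]
    have e1 := Finset.prod_range_succ (fun i => (X - C (α ^ Fintype.card F ^ i))) k
    have e2 := Finset.prod_range_succ' (fun i => (X - C (α ^ Fintype.card F ^ i))) k
    rw [e1] at e2
    have : α ^ Fintype.card F ^ k = α := by rw [← hE, FiniteField.pow_card]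
    rw [this, pow_zero, pow_one] at e2
    exact (mul_right_cancel₀ (X_sub_C_ne_zero α) e2).symm
  have h3 : T ∈ lifts (algebraMap F E) := by
    rw [lifts_iff_coeff_lifts]
    intro i; apply mem_range_of_pow
    rw [← h1, ← coeff_map, hTφ]
  obtain ⟨T0, hT0, hT0d, hm⟩ := lifts_and_natDegree_eq_and_monic h3 hTm
  have hintg : IsIntegral F α := Algebra.IsIntegral.isIntegral α
  have hPm := minpoly.monic hintg
  have hfac : ∀ R ∈ normalizedFactors T0, R = minpoly F α := by
    intro R hR
    obtain ⟨hRi, hRn, hRd⟩ := (mem_normalizedFactors_iff' hm.ne_zero).mp hR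
    have hRm : R.Monic := by rw [← hRn]; exact monic_normalize hRi.ne_zero
    have hd : R.map (algebraMap F E) ∣ T := by rw [← hT0]; exact Polynomial.map_dvd _ hRd
    have hTs : T.Splits := Splits.prod fun i _ => Splits.X_sub_C _
    have hRs := hTs.of_dvd hTm.ne_zero hd
    obtain ⟨x, hx⟩ := hRs.exists_eval_eq_zero (by
      rw [degree_map]
      exact fun h => by have := degree_pos_of_irreducible hRi; rw [h] at this; exact lt_irrefl _ this)
    have hxT : T.eval x = 0 := eval_eq_zero_of_dvd_of_eval_eq_zero hd hx
    rw [hT, eval_prod, Finset.prod_eq_zero_iff] at hxT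
    obtain ⟨i, -, hi⟩ := hxT
    rw [eval_sub, eval_X, eval_C, sub_eq_zero] at hi
    rw [eval_map_algebraMap, hi, aeval_pow_Q] at hx
    have : aeval α R = 0 := eq_zero_of_pow_eq_zero hx
    exact minpoly.eq_of_irreducible_of_monic hRi this hRm
  have hpr : (normalizedFactors T0).prod = T0 := by
    rw [prod_normalizedFactors_eq hm.ne_zero, hm.normalize_eq_self]
  have hpw : T0 = minpoly F α ^ (normalizedFactors T0).card := by
    conv_lhs => rw [← hpr, Multiset.eq_replicate_card.mpr hfac, Multiset.prod_replicate]
  have hdeg : k = (normalizedFactors T0).card * (minpoly F α).natDegree := by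
    rw [← hTdeg, ← hT0d]
    conv_lhs => rw [hpw, natDegree_pow]
  have : k / (minpoly F α).natDegree = (normalizedFactors T0).card := by
    conv_lhs => rw [hdeg]
    exact Nat.mul_div_cancel _ (minpoly.natDegree_pos hintg)
  rw [this, ← hpw, hT0]

noncomputable def Lam (χ : MulChar F ℂ) (ψ : AddChar F ℂ) (f : F[X]) (h : F[X]) : ℂ :=
  χ (resultant f h) * ψ (- h.nextCoeff)

lemma Lam_one (χ : MulChar F ℂ) (ψ : AddChar F ℂ) (f : F[X]) : Lam χ ψ f 1 = 1 := by
  simp [Lam, resultant_one_right, nextCoeff]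

lemma Lam_mul (χ : MulChar F ℂ) (ψ : AddChar F ℂ) (f : F[X]) (g h : F[X]) (hg : g.Monic) (hh : h.Monic) :
    Lam χ ψ f (g * h) = Lam χ ψ f g * Lam χ ψ f h := by
  unfold Lam
  rw [hg.nextCoeff_mul hh, hg.natDegree_mul hh, resultant_mul_right _ _ _ _ le_rfl, map_mul, neg_add, AddChar.map_add_eq_mul]
  ring

lemma finrank_of_card (E : Type) [Field E] [Fintype E] [Algebra F E] (k : ℕ)
    (hE : Fintype.card E = Fintype.card F ^ k) : Module.finrank F E = k := by
  have := Module.card_eq_pow_finrank (K := F) (V := E)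
  rw [hE] at this
  exact (Nat.pow_right_injective Fintype.one_lt_card this).symm

lemma Lam_minpoly (χ : MulChar F ℂ) (ψ : AddChar F ℂ) (f : F[X]) (E : Type) [Field E] [Fintype E] [Algebra F E] (k : ℕ) (hk : 1 ≤ k)
    (hE : Fintype.card E = Fintype.card F ^ k) (α : E) :
    Lam χ ψ f (minpoly F α ^ (k / (minpoly F α).natDegree)) =
      χ ((-1) ^ (f.natDegree * k)) * (χ (Algebra.norm F (aeval α f)) * ψ (Algebra.trace F E α)) := by
  have hmap := minpoly_pow_map E k hk hE α
  set h := minpoly F α ^ (k / (minpoly F α).natDegree) with hh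
  have hrk := finrank_of_card (F := F) E k hE
  have inj := (algebraMap F E).injective
  have hn : - h.nextCoeff = Algebra.trace F E α := by
    apply inj
    rw [FiniteField.algebraMap_trace_eq_sum_pow, hrk, map_neg, ← nextCoeff_map inj, hmap,
      prod_X_sub_C_nextCoeff, neg_neg, Nat.card_eq_fintype_card]
  have hr : resultant f h = (-1) ^ (f.natDegree * k) * Algebra.norm F (aeval α f) := by
    apply inj
    rw [← resultant_map_map, map_mul, map_pow, map_neg, map_one, FiniteField.algebraMap_norm_eq_prod_pow, hrk,
      ← natDegree_map (algebraMap F E) (p := f), ← natDegree_map (algebraMap F E) (p := h), hmap,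
      resultant_prod_right _ _ _ _ le_rfl (by simp only [leadingCoeff_X_sub_C]; simp)]
    rw [pow_mul]
    conv_rhs => rw [← Finset.card_range k, ← Finset.prod_const, Finset.card_range]
    rw [← Finset.prod_mul_distrib]
    refine Finset.prod_congr rfl fun i _ => ?_
    rw [natDegree_X_sub_C, resultant_X_sub_C_right _ _ _ le_rfl, eval_map_algebraMap, aeval_pow_Q, Nat.card_eq_fintype_card]
  unfold Lam
  rw [hn, hr, map_mul, mul_assoc]

lemma TT_cs (χ : MulChar F ℂ) (ψ : AddChar F ℂ) (f : F[X]) (E : Type) [Field E] [Fintype E] [Algebra F E] (k : ℕ) (hk : 1 ≤ k)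
    (hE : Fintype.card E = Fintype.card F ^ k) :
    ‖TT (Lam χ ψ f) k‖ = ‖cs χ ψ f E‖ := by
  rw [TT_eq _ (Lam_one χ ψ f) (Lam_mul χ ψ f) E k hk hE]
  rw [Finset.sum_congr rfl fun α _ => Lam_minpoly χ ψ f E k hk hE α, ← Finset.mul_sum, norm_mul, cs]
  have : ‖χ ((-1) ^ (f.natDegree * k))‖ = 1 := by
    apply Complex.norm_eq_one_of_pow_eq_one (n := 2) _ (by norm_num)
    rw [← map_pow, ← pow_mul, mul_comm _ 2, pow_mul]; simp
  rw [this, one_mul]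

lemma exists_ext (k : ℕ) (hk : 1 ≤ k) : ∃ (E : Type) (_ : Field E) (_ : Fintype E) (_ : Algebra F E),
    Fintype.card E = Fintype.card F ^ k := by
  obtain ⟨p, hp⟩ := CharP.exists F
  have : Fact p.Prime := ⟨CharP.char_is_prime F p⟩
  have : NeZero k := ⟨by omega⟩
  have : Finite (FiniteField.Extension F p k) := Module.finite_of_finite F
  let fi : Fintype (FiniteField.Extension F p k) := Fintype.ofFinite _
  refine ⟨FiniteField.Extension F p k, inferInstance, fi, inferInstance, ?_⟩
  have := FiniteField.natCard_extension F p k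
  rw [Nat.card_eq_fintype_card, Nat.card_eq_fintype_card] at this
  convert this

end
end W

open Polynomial
namespace W
section
variable {F : Type} [Field F] [Fintype F]

variable (F) in
noncomputable def LT (M : ℕ) : Finset F[X] :=
  (Set.Finite.subset (t := {h : F[X] | h.degree < M}) (finite_le M) (fun _ hh => natDegree_le_of_degree_le (le_of_lt hh))).toFinset

lemma mem_LT {M : ℕ} {h : F[X]} : h ∈ LT F M ↔ h.degree < M := by
  simp [LT]

lemma sum_division (m : F[X]) (hm : m.Monic) (e : ℕ) (G : F[X] → ℂ) :
    ∑ h ∈ Mon F (m.natDegree + e), G h = ∑ s ∈ Mon F e, ∑ r ∈ LT F m.natDegree, G (m * s + r) := by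
  rw [← Finset.sum_product']
  symm
  refine Finset.sum_bij' (fun x _ => m * x.1 + x.2) (fun h _ => (h /ₘ m, h %ₘ m)) ?_ ?_ ?_ ?_ ?_
  · rintro ⟨s, r⟩ hx
    rw [Finset.mem_product, mem_Mon, mem_LT] at hx
    obtain ⟨⟨h1, h2⟩, h3⟩ := hx
    simp only at h1 h2 h3
    have hms : (m * s).Monic := hm.mul h1
    have hd : (m * s).natDegree = m.natDegree + e := by rw [hm.natDegree_mul h1, h2]
    have hlt : r.degree < (m * s).degree := by
      refine lt_of_lt_of_le h3 ?_
      rw [degree_eq_natDegree hms.ne_zero, hd]; exact_mod_cast Nat.le_add_right _ _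
    rw [mem_Mon]
    refine ⟨hms.add_of_left hlt, ?_⟩
    rw [natDegree_add_eq_left_of_degree_lt hlt, hd]
  · intro h hh
    rw [mem_Mon] at hh
    rw [Finset.mem_product, mem_Mon, mem_LT]
    refine ⟨⟨?_, ?_⟩, ?_⟩
    · have hle : m.degree ≤ h.degree := by
        rw [degree_eq_natDegree hm.ne_zero, degree_eq_natDegree hh.1.ne_zero, hh.2]
        exact_mod_cast Nat.le_add_right _ _
      exact (leadingCoeff_divByMonic_of_monic hm hle).trans hh.1
    · rw [natDegree_divByMonic _ hm, hh.2]; simp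
    · rw [← degree_eq_natDegree hm.ne_zero]; exact degree_modByMonic_lt _ hm
  · rintro ⟨s, r⟩ hx
    rw [Finset.mem_product, mem_Mon, mem_LT] at hx
    have := div_modByMonic_unique (f := m * s + r) s r hm ⟨by ring, by rw [degree_eq_natDegree hm.ne_zero]; exact hx.2⟩
    simp [this.1, this.2]
  · intro h hh
    simp only
    rw [add_comm]; exact modByMonic_add_div h m
  · intro _ _; rfl

lemma nextCoeff_div (m s r : F[X]) (hm : m.Monic) (hs : s.Monic) (he : 1 ≤ s.natDegree) (hr : r.degree < m.natDegree) :
    (m * s + r).nextCoeff = m.nextCoeff + s.nextCoeff := by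
  rw [← hm.nextCoeff_mul hs]
  have hd : (m * s).natDegree = m.natDegree + s.natDegree := hm.natDegree_mul hs
  have hlt : r.degree < (m * s).degree := by
    refine lt_of_lt_of_le hr ?_
    rw [degree_eq_natDegree (hm.mul hs).ne_zero, hd]; exact_mod_cast Nat.le_add_right _ _
  have hd2 := natDegree_add_eq_left_of_degree_lt hlt
  rw [nextCoeff_of_natDegree_pos (by omega), nextCoeff_of_natDegree_pos (by omega), hd2, coeff_add, hd]
  rw [coeff_eq_zero_of_degree_lt (p := r), add_zero]
  exact lt_of_lt_of_le hr (by exact_mod_cast (by omega))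

lemma resultant_mod (f m s r : F[X]) (hf : f.Monic) (N : ℕ) (hfm : f ∣ m ^ N) :
    resultant f (m * s + r) = resultant f r := by
  apply (algebraMap F (AlgebraicClosure F)).injective
  rw [← resultant_map_map, ← resultant_map_map, ← natDegree_map (algebraMap F (AlgebraicClosure F)) (p := f),
    resultant_eq_prod_eval _ _ _ (by rw [natDegree_map]) (IsAlgClosed.splits _),
    resultant_eq_prod_eval _ _ _ (by rw [natDegree_map]) (IsAlgClosed.splits _)]
  rw [(hf.map _).leadingCoeff, one_pow, one_mul, one_pow, one_mul]
  congr 1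
  refine Multiset.map_congr rfl fun β hβ => ?_
  have h0 := (mem_roots'.mp hβ).2
  have h1 : (m.map (algebraMap F (AlgebraicClosure F))).eval β = 0 := by
    have h2 := Polynomial.map_dvd (algebraMap F (AlgebraicClosure F)) hfm
    have h3 := eval_eq_zero_of_dvd_of_eval_eq_zero h2 h0
    rw [Polynomial.map_pow, eval_pow] at h3
    exact eq_zero_of_pow_eq_zero h3
  rw [Polynomial.map_add, Polynomial.map_mul, eval_add, eval_mul, h1, zero_mul, zero_add]

lemma card_LT1 : (LT F 1).card = Fintype.card F := by
  classical
  have : LT F 1 = Finset.univ.image (C : F → F[X]) := by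
    ext h
    simp only [mem_LT, Finset.mem_image, Finset.mem_univ, true_and]
    constructor
    · intro h1
      refine ⟨h.coeff 0, (eq_C_of_degree_le_zero ?_).symm⟩
      exact Nat.WithBot.lt_one_iff_le_zero.mp (by simpa using h1)
    · rintro ⟨a, rfl⟩
      exact lt_of_le_of_lt degree_C_le (by norm_num)
  rw [this, Finset.card_image_of_injective _ C_injective, Finset.card_univ]

lemma tsum_step (ψ : AddChar F ℂ) (e : ℕ) (he : 1 ≤ e) :
    ∑ s ∈ Mon F (e+1), ψ (-s.nextCoeff) = Fintype.card F * ∑ s ∈ Mon F e, ψ (-s.nextCoeff) := by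
  have := sum_division (X : F[X]) monic_X e (fun s => ψ (-s.nextCoeff))
  rw [natDegree_X, add_comm 1 e] at this
  rw [this, Finset.mul_sum]
  refine Finset.sum_congr rfl fun s hs => ?_
  rw [mem_Mon] at hs
  rw [← card_LT1 (F := F), ← nsmul_eq_mul, ← Finset.sum_const]
  refine Finset.sum_congr rfl fun r hr => ?_
  rw [mem_LT] at hr
  rw [nextCoeff_div _ _ _ monic_X hs.1 (by omega) (by simpa using hr)]
  congr 2
  have : (X : F[X]).nextCoeff = 0 := by
    have := nextCoeff_X_add_C (0 : F); simpa using this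
  rw [this, zero_add]

lemma a_step (χ : MulChar F ℂ) (ψ : AddChar F ℂ) (f m : F[X]) (hf : f.Monic) (hm : m.Monic) (N : ℕ) (hfm : f ∣ m ^ N)
    (d : ℕ) (hd : m.natDegree + 1 ≤ d) :
    ∑ h ∈ Mon F (d+1), Lam χ ψ f h = Fintype.card F * ∑ h ∈ Mon F d, Lam χ ψ f h := by
  have key : ∀ e, 1 ≤ e → ∑ h ∈ Mon F (m.natDegree + e), Lam χ ψ f h =
      (ψ (- m.nextCoeff) * ∑ r ∈ LT F m.natDegree, χ (resultant f r)) * ∑ s ∈ Mon F e, ψ (-s.nextCoeff) := by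
    intro e he
    rw [sum_division m hm, Finset.mul_sum]
    refine Finset.sum_congr rfl fun s hs => ?_
    rw [mem_Mon] at hs
    rw [Finset.mul_sum, Finset.sum_mul]
    refine Finset.sum_congr rfl fun r hr => ?_
    rw [mem_LT] at hr
    unfold Lam
    rw [resultant_mod f m s r hf N hfm, nextCoeff_div m s r hm hs.1 (by omega) hr, neg_add, AddChar.map_add_eq_mul]
    ring
  obtain ⟨e, rfl⟩ := Nat.exists_eq_add_of_le (show m.natDegree ≤ d by omega)
  rw [add_assoc, key (e+1) (by omega), key e (by omega), tsum_step ψ e (by omega)]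
  ring

theorem weil (χ : MulChar F ℂ) (hχ : ∀ u : F, u ≠ 0 → χ u = 1 → u = 1)
    (ψ : AddChar F ℂ) (f m : F[X]) (hf : f.Monic) (hm : m.Monic) (N : ℕ) (hfm : f ∣ m ^ N)
    (hnt : ψ ≠ 1 ∨ ¬ ∃ g : F[X], g.Monic ∧ g ^ (Fintype.card F - 1) = f) :
    ‖∑ x : F, χ (f.eval x) * ψ x‖ ≤ m.natDegree * √(Fintype.card F : ℝ) := by
  obtain ⟨Cst, hC⟩ := cs_bound χ hχ ψ f hf hnt
  set q : ℝ := (Fintype.card F : ℝ) with hq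
  have hq1 : 1 < q := by rw [hq]; exact_mod_cast Fintype.one_lt_card
  set S : ℕ → ℂ := fun k => if k = 0 then 0 else TT (Lam χ ψ f) k with hS
  have hM0 : Mon F 0 = {1} := by
    ext h; rw [mem_Mon, Finset.mem_singleton]
    constructor
    · rintro ⟨h1, h2⟩; exact h1.natDegree_eq_zero.mp h2
    · rintro rfl; simp
  obtain ⟨Ω, hΩ, hsum⟩ := newton (fun d => ∑ h ∈ Mon F d, Lam χ ψ f h) S (q : ℂ) (m.natDegree + 1)
    (by simp [hM0, Lam_one]) (by simp [hS]) (by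
      intro d
      rw [Lrec (Lam χ ψ f) (Lam_one χ ψ f) (Lam_mul χ ψ f) d])
    (by
      intro d hd
      rw [a_step χ ψ f m hf hm N hfm d hd, hq]; simp)
  have hSb : ∀ k, 1 ≤ k → ‖S k‖ ≤ Cst * √q ^ k := by
    intro k hk
    obtain ⟨E, i1, i2, i3, hE⟩ := exists_ext (F := F) k hk
    simp only [hS, if_neg (show k ≠ 0 by omega)]
    rw [TT_cs χ ψ f E k hk hE]
    exact hC k E hE
  have h1 := sum_bound S q hq1 Ω Cst hsum hSb
  have h2 : ‖S 1‖ = ‖∑ x : F, χ (f.eval x) * ψ x‖ := by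
    simp only [hS, if_neg one_ne_zero]
    rw [TT_cs χ ψ f F 1 le_rfl (by simp)]
    simp [cs, Algebra.norm_self, Algebra.trace_self]
  rw [← h2]
  have h3 : (Ω.card : ℝ) ≤ m.natDegree + 1 := by exact_mod_cast hΩ
  have h4 : 0 ≤ √q := by positivity
  nlinarith

end
end W

namespace W
section
variable {α G ι : Type*} [CommGroup G] [Fintype ι] [DecidableEq ι]

open Classical in
/-- nontrivial part of a subgroup -/
noncomputable def Gam [Fintype G] (H : Subgroup G) : Finset G := Finset.univ.filter (fun g => g ∈ H ∧ g ≠ 1)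

variable [Fintype G]

lemma mem_Gam {H : Subgroup G} {g : G} : g ∈ Gam H ↔ g ∈ H ∧ g ≠ 1 := by simp [Gam]

lemma card_Gam (H : Subgroup G) : (Gam H).card + 1 = Nat.card H := by
  classical
  have h1 : (Finset.univ.filter (fun g => g ∈ H)) = insert 1 (Gam H) := by
    ext g; simp only [Finset.mem_filter, Finset.mem_univ, true_and, Finset.mem_insert, mem_Gam]
    constructor
    · intro h; by_cases h1 : g = 1 <;> simp [h, h1]
    · rintro (rfl | h); exacts [H.one_mem, h.1]
  rw [Nat.card_eq_fintype_card, Fintype.card_subtype, h1, Finset.card_insert_of_notMem (by simp [mem_Gam])]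

/-- average of nontrivial characters -/
noncomputable def vv (e : G → α → ℂ) (H : Subgroup G) (a : α) : ℂ := ((Gam H).card : ℂ)⁻¹ * ∑ g ∈ Gam H, e g a

lemma prod_v_bound (A : Finset α) (e : G → α → ℂ) (he : ∀ a ∈ A, ∀ g h, e (g * h) a = e g a * e h a)
    (B : ℝ) (hB0 : 0 ≤ B) (hB : ∀ g, g ≠ 1 → ‖∑ a ∈ A, e g a‖ ≤ B) (H : ι → Subgroup G) (J : Finset ι) :
    ∀ g0 : G, (∀ γ : ι → G, (∀ i ∈ J, γ i ∈ Gam (H i)) → g0 * ∏ i ∈ J, γ i ≠ 1) →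
      ‖∑ a ∈ A, e g0 a * ∏ i ∈ J, vv e (H i) a‖ ≤ B := by
  classical
  induction J using Finset.induction_on with
  | empty =>
    intro g0 h
    have := h 1 (by simp)
    simpa using hB g0 (by simpa using this)
  | insert i J hi ih =>
    intro g0 h
    have e1 : ∑ a ∈ A, e g0 a * ∏ j ∈ insert i J, vv e (H j) a
       = ((Gam (H i)).card : ℂ)⁻¹ * ∑ g ∈ Gam (H i), ∑ a ∈ A, e (g0 * g) a * ∏ j ∈ J, vv e (H j) a := by
      rw [Finset.sum_comm, Finset.mul_sum]
      refine Finset.sum_congr rfl fun a ha => ?_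
      rw [Finset.prod_insert hi, vv, ← Finset.sum_mul]
      simp only [he a ha]
      rw [← Finset.mul_sum]; ring
    rw [e1, norm_mul, norm_inv, Complex.norm_natCast]
    have h2 : ‖∑ g ∈ Gam (H i), ∑ a ∈ A, e (g0 * g) a * ∏ j ∈ J, vv e (H j) a‖ ≤ (Gam (H i)).card * B := by
      refine (norm_sum_le _ _).trans ?_
      rw [← nsmul_eq_mul]
      refine Finset.sum_le_card_nsmul _ _ _ fun g hg => ?_
      apply ih
      intro γ hγ
      have := h (Function.update γ i g) (by
        intro j hj
        by_cases hji : j = i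
        · subst hji; simpa using hg
        · rw [Function.update_of_ne hji]; exact hγ j (by simpa [hji] using hj))
      rw [Finset.prod_insert hi, Function.update_self, ← mul_assoc] at this
      rw [Finset.prod_congr rfl (g := γ)] at this
      · exact this
      · intro j hj
        rw [Function.update_of_ne]; rintro rfl; exact hi hj
    rcases Nat.eq_zero_or_pos (Gam (H i)).card with h0 | h0
    · rw [h0]; simpa using hB0
    · have : (0:ℝ) < (Gam (H i)).card := by exact_mod_cast h0
      rw [inv_mul_le_iff₀ this]; exact h2

open Classical in
lemma sum_hom (e : G → α → ℂ) (a : α) (he : ∀ g h, e (g * h) a = e g a * e h a) (he1 : e 1 a = 1) (H : Subgroup G) :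
    ((Nat.card H : ℂ) - 1) * vv e H a + 1 = if (∃ g ∈ H, e g a ≠ 1) then 0 else (Nat.card H : ℂ) := by
  classical
  have hc := card_Gam H
  have hc' : (Nat.card H : ℂ) - 1 = (Gam H).card := by rw [← hc]; push_cast; ring
  have hs : ((Nat.card H : ℂ) - 1) * vv e H a + 1 = ∑ g ∈ insert 1 (Gam H), e g a := by
    rw [Finset.sum_insert (by simp [mem_Gam]), he1, hc', vv, add_comm]
    congr 1
    rcases Nat.eq_zero_or_pos (Gam H).card with h0 | h0
    · rw [h0]; rw [Finset.card_eq_zero] at h0; simp [h0]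
    · rw [mul_inv_cancel_left₀]; exact_mod_cast h0.ne'
  have hmem : ∀ g, g ∈ insert 1 (Gam H) ↔ g ∈ H := by
    intro g
    simp only [Finset.mem_insert, mem_Gam]
    constructor
    · rintro (rfl | h); exacts [H.one_mem, h.1]
    · intro h; by_cases h1 : g = 1 <;> simp [h, h1]
  rw [hs]
  split_ifs with hex
  · obtain ⟨g0, hg0, hne⟩ := hex
    have : e g0 a * ∑ g ∈ insert 1 (Gam H), e g a = ∑ g ∈ insert 1 (Gam H), e g a := by
      rw [Finset.mul_sum]
      refine Finset.sum_bij (fun g _ => g0 * g) ?_ ?_ ?_ ?_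
      · intro g hg; rw [hmem] at hg ⊢; exact H.mul_mem hg0 hg
      · intro x _ y _ h; exact mul_left_cancel h
      · intro y hy; rw [hmem] at hy
        exact ⟨g0⁻¹ * y, by rw [hmem]; exact H.mul_mem (H.inv_mem hg0) hy, by group⟩
      · intro g _; rw [he]
    have h2 : (e g0 a - 1) * ∑ g ∈ insert 1 (Gam H), e g a = 0 := by linear_combination this
    rcases mul_eq_zero.mp h2 with h | h
    · exact absurd (by linear_combination h) hne
    · exact h
  · push Not at hex
    rw [Finset.sum_congr rfl (g := fun _ => 1) (fun g hg => hex g ((hmem g).mp hg))]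
    rw [← hc, Finset.sum_const, Finset.card_insert_of_notMem (by simp [mem_Gam])]; simp

lemma ite_and_not (p q : Prop) [Decidable p] [Decidable q] [Decidable (p ∧ ¬ q)] : (if (p ∧ ¬ q) then (1:ℂ) else 0) = (if p then 1 else 0) * (1 - if q then 1 else 0) := by
  by_cases hp : p <;> by_cases hq : q <;> simp [hp, hq]

set_option maxHeartbeats 1000000 in
open Classical in
theorem sieve (A : Finset α) (e : G → α → ℂ) (he : ∀ a ∈ A, ∀ g h, e (g * h) a = e g a * e h a)
    (he1 : ∀ a ∈ A, e 1 a = 1)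
    (B : ℝ) (hB0 : 0 ≤ B) (hB : ∀ g, g ≠ 1 → ‖∑ a ∈ A, e g a‖ ≤ B) (H : ι → Subgroup G)
    (hn : ∀ i, 2 ≤ Nat.card (H i))
    (hind : ∀ J : Finset ι, ∀ γ : ι → G, (∀ i ∈ J, γ i ∈ H i) → ∏ i ∈ J, γ i = 1 → ∀ i ∈ J, γ i = 1)
    (c : Finset ι)
    (hcond : (2:ℝ) ^ c.card * B * ∑ i ∈ cᶜ, (1 - 1 / (Nat.card (H i) : ℝ))
       < (1 - ∑ i ∈ cᶜ, 1 / (Nat.card (H i) : ℝ)) * (A.card - (2 ^ c.card - 1) * B))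
    (hδ : 0 ≤ 1 - ∑ i ∈ cᶜ, 1 / (Nat.card (H i) : ℝ)) :
    ∃ a ∈ A, ∀ i, ∃ g ∈ H i, e g a ≠ 1 := by
  by_contra hcon
  push Not at hcon
  set ev : ι → α → Prop := fun i a => ∃ g ∈ H i, e g a ≠ 1 with hev
  set n : ι → ℝ := fun i => (Nat.card (H i) : ℝ) with hndef
  have hn2 : ∀ i, 2 ≤ n i := fun i => by simp only [hndef]; exact_mod_cast hn i
  set v : ι → α → ℂ := fun i => vv e (H i) with hv
  -- nonempty products
  have hJ : ∀ J : Finset ι, J.Nonempty → ‖∑ a ∈ A, ∏ i ∈ J, v i a‖ ≤ B := by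
    intro J hJ
    have := prod_v_bound A e he B hB0 hB H J 1 (by
      intro γ hγ h
      rw [one_mul] at h
      obtain ⟨i, hi⟩ := hJ
      exact (mem_Gam.mp (hγ i hi)).2 (hind J γ (fun i hi => (mem_Gam.mp (hγ i hi)).1) h i hi))
    refine le_of_eq_of_le ?_ this
    congr 1
    exact Finset.sum_congr rfl fun a ha => by rw [he1 a ha, one_mul]
  set S : ℂ := ∑ a ∈ A, ∏ i ∈ c, (1 - v i a) with hSdef
  have hexp : ∀ a, ∏ i ∈ c, (1 - v i a) = ∑ J ∈ c.powerset, (-1) ^ J.card * ∏ i ∈ J, v i a := by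
    intro a
    simp only [sub_eq_add_neg]
    rw [Finset.prod_one_add]
    refine Finset.sum_congr rfl fun J _ => ?_
    rw [Finset.prod_neg]
  have hS : ‖S - A.card‖ ≤ (2 ^ c.card - 1) * B := by
    have e1 : S - A.card = ∑ J ∈ c.powerset.erase ∅, (-1) ^ J.card * ∑ a ∈ A, ∏ i ∈ J, v i a := by
      rw [hSdef, Finset.sum_congr rfl fun a _ => hexp a, Finset.sum_comm]
      simp only [← Finset.mul_sum]
      rw [← Finset.add_sum_erase _ _ (Finset.empty_mem_powerset c)]
      simp
    rw [e1]
    have h3 : ((c.powerset.erase ∅).card : ℝ) = 2 ^ c.card - 1 := by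
      rw [Finset.card_erase_of_mem (Finset.empty_mem_powerset c), Finset.card_powerset, Nat.cast_sub Nat.one_le_two_pow]
      push_cast; rfl
    rw [← h3, ← nsmul_eq_mul]
    refine (norm_sum_le _ _).trans (Finset.sum_le_card_nsmul _ _ _ fun J hJ' => ?_)
    rw [norm_mul, norm_pow, norm_neg, norm_one, one_pow, one_mul]
    exact hJ J (Finset.nonempty_iff_ne_empty.mpr (Finset.ne_of_mem_erase hJ'))
  have hSi : ∀ i ∈ cᶜ, ‖∑ a ∈ A, v i a * ∏ j ∈ c, (1 - v j a)‖ ≤ 2 ^ c.card * B := by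
    intro i hi
    rw [Finset.mem_compl] at hi
    have e1 : ∑ a ∈ A, v i a * ∏ j ∈ c, (1 - v j a)
        = ∑ J ∈ c.powerset, (-1) ^ J.card * ∑ a ∈ A, ∏ j ∈ insert i J, v j a := by
      simp only [Finset.mul_sum]
      rw [Finset.sum_comm]
      refine Finset.sum_congr rfl fun a _ => ?_
      rw [hexp, Finset.mul_sum]
      refine Finset.sum_congr rfl fun J hJ' => ?_
      rw [Finset.prod_insert (fun h => hi (Finset.mem_powerset.mp hJ' h))]; ring
    rw [e1]
    have h3 : ((c.powerset).card : ℝ) = 2 ^ c.card := by rw [Finset.card_powerset]; push_cast; rfl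
    rw [← h3, ← nsmul_eq_mul]
    refine (norm_sum_le _ _).trans (Finset.sum_le_card_nsmul _ _ _ fun J hJ' => ?_)
    rw [norm_mul, norm_pow, norm_neg, norm_one, one_pow, one_mul]
    exact hJ _ ⟨i, Finset.mem_insert_self _ _⟩
  -- indicator formulas
  have hind1 : ∀ a ∈ A, ∀ i, (1 - v i a) * (1 - 1 / (n i : ℂ)) = if ev i a then 1 else 0 := by
    intro a ha i
    have h1 := sum_hom e a (he a ha) (he1 a ha) (H i)
    have h2 : (n i : ℂ) ≠ 0 := by
      have := hn2 i
      exact_mod_cast (show n i ≠ 0 by linarith)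
    have h3 : (Nat.card (H i) : ℂ) = (n i : ℂ) := by simp [hndef]
    rw [h3] at h1
    simp only [hev, hv]
    field_simp
    split_ifs at h1 ⊢ with h
    · linear_combination -h1
    · linear_combination -h1
  set θ : ℝ := ∏ i ∈ c, (1 - 1 / n i) with hθ
  have hθpos : 0 < θ := by
    apply Finset.prod_pos
    intro i _
    have := hn2 i
    rw [sub_pos, div_lt_one (by linarith)]; linarith
  have hcore : ∀ a ∈ A, (θ : ℂ) * ∏ i ∈ c, (1 - v i a) = if (∀ i ∈ c, ev i a) then 1 else 0 := by
    intro a ha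
    rw [hθ]; push_cast
    rw [← Finset.prod_mul_distrib]
    rw [Finset.prod_congr rfl (g := fun i => if ev i a then (1:ℂ) else 0)]
    · rw [Finset.prod_ite_zero]; simp
    · intro i _; rw [mul_comm]; exact hind1 a ha i
  -- counts
  set Ac := A.filter (fun a => ∀ i ∈ c, ev i a) with hAc
  have hNc : (Ac.card : ℂ) = θ * S := by
    rw [hSdef, Finset.mul_sum, Finset.sum_congr rfl hcore, hAc, Finset.card_filter]
    push_cast; rfl
  have hcov : Ac.card ≤ ∑ i ∈ cᶜ, (Ac.filter (fun a => ¬ ev i a)).card := by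
    refine le_trans (Finset.card_le_card ?_) Finset.card_biUnion_le
    intro a ha
    have ha' := Finset.mem_filter.mp ha
    obtain ⟨i, hi⟩ := hcon a ha'.1
    have hni : ¬ ev i a := by
      simp only [hev]; push Not; exact hi
    rw [Finset.mem_biUnion]
    refine ⟨i, ?_, Finset.mem_filter.mpr ⟨ha, hni⟩⟩
    rw [Finset.mem_compl]; intro hic; exact hni (ha'.2 i hic)
  have hXi : ∀ i ∈ cᶜ, ((Ac.filter (fun a => ¬ ev i a)).card : ℝ) ≤ θ * (S.re / n i + (1 - 1 / n i) * (2 ^ c.card * B)) := by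
    intro i hi
    have e1 : ((Ac.filter (fun a => ¬ ev i a)).card : ℂ)
        = θ * (S / n i + (1 - 1 / n i) * ∑ a ∈ A, v i a * ∏ j ∈ c, (1 - v j a)) := by
      rw [hAc, Finset.filter_filter, Finset.card_filter]
      push_cast
      rw [hSdef, Finset.sum_div, Finset.mul_sum, ← Finset.sum_add_distrib, Finset.mul_sum]
      refine Finset.sum_congr rfl fun a ha => ?_
      have h1 := hcore a ha
      have h2 := hind1 a ha i
      have : (if ((∀ j ∈ c, ev j a) ∧ ¬ ev i a) then (1:ℂ) else 0) = (if (∀ j ∈ c, ev j a) then 1 else 0) * (1 - if ev i a then 1 else 0) := by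
        exact ite_and_not _ _
      rw [this, ← h1, ← h2]
      ring
    have e2 := congrArg Complex.re e1
    rw [Complex.natCast_re, Complex.re_ofReal_mul, Complex.add_re, Complex.div_ofReal_re] at e2
    rw [e2]
    have hcst : (1 - 1 / (n i : ℂ)) = ((1 - 1 / n i : ℝ) : ℂ) := by push_cast; rfl
    rw [hcst, Complex.re_ofReal_mul]
    have h4 := (Complex.re_le_norm _).trans (hSi i hi)
    have h5 : 0 ≤ 1 - 1 / n i := by
      have := hn2 i
      rw [sub_nonneg, div_le_one (by linarith)]; linarith
    exact mul_le_mul_of_nonneg_left (add_le_add_right (mul_le_mul_of_nonneg_left h4 h5) _) hθpos.le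
  have hSre : A.card - (2 ^ c.card - 1) * B ≤ S.re := by
    have h1 := (Complex.abs_re_le_norm (S - A.card)).trans hS
    rw [Complex.sub_re, Complex.natCast_re] at h1
    have := (abs_le.mp h1).1
    linarith
  have hNcr : (Ac.card : ℝ) = θ * S.re := by
    have := congrArg Complex.re hNc
    rwa [Complex.natCast_re, Complex.re_ofReal_mul] at this
  have hfin : (Ac.card : ℝ) ≤ ∑ i ∈ cᶜ, θ * (S.re / n i + (1 - 1 / n i) * (2 ^ c.card * B)) := by
    calc (Ac.card : ℝ) ≤ ((∑ i ∈ cᶜ, (Ac.filter (fun a => ¬ ev i a)).card : ℕ) : ℝ) := by exact_mod_cast hcov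
      _ ≤ _ := by push_cast; exact Finset.sum_le_sum hXi
  rw [hNcr, ← Finset.mul_sum, mul_le_mul_iff_right₀ hθpos, Finset.sum_add_distrib, ← Finset.sum_mul] at hfin
  have : ∑ i ∈ cᶜ, S.re / n i = S.re * ∑ i ∈ cᶜ, 1 / n i := by
    rw [Finset.mul_sum]; exact Finset.sum_congr rfl fun i _ => by ring
  rw [this] at hfin
  have h6 := mul_le_mul_of_nonneg_left hSre hδ
  nlinarith
end
end W

open Polynomial
namespace W
section
variable {L : Type} [Field L] [Fintype L]

lemma exists_faithful : ∃ χ : MulChar L ℂ, orderOf χ = Fintype.card L - 1 ∧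
    (∀ u : L, u ≠ 0 → χ u = 1 → u = 1) ∧
    ∀ μ : MulChar L ℂ, ∃ a : ℕ, 1 ≤ a ∧ a ≤ Fintype.card L - 1 ∧ μ = χ ^ a := by
  classical
  have hD : 0 < Fintype.card L - 1 := by have := Fintype.one_lt_card (α := L); omega
  set D := Fintype.card L - 1 with hDdef
  obtain ⟨χ, hχ⟩ := MulChar.exists_mulChar_orderOf L (dvd_refl D)
    (Complex.isPrimitiveRoot_exp D hD.ne')
  obtain ⟨g, hg⟩ := IsCyclic.exists_generator (α := Lˣ)
  have hcardU : Fintype.card Lˣ = D := Fintype.card_units L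
  have hgo : orderOf g = D := by rw [orderOf_eq_card_of_forall_mem_zpowers hg, Nat.card_eq_fintype_card, hcardU]
  have key : ∀ μ ν : MulChar L ℂ, μ g = ν g → μ = ν := fun μ ν h => (MulChar.eq_iff hg μ ν).2 h
  have hroot : ∀ μ : MulChar L ℂ, (μ g) ^ D = 1 := by
    intro μ
    rw [← map_pow, ← Units.val_pow_eq_pow_val, ← hgo, pow_orderOf_eq_one]; simp
  have hprim : IsPrimitiveRoot (χ g) D := by
    refine IsPrimitiveRoot.mk_of_lt _ hD (hroot χ) ?_
    intro l hl0 hl h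
    have : χ ^ l = 1 := key _ _ (by rw [MulChar.pow_apply_coe, h]; simp)
    have := orderOf_dvd_of_pow_eq_one this
    rw [hχ] at this
    exact absurd (Nat.le_of_dvd hl0 this) (by omega)
  refine ⟨χ, hχ, ?_, ?_⟩
  · intro u hu h
    obtain ⟨k, hk⟩ := (mem_powers_iff_mem_zpowers).2 (hg (Units.mk0 u hu))
    have hk' : u = (g:L)^k := by
      have := congrArg Units.val hk; simpa using this.symm
    rw [hk', map_pow] at h
    have := (hprim.pow_eq_one_iff_dvd k).1 h
    rw [← hgo] at this
    have := orderOf_dvd_iff_pow_eq_one.1 this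
    rw [hk', ← Units.val_pow_eq_pow_val, this]; simp
  · intro μ
    have : NeZero D := ⟨hD.ne'⟩
    obtain ⟨i, hi, h⟩ := hprim.eq_pow_of_pow_eq_one (hroot μ)
    refine ⟨if i = 0 then D else i, ?_, ?_, ?_⟩
    · split_ifs <;> omega
    · split_ifs <;> omega
    · apply key
      rw [MulChar.pow_apply_coe]
      split_ifs with h0
      · subst h0; rw [hprim.pow_eq_one, ← h, pow_zero]
      · exact h.symm

lemma indep_coprime {G ι : Type*} [CommGroup G] (J : Finset ι) (n : ι → ℕ) (x : ι → G)
    (hn : ∀ i ∈ J, ∀ j ∈ J, i ≠ j → Nat.Coprime (n i) (n j)) (hx : ∀ i ∈ J, x i ^ n i = 1)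
    (h : ∏ i ∈ J, x i = 1) : ∀ i ∈ J, x i = 1 := by
  classical
  intro i hi
  have h1 : x i ^ (∏ j ∈ J.erase i, n j) = 1 := by
    rw [← Finset.mul_prod_erase J x hi] at h
    have h2 := congrArg (fun y => y ^ (∏ j ∈ J.erase i, n j)) h
    simp only [mul_pow, one_pow] at h2
    have h4 : (∏ j ∈ J.erase i, x j) ^ (∏ j ∈ J.erase i, n j) = 1 := by
      rw [← Finset.prod_pow]
      apply Finset.prod_eq_one
      intro j hj
      rw [← Finset.mul_prod_erase _ n hj, pow_mul, hx j (Finset.mem_of_mem_erase hj), one_pow]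
    rwa [h4, mul_one] at h2
  have h3 : Nat.Coprime (n i) (∏ j ∈ J.erase i, n j) := by
    apply Nat.Coprime.prod_right
    intro j hj
    exact hn i hi j (Finset.mem_of_mem_erase hj) (Finset.ne_of_mem_erase hj).symm
  have := Nat.dvd_gcd (orderOf_dvd_of_pow_eq_one (hx i hi)) (orderOf_dvd_of_pow_eq_one h1)
  rw [h3.gcd_eq_one] at this
  exact orderOf_eq_one_iff.1 (Nat.dvd_one.1 this)

/-- subgroup of characters of order dividing `ℓ` -/
def Hmul (L : Type) [Field L] (l : ℕ) : Subgroup (MulChar L ℂ) where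
  carrier := {μ | μ ^ l = 1}
  one_mem' := one_pow l
  mul_mem' := by intro a b ha hb; simp only [Set.mem_ofPred_eq] at *; rw [mul_pow, ha, hb, one_mul]
  inv_mem' := by intro a ha; simp only [Set.mem_ofPred_eq] at *; rw [inv_pow, ha, inv_one]

lemma mem_Hmul {l : ℕ} {μ : MulChar L ℂ} : μ ∈ Hmul L l ↔ μ ^ l = 1 := Iff.rfl

lemma card_Hmul {l : ℕ} (hl0 : 0 < l) (hl : l ∣ Fintype.card L - 1) : l ≤ Nat.card (Hmul L l) := by
  obtain ⟨χ, hχ, -, -⟩ := exists_faithful (L := L)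
  have hD : 0 < Fintype.card L - 1 := by have := Fintype.one_lt_card (α := L); omega
  obtain ⟨m, hm⟩ := hl
  have hm0 : 0 < m := Nat.pos_of_ne_zero (by rintro rfl; omega)
  have ho : orderOf (χ ^ m) = l := by
    rw [orderOf_pow' _ hm0.ne', hχ, hm, Nat.gcd_eq_right (Dvd.intro_left _ rfl), Nat.mul_div_cancel _ hm0]
  have : Nat.card (Subgroup.zpowers (χ ^ m)) = l := by rw [Nat.card_zpowers, ho]
  conv_lhs => rw [← this]
  refine Nat.card_le_card_of_injective (fun x : Subgroup.zpowers (χ ^ m) => (⟨x.1, ?_⟩ : Hmul L l)) ?_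
  · obtain ⟨y, hy⟩ := x
    obtain ⟨k, rfl⟩ := hy
    show ((χ ^ m) ^ k) ^ l = 1
    rw [← zpow_natCast, zpow_comm, zpow_natCast, ← ho, pow_orderOf_eq_one, one_zpow]
  · intro a b h; exact Subtype.ext (congrArg (fun z : Hmul L l => z.1) h)

lemma event_mul {l : ℕ} (hl : l ∣ Fintype.card L - 1) {μ : MulChar L ℂ} (hμ : μ ∈ Hmul L l)
    {u : L} (hu : u ≠ 0) (h : μ u ≠ 1) : u ^ ((Fintype.card L - 1) / l) ≠ 1 := by
  classical
  intro h1
  apply h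
  have hD : 0 < Fintype.card L - 1 := by have := Fintype.one_lt_card (α := L); omega
  obtain ⟨g, hg⟩ := IsCyclic.exists_generator (α := Lˣ)
  have hcardU : Fintype.card Lˣ = Fintype.card L - 1 := Fintype.card_units L
  have hgo : orderOf g = Fintype.card L - 1 := by
    rw [orderOf_eq_card_of_forall_mem_zpowers hg, Nat.card_eq_fintype_card, hcardU]
  obtain ⟨k, hk⟩ := (mem_powers_iff_mem_zpowers).2 (hg (Units.mk0 u hu))
  have hk' : u = (g:L)^k := by
    have := congrArg Units.val hk; simpa using this.symm
  rw [hk', ← pow_mul, ← Units.val_pow_eq_pow_val] at h1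
  have h2 : g ^ (k * ((Fintype.card L - 1) / l)) = 1 := by ext; simpa using h1
  have h3 := orderOf_dvd_of_pow_eq_one h2
  rw [hgo] at h3
  obtain ⟨m, hm⟩ := hl
  have hl0 : 0 < l := Nat.pos_of_ne_zero (by rintro rfl; omega)
  have hm0 : 0 < m := Nat.pos_of_ne_zero (by rintro rfl; omega)
  rw [hm, Nat.mul_div_cancel_left _ hl0] at h3
  obtain ⟨t, rfl⟩ := Nat.dvd_of_mul_dvd_mul_right hm0 h3
  rw [hk', pow_mul, map_pow, map_pow, ← MulChar.pow_apply_coe, mem_Hmul.1 hμ]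
  simp

lemma primitive_of {u : L} (hu : u ≠ 0)
    (h : ∀ l ∈ (Fintype.card L - 1).primeFactors, u ^ ((Fintype.card L - 1) / l) ≠ 1) :
    orderOf u = Fintype.card L - 1 := by
  have hD : 0 < Fintype.card L - 1 := by have := Fintype.one_lt_card (α := L); omega
  apply orderOf_eq_of_pow_and_pow_div_prime hD (FiniteField.pow_card_sub_one_eq_one u hu)
  intro p hp hd
  exact h p (Nat.mem_primeFactors.2 ⟨hp, hd, hD.ne'⟩)
end
end W

open Polynomial
set_option linter.unusedSectionVars false
namespace W
section
variable {K L : Type} [Field K] [Field L] [Fintype K] [Fintype L] [Algebra K L]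

/-- action of polynomials through Frobenius -/
noncomputable def FA (K L : Type) [Field K] [Field L] [Fintype K] [Algebra K L] : K[X] →ₐ[K] Module.End K L :=
  aeval (FiniteField.frobeniusAlgHom K L).toLinearMap

lemma frob_pow (i : ℕ) (x : L) :
    (((FiniteField.frobeniusAlgHom K L).toLinearMap : Module.End K L) ^ i) x = x ^ (Fintype.card K ^ i) := by
  induction i with
  | zero => simp
  | succ i ih =>
    rw [pow_succ', Module.End.mul_apply, ih]
    simp [FiniteField.coe_frobeniusAlgHom, pow_succ, pow_mul]

lemma FA_apply (h : K[X]) (x : L) :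
    FA K L h x = ∑ i ∈ Finset.range (h.natDegree + 1), algebraMap K L (h.coeff i) * x ^ (Fintype.card K ^ i) := by
  rw [FA, aeval_eq_sum_range, LinearMap.sum_apply]
  refine Finset.sum_congr rfl fun i _ => ?_
  rw [LinearMap.smul_apply, frob_pow, Algebra.smul_def]

lemma FA_mul (g h : K[X]) (x : L) : FA K L (g * h) x = FA K L g (FA K L h x) := by
  rw [map_mul]; rfl

lemma FA_Xn {n : ℕ} (hn : 0 < n) (hL : Fintype.card L = Fintype.card K ^ n) (x : L) :
    FA K L (X ^ n - 1) x = 0 := by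
  rw [map_sub, map_pow, map_one, LinearMap.sub_apply, FA, aeval_X, frob_pow, ← hL, FiniteField.pow_card]
  simp

lemma card_ker_FA (g : K[X]) (hg : g ≠ 0) :
    Nat.card (LinearMap.ker (FA K L g)) ≤ Fintype.card K ^ g.natDegree := by
  classical
  set q := Fintype.card K with hq
  have hq1 : 1 < q := Fintype.one_lt_card
  let P : L[X] := ∑ i ∈ Finset.range (g.natDegree + 1), C (algebraMap K L (g.coeff i)) * X ^ (q ^ i)
  have hP : P.coeff (q ^ g.natDegree) = algebraMap K L g.leadingCoeff := by
    simp only [P, finsetSum_coeff, coeff_C_mul, coeff_X_pow]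
    rw [Finset.sum_eq_single g.natDegree]
    · simp
    · intro i _ hi
      rw [if_neg, mul_zero]
      intro h; exact hi (Nat.pow_right_injective hq1 h).symm
    · intro h; exact absurd (Finset.self_mem_range_succ _) h
  have hP0 : P ≠ 0 := by
    intro h; rw [h, coeff_zero] at hP
    have := (map_eq_zero (algebraMap K L)).1 hP.symm
    exact hg (leadingCoeff_eq_zero.1 this)
  have hdeg : P.natDegree ≤ q ^ g.natDegree := by
    apply natDegree_sum_le_of_forall_le
    intro i hi
    refine (natDegree_C_mul_X_pow_le _ _).trans (Nat.pow_le_pow_right (by omega) ?_)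
    have := Finset.mem_range.1 hi; omega
  have hsub : ∀ x ∈ LinearMap.ker (FA K L g), x ∈ P.roots.toFinset := by
    intro x hx
    rw [Multiset.mem_toFinset, mem_roots hP0, IsRoot.def]
    simp only [P, eval_finsetSum, eval_mul, eval_C, eval_pow, eval_X]
    rw [← FA_apply]; exact hx
  calc Nat.card (LinearMap.ker (FA K L g)) ≤ Nat.card (P.roots.toFinset : Set L) :=
        Nat.card_mono (Finset.finite_toSet _) hsub
    _ = P.roots.toFinset.card := by rw [Nat.card_coe_set_eq, Set.ncard_coe_finset]
    _ ≤ P.roots.card := Multiset.toFinset_card_le _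
    _ ≤ P.natDegree := card_roots' P
    _ ≤ _ := hdeg

lemma card_range_mul_ker (f : Module.End K L) :
    Nat.card (LinearMap.range f) * Nat.card (LinearMap.ker f) = Fintype.card L := by
  rw [← Nat.card_congr f.quotKerEquivRange.toEquiv, ← Nat.card_eq_fintype_card, mul_comm]
  exact (Submodule.card_eq_card_quotient_mul_card (LinearMap.ker f)).symm ▸ (by rw [mul_comm])

lemma range_eq_ker {n : ℕ} (hn : 0 < n) (hL : Fintype.card L = Fintype.card K ^ n) (h k : K[X])
    (hk : h * k = X ^ n - 1) : LinearMap.range (FA K L h) = LinearMap.ker (FA K L k) ∧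
      Fintype.card K ^ h.natDegree * Nat.card (LinearMap.range (FA K L h)) ≤ Fintype.card L := by
  have hX : (X ^ n - 1 : K[X]) ≠ 0 := X_pow_sub_C_ne_zero hn 1
  have hh : h ≠ 0 := by rintro rfl; simp at hk; exact hX hk.symm
  have hk0 : k ≠ 0 := by rintro rfl; simp at hk; exact hX hk.symm
  have hq : 0 < Fintype.card K := Fintype.card_pos
  have hdeg : h.natDegree + k.natDegree = n := by
    rw [← natDegree_mul hh hk0, hk]; exact natDegree_X_pow_sub_C
  have hsub : LinearMap.range (FA K L h) ≤ LinearMap.ker (FA K L k) := by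
    rintro _ ⟨x, rfl⟩
    rw [LinearMap.mem_ker, ← FA_mul, mul_comm, hk, FA_Xn hn hL]
  have h1 := card_ker_FA (L := L) h hh
  have h2 := card_ker_FA (L := L) k hk0
  have h3 := card_range_mul_ker (FA K L h)
  have hle : Nat.card (LinearMap.range (FA K L h)) ≤ Nat.card (LinearMap.ker (FA K L k)) :=
    Nat.card_mono (Set.toFinite _) hsub
  have hpw : Fintype.card K ^ h.natDegree * Fintype.card K ^ k.natDegree = Fintype.card L := by
    rw [← pow_add, hdeg, hL]
  constructor
  · apply SetLike.coe_injective
    apply Set.eq_of_subset_of_ncard_le hsub _ (Set.toFinite _)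
    rw [← Nat.card_coe_set_eq, ← Nat.card_coe_set_eq]
    have hp : 0 < Fintype.card K ^ h.natDegree := pow_pos hq _
    have : Fintype.card K ^ k.natDegree ≤ Nat.card (LinearMap.range (FA K L h)) := by
      by_contra hc
      push Not at hc
      have : Nat.card (LinearMap.range (FA K L h)) * Nat.card (LinearMap.ker (FA K L h)) < Fintype.card K ^ k.natDegree * Fintype.card K ^ h.natDegree :=
        Nat.mul_lt_mul_of_lt_of_le hc h1 hp
      rw [h3, ← hpw, mul_comm] at this
      exact lt_irrefl _ this
    exact h2.trans this
  · rw [← hpw]; exact Nat.mul_le_mul_left _ (hle.trans h2)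

/-- additive characters killed by `h` -/
noncomputable def Hadd (K L : Type) [Field K] [Field L] [Fintype K] [Algebra K L] (h : K[X]) : Subgroup (AddChar L ℂ) where
  carrier := {ψ | ∀ x, ψ (FA K L h x) = 1}
  one_mem' := by intro x; simp
  mul_mem' := by intro a b ha hb x; rw [AddChar.mul_apply, ha x, hb x, one_mul]
  inv_mem' := by intro a ha x; rw [AddChar.inv_apply, ← map_neg, ha]

lemma mem_Hadd {h : K[X]} {ψ : AddChar L ℂ} : ψ ∈ Hadd K L h ↔ ∀ x, ψ (FA K L h x) = 1 := Iff.rfl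

lemma card_Hadd {n : ℕ} (hn : 0 < n) (hL : Fintype.card L = Fintype.card K ^ n) (h : K[X])
    (hh : h ∣ X ^ n - 1) : Fintype.card K ^ h.natDegree ≤ Nat.card (Hadd K L h) := by
  classical
  obtain ⟨k, hk⟩ := hh
  have h1 := (range_eq_ker hn hL h k hk.symm).2
  set R := LinearMap.range (FA K L h) with hR
  have h2 : Nat.card (L ⧸ R) ≤ Nat.card (Hadd K L h) := by
    have : Nat.card (AddChar (L ⧸ R) ℂ) = Nat.card (L ⧸ R) := by
      have : Fintype (L ⧸ R) := Fintype.ofFinite _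
      rw [Nat.card_eq_fintype_card, Nat.card_eq_fintype_card, AddChar.card_eq]
    rw [← this]
    refine Nat.card_le_card_of_injective (fun ψ : AddChar (L ⧸ R) ℂ =>
      (⟨ψ.compAddMonoidHom R.mkQ.toAddMonoidHom, ?_⟩ : Hadd K L h)) ?_
    · intro x
      have : R.mkQ (FA K L h x) = 0 := by
        rw [Submodule.mkQ_apply, Submodule.Quotient.mk_eq_zero]; exact ⟨x, rfl⟩
      show ψ (R.mkQ (FA K L h x)) = 1
      rw [this, AddChar.map_zero_eq_one]
    · intro a b hab
      have hab' := congrArg (fun z : Hadd K L h => z.1) hab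
      ext y
      obtain ⟨x, rfl⟩ := R.mkQ_surjective y
      exact DFunLike.congr_fun hab' x
  have h3 : Fintype.card L = Nat.card (L ⧸ R) * Nat.card R := by
    rw [← Nat.card_eq_fintype_card, Submodule.card_eq_card_quotient_mul_card R, mul_comm]
  rw [h3] at h1
  exact (Nat.le_of_mul_le_mul_right h1 Nat.card_pos).trans h2

lemma indep_add {ι : Type*} (J : Finset ι) (h : ι → K[X]) (x : ι → AddChar L ℂ)
    (hn : ∀ i ∈ J, ∀ j ∈ J, i ≠ j → IsCoprime (h i) (h j)) (hx : ∀ i ∈ J, x i ∈ Hadd K L (h i))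
    (h1 : ∏ i ∈ J, x i = 1) : ∀ i ∈ J, x i = 1 := by
  classical
  intro i hi
  have hc : IsCoprime (h i) (∏ j ∈ J.erase i, h j) := by
    apply IsCoprime.prod_right
    intro j hj
    exact hn i hi j (Finset.mem_of_mem_erase hj) (Finset.ne_of_mem_erase hj).symm
  obtain ⟨u, v, huv⟩ := hc
  ext y
  have hy : y = FA K L (h i) (FA K L u y) + FA K L (∏ j ∈ J.erase i, h j) (FA K L v y) := by
    rw [← FA_mul, ← FA_mul, mul_comm, mul_comm _ v, ← LinearMap.add_apply, ← map_add, huv, map_one]; rfl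
  rw [hy, AddChar.map_add_eq_mul, hx i hi, one_mul, AddChar.one_apply]
  set z := FA K L (∏ j ∈ J.erase i, h j) (FA K L v y) with hz
  rw [← Finset.mul_prod_erase J x hi] at h1
  have h2 : x i z * ∏ j ∈ J.erase i, x j z = 1 := by
    have := DFunLike.congr_fun h1 z
    rwa [AddChar.mul_apply, AddChar.prod_apply, AddChar.one_apply] at this
  rw [Finset.prod_eq_one, mul_one] at h2
  · exact h2
  · intro j hj
    rw [hz, ← Finset.mul_prod_erase _ h hj, FA_mul]
    exact hx j (Finset.mem_of_mem_erase hj) _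

lemma event_add {h : K[X]} {ψ : AddChar L ℂ} (hψ : ψ ∈ Hadd K L h) {x : L} (hx : ψ x ≠ 1) :
    ∀ y, FA K L h y ≠ x := by
  rintro y rfl; exact hx (hψ y)

lemma normal_of {n : ℕ} (hn : 0 < n) (hL : Fintype.card L = Fintype.card K ^ n) (α : L)
    (hα : ∀ h : K[X], h.Monic → Irreducible h → h ∣ X ^ n - 1 → ∀ y, FA K L h y ≠ α) :
    LinearIndependent K (fun i : Fin n => α ^ Fintype.card K ^ (i : ℕ)) ∧
    Submodule.span K (Set.range fun i : Fin n => α ^ Fintype.card K ^ (i : ℕ)) = ⊤ := by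
  classical
  have hX : (X ^ n - 1 : K[X]) ≠ 0 := X_pow_sub_C_ne_zero hn 1
  have key : ∀ c : K[X], c.natDegree < n → FA K L c α = 0 → c = 0 := by
    intro c hc h0
    by_contra hc0
    set t := EuclideanDomain.gcd c (X ^ n - 1) with ht
    have htα : FA K L t α = 0 := by
      rw [ht, EuclideanDomain.gcd_eq_gcd_ab, map_add, LinearMap.add_apply, mul_comm, FA_mul, h0, mul_comm, FA_mul, FA_Xn hn hL]
      simp
    obtain ⟨s, hs⟩ : t ∣ X ^ n - 1 := EuclideanDomain.gcd_dvd_right _ _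
    have htc : t.natDegree ≤ c.natDegree := natDegree_le_of_dvd (EuclideanDomain.gcd_dvd_left _ _) hc0
    have hs0 : s ≠ 0 := by rintro rfl; simp at hs; exact hX hs
    have ht0 : t ≠ 0 := by intro h; rw [h] at hs; simp at hs; exact hX hs
    have hsdeg : ¬ IsUnit s := by
      intro hu
      have h1 : (X ^ n - 1 : K[X]).natDegree = n := natDegree_X_pow_sub_C
      rw [hs, natDegree_mul ht0 hs0, natDegree_eq_zero_of_isUnit hu] at h1
      omega
    obtain ⟨h, hm, hi, r, hr⟩ := exists_monic_irreducible_factor s hsdeg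
    have hk : h * (t * r) = X ^ n - 1 := by rw [hs, hr]; ring
    have hrk := (range_eq_ker hn hL h (t * r) hk).1
    have : α ∈ LinearMap.range (FA K L h) := by
      rw [hrk, LinearMap.mem_ker, mul_comm, FA_mul, htα, map_zero]
    obtain ⟨y, hy⟩ := this
    exact hα h hm hi ⟨_, hk.symm⟩ y hy
  have hli : LinearIndependent K (fun i : Fin n => α ^ Fintype.card K ^ (i : ℕ)) := by
    rw [Fintype.linearIndependent_iff]
    intro g hg
    let c : K[X] := ∑ i : Fin n, C (g i) * X ^ (i : ℕ)
    have hcoeff : ∀ i : Fin n, c.coeff i = g i := by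
      intro i
      simp only [c, finsetSum_coeff, coeff_C_mul, coeff_X_pow]
      rw [Finset.sum_eq_single i]
      · simp
      · intro j _ hj; rw [if_neg, mul_zero]; intro h; exact hj (Fin.ext h.symm)
      · simp
    have hdeg : c.natDegree < n := by
      have : c.natDegree ≤ n - 1 := by
        apply natDegree_sum_le_of_forall_le
        intro i _
        refine (natDegree_C_mul_X_pow_le _ _).trans ?_
        have := i.2; omega
      omega
    have hc : FA K L c α = 0 := by
      simp only [c, map_sum, LinearMap.sum_apply]
      rw [← hg]
      refine Finset.sum_congr rfl fun i _ => ?_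
      rw [FA, ← smul_eq_C_mul, map_smul, map_pow, aeval_X, LinearMap.smul_apply, frob_pow]
    have := key c hdeg hc
    intro i; rw [← hcoeff i, this, coeff_zero]
  refine ⟨hli, ?_⟩
  apply hli.span_eq_top_of_card_eq_finrank'
  have h1 := Module.card_eq_pow_finrank (K := K) (V := L)
  rw [hL] at h1
  rw [Fintype.card_fin]
  exact Nat.pow_right_injective Fintype.one_lt_card h1
end
end W

open Polynomial
set_option linter.unusedSectionVars false
namespace W
section
variable {L : Type} [Field L] [Fintype L]

lemma mult_facts {g : L[X]} (hg : Irreducible g) : ∃ v : L[X] → ℕ,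
    (∀ a b, a ≠ 0 → b ≠ 0 → v (a * b) = v a + v b) ∧ (∀ a, a ≠ 0 → ∀ n, v (a ^ n) = n * v a) ∧
    (∀ a, a ≠ 0 → ¬ g ∣ a → v a = 0) ∧ (∀ a k, g ^ k ∣ a → ¬ g ^ (k+1) ∣ a → v a = k) := by
  have hp := hg.prime
  have hfin : ∀ a : L[X], a ≠ 0 → FiniteMultiplicity g a := fun a ha =>
    FiniteMultiplicity.of_prime_left hp ha
  refine ⟨fun a => multiplicity g a, ?_, ?_, ?_, ?_⟩
  · intro a b ha hb
    exact multiplicity_mul hp (hfin _ (mul_ne_zero ha hb))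
  · intro a ha n
    exact (hfin a ha).multiplicity_pow hp
  · intro a ha h
    exact multiplicity_eq_zero.2 h
  · intro a k h1 h2
    exact multiplicity_eq_of_dvd_of_not_dvd h1 h2

lemma not_power_fn {f1 f2 : L[X]} (h10 : f1 ≠ 0) (h20 : f2 ≠ 0) (hco : IsCoprime f1 f2)
    {k : ℕ} {g : L[X]} (hgm : g.Monic) (hg : Irreducible g) (hgX : g ≠ X)
    (hk : Nat.gcd k (Fintype.card L - 1) = 1) (hd : g ^ k ∣ f1 * f2) (hnd : ¬ g ^ (k+1) ∣ f1 * f2)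
    {a b : ℕ} (ha : 1 ≤ a) (ha' : a ≤ Fintype.card L - 1) (hb : 1 ≤ b) (hb' : b ≤ Fintype.card L - 1)
    {u : L[X]} (hu : IsUnit u) (G : L[X])
    (h : u * (X ^ a * f1 ^ b * f2 ^ (2 * (Fintype.card L - 1) - b)) = G ^ (Fintype.card L - 1)) :
    a = Fintype.card L - 1 ∧ b = Fintype.card L - 1 := by
  set D := Fintype.card L - 1 with hD
  have hu0 := hu.ne_zero
  have hG0 : G ≠ 0 := by
    rintro rfl
    rw [zero_pow (by omega)] at h
    have h1 : u * (X ^ a * f1 ^ b * f2 ^ (2 * D - b)) ≠ 0 :=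
      mul_ne_zero hu0 (mul_ne_zero (mul_ne_zero (pow_ne_zero _ X_ne_zero) (pow_ne_zero _ h10)) (pow_ne_zero _ h20))
    exact h1 h
  have gen : ∀ p : L[X], Irreducible p → ∃ v : L[X] → ℕ,  a * v X + b * v f1 + (2 * D - b) * v f2 = D * v G ∧
     (∀ a b, a ≠ 0 → b ≠ 0 → v (a * b) = v a + v b) ∧ 
    (∀ a, a ≠ 0 → ¬ p ∣ a → v a = 0) ∧ (∀ a k, p ^ k ∣ a → ¬ p ^ (k+1) ∣ a → v a = k) := by
    intro p hp
    obtain ⟨v, v1, v2, v3, v4⟩ := mult_facts hp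
    refine ⟨v, ?_, v1, v3, v4⟩
    have := congrArg v h
    rw [v1 _ _ hu0 (mul_ne_zero (mul_ne_zero (pow_ne_zero _ X_ne_zero) (pow_ne_zero _ h10)) (pow_ne_zero _ h20)),
      v1 _ _ (mul_ne_zero (pow_ne_zero _ X_ne_zero) (pow_ne_zero _ h10)) (pow_ne_zero _ h20),
      v1 _ _ (pow_ne_zero _ X_ne_zero) (pow_ne_zero _ h10), v2 _ X_ne_zero, v2 _ h10, v2 _ h20, v2 _ hG0,
      v3 u hu0 (fun hpu => hp.not_isUnit (isUnit_of_dvd_unit hpu hu)), zero_add] at this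
    exact this
  have hbD : b = D := by
    obtain ⟨v, v0, v1, v3, v4⟩ := gen g hg
    have hvX : v X = 0 := by
      apply v3 _ X_ne_zero
      intro hgx
      exact hgX (eq_of_monic_of_associated hgm monic_X ((hg.dvd_irreducible_iff_associated irreducible_X).1 hgx))
    have hsum : v f1 + v f2 = k := by rw [← v1 _ _ h10 h20]; exact v4 _ _ hd hnd
    have hDd : D ∣ b * k := by
      by_cases hg1 : g ∣ f1
      · have hg2 : ¬ g ∣ f2 := fun hg2 => hg.not_isUnit (hco.isUnit_of_dvd' hg1 hg2)
        rw [hvX, v3 _ h20 hg2, mul_zero, mul_zero, zero_add, add_zero] at v0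
        rw [v3 _ h20 hg2, add_zero] at hsum
        rw [← hsum, v0]; exact dvd_mul_right _ _
      · rw [hvX, v3 _ h10 hg1, mul_zero, mul_zero, zero_add, zero_add] at v0
        rw [v3 _ h10 hg1, zero_add] at hsum
        rw [hsum] at v0
        have h5 : D ∣ (2 * D - b) * k + b * k := by
          rw [← add_mul, Nat.sub_add_cancel (by omega)]
          exact ⟨2 * k, by ring⟩
        exact (Nat.dvd_add_right ⟨v G, v0⟩).1 h5
    have : D ∣ b := Nat.Coprime.dvd_of_dvd_mul_right (by rw [Nat.coprime_comm]; exact hk) hDd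
    exact le_antisymm hb' (Nat.le_of_dvd (by omega) this)
  refine ⟨?_, hbD⟩
  obtain ⟨v, v0, v1, v3, v4⟩ := gen X irreducible_X
  have hvX : v X = 1 := by
    apply v4
    · simp
    · intro h
      have := natDegree_le_of_dvd h X_ne_zero
      simp at this
  rw [hvX, mul_one, hbD] at v0
  have h2 : 2 * D - D = D := by omega
  rw [h2] at v0
  have : D ∣ a := by
    have h6 : D ∣ a + (D * v f1 + D * v f2) := ⟨v G, by rw [← v0]; ring⟩
    exact (Nat.dvd_add_left ⟨v f1 + v f2, by ring⟩).1 h6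
  exact le_antisymm ha' (Nat.le_of_dvd (by omega) this)

lemma charsum [DecidableEq L] {f1 f2 : L[X]} (h10 : f1 ≠ 0) (h20 : f2 ≠ 0) (hco : IsCoprime f1 f2)
    (hd1 : f1.natDegree ≤ 3) (hd2 : f2.natDegree ≤ 2)
    {k : ℕ} {g : L[X]} (hgm : g.Monic) (hg : Irreducible g) (hgX : g ≠ X)
    (hk : Nat.gcd k (Fintype.card L - 1) = 1) (hd : g ^ k ∣ f1 * f2) (hnd : ¬ g ^ (k+1) ∣ f1 * f2)
    (μ1 μ2 : MulChar L ℂ) (ψ : AddChar L ℂ) (hne : (μ1, μ2, ψ) ≠ 1) :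
    ‖∑ α ∈ Finset.univ.filter (fun α : L => α ≠ 0 ∧ f1.eval α ≠ 0 ∧ f2.eval α ≠ 0),
      μ1 α * μ2 (f1.eval α / f2.eval α) * ψ α‖ ≤ 6 * √(Fintype.card L : ℝ) := by
  obtain ⟨χ, hχ, hfaith, hall⟩ := exists_faithful (L := L)
  obtain ⟨a, ha, ha', rfl⟩ := hall μ1
  obtain ⟨b, hb, hb', rfl⟩ := hall μ2
  set D := Fintype.card L - 1 with hD
  set c1 := f1.leadingCoeff with hc1
  set c2 := f2.leadingCoeff with hc2
  have hc10 : c1 ≠ 0 := leadingCoeff_ne_zero.2 h10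
  have hc20 : c2 ≠ 0 := leadingCoeff_ne_zero.2 h20
  let p1 := f1 * C c1⁻¹
  let p2 := f2 * C c2⁻¹
  have hp1 : p1.Monic := monic_mul_leadingCoeff_inv h10
  have hp2 : p2.Monic := monic_mul_leadingCoeff_inv h20
  let F := X ^ a * p1 ^ b * p2 ^ (2 * D - b)
  have hF : F.Monic := ((monic_X.pow a).mul (hp1.pow b)).mul (hp2.pow _)
  let m := X * p1 * p2
  have hm : m.Monic := (monic_X.mul hp1).mul hp2
  have hmd : m.natDegree ≤ 6 := by
    have e1 : p1.natDegree = f1.natDegree := natDegree_mul_C (inv_ne_zero hc10)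
    have e2 : p2.natDegree = f2.natDegree := natDegree_mul_C (inv_ne_zero hc20)
    have : m.natDegree = 1 + p1.natDegree + p2.natDegree := by
      rw [Monic.natDegree_mul (monic_X.mul hp1) hp2, Monic.natDegree_mul monic_X hp1, natDegree_X]
    omega
  have hFm : F ∣ m ^ (2 * D) := by
    rw [show m ^ (2*D) = X ^ (2*D) * p1 ^ (2*D) * p2 ^ (2*D) by simp only [m, mul_pow]]
    exact mul_dvd_mul (mul_dvd_mul (pow_dvd_pow _ (by omega)) (pow_dvd_pow _ (by omega))) (pow_dvd_pow _ (by omega))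
  have hnt : ψ ≠ 1 ∨ ¬ ∃ G : L[X], G.Monic ∧ G ^ (Fintype.card L - 1) = F := by
    by_contra hcon
    push Not at hcon
    obtain ⟨hψ, G, -, hG⟩ := hcon
    have hu : IsUnit ((C c1⁻¹) ^ b * (C c2⁻¹) ^ (2 * D - b) : L[X]) :=
      ((isUnit_C.2 (inv_ne_zero hc10).isUnit).pow _).mul ((isUnit_C.2 (inv_ne_zero hc20).isUnit).pow _)
    obtain ⟨e1, e2⟩ := not_power_fn h10 h20 hco hgm hg hgX hk hd hnd ha ha' hb hb' hu G (by
      rw [hG]; simp only [F, p1, p2, mul_pow]; ring)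
    apply hne
    rw [e1, e2, hψ, ← hD, ← hχ, pow_orderOf_eq_one]; rfl
  have hw := weil χ hfaith ψ F m hF hm (2 * D) hFm hnt
  have hpt : ∀ α : L, α ∈ Finset.univ.filter (fun α : L => α ≠ 0 ∧ f1.eval α ≠ 0 ∧ f2.eval α ≠ 0) →
      (χ ^ a) α * (χ ^ b) (f1.eval α / f2.eval α) * ψ α = (χ ^ b) (c1 / c2) * (χ (F.eval α) * ψ α) := by
    intro α hα
    simp only [Finset.mem_filter, Finset.mem_univ, true_and] at hα
    obtain ⟨hα0, hα1, hα2⟩ := hα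
    rw [MulChar.pow_apply' _ (by omega), MulChar.pow_apply' _ (by omega), MulChar.pow_apply' _ (by omega),
      ← map_pow, ← map_pow, ← map_pow, ← mul_assoc, ← map_mul, ← map_mul]
    congr 2
    have e2 : p2.eval α ≠ 0 := by simp only [p2, eval_mul, eval_C]; exact mul_ne_zero hα2 (inv_ne_zero hc20)
    have e3 : (p2.eval α) ^ (2 * D - b) = ((p2.eval α) ^ b)⁻¹ := by
      apply eq_inv_of_mul_eq_one_left
      rw [← pow_add, Nat.sub_add_cancel (by omega), mul_comm, pow_mul,
        FiniteField.pow_card_sub_one_eq_one _ e2, one_pow]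
    simp only [F, eval_mul, eval_pow, eval_X, e3]
    simp only [p1, p2, eval_mul, eval_C]
    simp only [mul_pow, div_pow, inv_pow]
    field_simp
  have hsum : ∑ x : L, χ (F.eval x) * ψ x = ∑ α ∈ Finset.univ.filter (fun α : L => α ≠ 0 ∧ f1.eval α ≠ 0 ∧ f2.eval α ≠ 0), χ (F.eval α) * ψ α := by
    symm
    apply Finset.sum_subset (Finset.subset_univ _)
    intro x _ hx
    simp only [Finset.mem_filter, Finset.mem_univ, true_and, not_and_or, not_not] at hx
    have : F.eval x = 0 := by
      simp only [F, eval_mul, eval_pow, eval_X, p1, p2]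
      rcases hx with h | h | h
      · rw [h, zero_pow (by omega)]; ring
      · rw [h, zero_mul, zero_pow (by omega)]; ring
      · rw [h, zero_mul, zero_pow (n := 2 * D - b) (by omega)]; ring
    rw [this, MulChar.map_zero, zero_mul]
  rw [Finset.sum_congr rfl hpt, ← Finset.mul_sum, ← hsum, norm_mul]
  have hn1 : ‖(χ ^ b) (c1 / c2)‖ ≤ 1 := MulChar_norm_le _ _
  calc _ ≤ 1 * ((m.natDegree : ℝ) * √(Fintype.card L : ℝ)) :=
        mul_le_mul hn1 hw (norm_nonneg _) zero_le_one
    _ ≤ 6 * √(Fintype.card L : ℝ) := by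
      rw [one_mul]
      exact mul_le_mul_of_nonneg_right (by exact_mod_cast hmd) (Real.sqrt_nonneg _)

lemma card_good [DecidableEq L] {f1 f2 : L[X]} (h10 : f1 ≠ 0) (h20 : f2 ≠ 0)
    (hd1 : f1.natDegree ≤ 3) (hd2 : f2.natDegree ≤ 2) :
    Fintype.card L ≤ (Finset.univ.filter (fun α : L => α ≠ 0 ∧ f1.eval α ≠ 0 ∧ f2.eval α ≠ 0)).card + 6 := by
  have h := Finset.card_filter_add_card_filter_not (s := (Finset.univ : Finset L)) (fun α : L => α ≠ 0 ∧ f1.eval α ≠ 0 ∧ f2.eval α ≠ 0)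
  rw [Finset.card_univ] at h
  have h2 : (Finset.univ.filter (fun α : L => ¬ (α ≠ 0 ∧ f1.eval α ≠ 0 ∧ f2.eval α ≠ 0))) ⊆
      insert 0 (f1.roots.toFinset ∪ f2.roots.toFinset) := by
    intro x hx
    simp only [Finset.mem_filter, Finset.mem_univ, true_and, not_and_or, not_not] at hx
    simp only [Finset.mem_insert, Finset.mem_union, Multiset.mem_toFinset, mem_roots h10, mem_roots h20, IsRoot.def]
    exact hx
  have h3 := Finset.card_le_card h2
  have h4 := Finset.card_insert_le (0:L) (f1.roots.toFinset ∪ f2.roots.toFinset)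
  have h5 := Finset.card_union_le f1.roots.toFinset f2.roots.toFinset
  have h6 := (Multiset.toFinset_card_le f1.roots).trans (card_roots' f1)
  have h7 := (Multiset.toFinset_card_le f2.roots).trans (card_roots' f2)
  omega

lemma ratEval_eq {f1 f2 : L[X]} (h20 : f2 ≠ 0) (α : L) (hα : f2.eval α ≠ 0) :
    (algebraMap L[X] (RatFunc L) f1 / algebraMap L[X] (RatFunc L) f2).eval (RingHom.id L) α = f1.eval α / f2.eval α := by
  set r := algebraMap L[X] (RatFunc L) f1 / algebraMap L[X] (RatFunc L) f2 with hr
  have h1 : r.num * f2 = f1 * r.denom := (RatFunc.num_mul_eq_mul_denom_iff h20).2 hr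
  have h2 : r.denom ∣ f2 := RatFunc.denom_div_dvd f1 f2
  have h3 : r.denom.eval α ≠ 0 := by
    intro h
    obtain ⟨c, hc⟩ := h2
    apply hα
    rw [hc, eval_mul, h, zero_mul]
  have h4 := congrArg (eval α) h1
  rw [eval_mul, eval_mul] at h4
  rw [RatFunc.eval, eval₂_id, eval₂_id, div_eq_div_iff h3 hα, h4]
end
end W

open Polynomial
set_option linter.unusedSectionVars false
namespace W
section

lemma real_cond {Q B a δ δ' : ℝ} {c c' R R' : ℕ} (hQ : 36 ≤ Q) (hB : B = 6 * √Q) (ha : Q ≤ a + 6)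
    (hc : c' ≤ c) (hR : R' ≤ R) (hδ0 : 0 < δ) (hδ : δ ≤ δ')
    (h1 : 12 * 2 ^ c ≤ √Q) (h2 : 6 * 2 ^ c * ((R:ℝ) - 1) < δ * (√Q - 12 * 2 ^ c)) :
    (2:ℝ) ^ c' * B * (R' - (1 - δ')) < δ' * (a - (2 ^ c' - 1) * B) := by
  set s := √Q with hs
  have hss : s * s = Q := Real.mul_self_sqrt (by linarith)
  have hs6 : 6 ≤ s := by
    rw [hs]; apply Real.le_sqrt_of_sq_le; linarith
  have hcc : (2:ℝ) ^ c' ≤ 2 ^ c := pow_le_pow_right₀ (by norm_num) hc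
  have hp : (0:ℝ) < 2 ^ c' := by positivity
  have hRR : (R' : ℝ) ≤ R := by exact_mod_cast hR
  generalize (2:ℝ) ^ c' = t' at *
  generalize (2:ℝ) ^ c = t at *
  generalize (R:ℝ) = r at *
  have hr0 : (0:ℝ) ≤ R' := by positivity
  generalize (R':ℝ) = r' at *
  have e1 : 6 * t * (r - 1) < δ' * (s - 12 * t) :=
    h2.trans_le (mul_le_mul_of_nonneg_right hδ (by linarith))
  have e2 : 6 * t' * (r' - 1) < δ' * (s - 12 * t') := by
    by_cases hr : 1 ≤ r'
    · have : 6 * t' * (r' - 1) ≤ 6 * t * (r - 1) := by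
        apply mul_le_mul <;> linarith
      have h4 : δ' * (s - 12 * t) ≤ δ' * (s - 12 * t') := by
        apply mul_le_mul_of_nonneg_left <;> linarith
      linarith
    · have h5 : 6 * t' * (r' - 1) < 0 := by
        apply mul_neg_of_pos_of_neg <;> linarith
      have : 0 ≤ δ' * (s - 12 * t') := mul_nonneg (by linarith) (by linarith)
      linarith
  have e3 : s * (6 * t' * (r' - 1)) < s * (δ' * (s - 12 * t')) := mul_lt_mul_of_pos_left e2 (by linarith)
  have e4 : 0 ≤ δ' * (a + 6 * s - s * s) := mul_nonneg (by linarith) (by linarith)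
  rw [hB]
  nlinarith

variable {K L : Type} [Field K] [Field L] [Fintype K] [Fintype L] [Algebra K L]

/-- subgroups used in the sieve -/
noncomputable def HH (K L : Type) [Field K] [Field L] [Fintype K] [Algebra K L] (P : Finset ℕ) (S : Finset K[X]) :
    (P ⊕ P ⊕ S) → Subgroup (MulChar L ℂ × MulChar L ℂ × AddChar L ℂ)
  | .inl p => (Hmul L p.1).prod ⊥
  | .inr (.inl p) => (⊥ : Subgroup (MulChar L ℂ)).prod ((Hmul L p.1).prod ⊥)
  | .inr (.inr s) => (⊥ : Subgroup (MulChar L ℂ)).prod ((⊥ : Subgroup (MulChar L ℂ)).prod (Hadd K L s.1))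

/-- lower bounds for sizes -/
noncomputable def NN (K : Type) [Field K] [Fintype K] (P : Finset ℕ) (S : Finset K[X]) : (P ⊕ P ⊕ S) → ℕ
  | .inl p => p.1
  | .inr (.inl p) => p.1
  | .inr (.inr s) => Fintype.card K ^ s.1.natDegree

noncomputable def n1 (P : Finset ℕ) (S : Finset K[X]) : (P ⊕ P ⊕ S) → ℕ
  | .inl p => p.1
  | .inr (.inl _) => 1
  | .inr (.inr _) => 1
noncomputable def n2 (P : Finset ℕ) (S : Finset K[X]) : (P ⊕ P ⊕ S) → ℕ
  | .inl _ => 1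
  | .inr (.inl p) => p.1
  | .inr (.inr _) => 1
noncomputable def n3 (P : Finset ℕ) (S : Finset K[X]) : (P ⊕ P ⊕ S) → K[X]
  | .inl _ => 1
  | .inr (.inl _) => 1
  | .inr (.inr s) => s.1

lemma mem_HH {P : Finset ℕ} {S : Finset K[X]} {i : P ⊕ P ⊕ S} {γ : MulChar L ℂ × MulChar L ℂ × AddChar L ℂ}
    (h : γ ∈ HH K L P S i) : γ.1 ^ n1 P S i = 1 ∧ γ.2.1 ^ n2 P S i = 1 ∧ γ.2.2 ∈ Hadd K L (n3 P S i) := by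
  obtain ⟨a, b, c⟩ := γ
  rcases i with p | p | s
  · simp only [HH, Subgroup.mem_prod, Subgroup.mem_bot, mem_Hmul] at h
    have := Prod.ext_iff.1 h.2
    simp only [Prod.fst_one, Prod.snd_one] at this
    simp [n1, n2, n3, h.1, this.1, this.2, (Hadd K L 1).one_mem]
  · simp only [HH, Subgroup.mem_prod, Subgroup.mem_bot, mem_Hmul] at h
    simp [n1, n2, n3, h.1, h.2.1, h.2.2, (Hadd K L 1).one_mem]
  · simp only [HH, Subgroup.mem_prod, Subgroup.mem_bot] at h
    simp [n1, n2, n3, h.1, h.2.1, h.2.2]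

lemma indep_HH {P : Finset ℕ} {S : Finset K[X]} (hP : ∀ p ∈ P, p.Prime)
    (hS : ∀ s ∈ S, s.Monic ∧ Irreducible s) :
    ∀ J : Finset (P ⊕ P ⊕ S), ∀ γ : (P ⊕ P ⊕ S) → MulChar L ℂ × MulChar L ℂ × AddChar L ℂ,
      (∀ i ∈ J, γ i ∈ HH K L P S i) → ∏ i ∈ J, γ i = 1 → ∀ i ∈ J, γ i = 1 := by
  intro J γ hγ h1 i hi
  have hcop : ∀ p q : P, p ≠ q → Nat.Coprime p.1 q.1 := by
    intro p q hpq
    exact (Nat.coprime_primes (hP _ p.2) (hP _ q.2)).2 (fun h => hpq (Subtype.ext h))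
  have e1 := indep_coprime J (n1 P S) (fun i => (γ i).1) (by
    rintro (p | p | s) - (p' | p' | s') - hij <;> simp only [n1, Nat.coprime_one_left_iff, Nat.coprime_one_right_iff]
    exact hcop _ _ (fun h => hij (congrArg Sum.inl h))) (fun i hi => (mem_HH (hγ i hi)).1) (by
      rw [← Prod.fst_prod, h1]; rfl) i hi
  have e2 := indep_coprime J (n2 P S) (fun i => (γ i).2.1) (by
    rintro (p | p | s) - (p' | p' | s') - hij <;> simp only [n2, Nat.coprime_one_left_iff, Nat.coprime_one_right_iff]
    exact hcop _ _ (fun h => hij (congrArg (fun z => Sum.inr (Sum.inl z)) h))) (fun i hi => (mem_HH (hγ i hi)).2.1) (by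
      rw [← Prod.fst_prod, ← Prod.snd_prod, h1]; rfl) i hi
  have e3 := indep_add (K := K) J (n3 P S) (fun i => (γ i).2.2) (by
    rintro (p | p | s) - (p' | p' | s') - hij <;> simp only [n3, isCoprime_one_left, isCoprime_one_right]
    refine (hS _ s.2).2.coprime_iff_not_dvd.2 (fun hd => hij ?_)
    have := eq_of_monic_of_associated (hS _ s.2).1 (hS _ s'.2).1
      (((hS _ s.2).2.dvd_irreducible_iff_associated (hS _ s'.2).2).1 hd)
    rw [Subtype.ext this]) (fun i hi => (mem_HH (hγ i hi)).2.2) (by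
      rw [← Prod.snd_prod, ← Prod.snd_prod, h1]; rfl) i hi
  exact Prod.ext e1 (Prod.ext e2 e3)

instance finMul : Finite (MulChar L ℂ) := inferInstance
instance finAdd : Finite (AddChar L ℂ) := inferInstance

lemma card_HH {n : ℕ} (hn : 0 < n) (hL : Fintype.card L = Fintype.card K ^ n)
    {P : Finset ℕ} {S : Finset K[X]} (hP : ∀ p ∈ P, p.Prime ∧ p ∣ Fintype.card L - 1)
    (hS : ∀ s ∈ S, s ∣ X ^ n - 1) (i : P ⊕ P ⊕ S) : NN K P S i ≤ Nat.card (HH K L P S i) := by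
  have hinj : ∀ {A : Type} [CommGroup A] [Finite A] (H : Subgroup A) (H' : Subgroup (MulChar L ℂ × MulChar L ℂ × AddChar L ℂ))
      (f : A → MulChar L ℂ × MulChar L ℂ × AddChar L ℂ) (hf : Function.Injective f) (hfm : ∀ x ∈ H, f x ∈ H'),
      Nat.card H ≤ Nat.card H' := by
    intro A _ _ H H' f hf hfm
    refine Nat.card_le_card_of_injective (fun x : H => (⟨f x.1, hfm _ x.2⟩ : H')) ?_
    intro x y hxy
    exact Subtype.ext (hf (congrArg (fun z : H' => z.1) hxy))
  rcases i with p | p | s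
  · refine (card_Hmul (L := L) (hP _ p.2).1.pos (hP _ p.2).2).trans ?_
    refine hinj _ _ (fun μ => (μ, 1, 1)) (fun x y h => (Prod.ext_iff.1 h).1) ?_
    intro x hx
    exact ⟨hx, rfl⟩
  · refine (card_Hmul (L := L) (hP _ p.2).1.pos (hP _ p.2).2).trans ?_
    refine hinj _ _ (fun μ => (1, μ, 1)) (fun x y h => (Prod.ext_iff.1 (Prod.ext_iff.1 h).2).1) ?_
    intro x hx
    exact ⟨rfl, hx, rfl⟩
  · refine (card_Hadd hn hL _ (hS _ s.2)).trans ?_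
    refine hinj _ _ (fun μ => (1, 1, μ)) (fun x y h => (Prod.ext_iff.1 (Prod.ext_iff.1 h).2).2) ?_
    intro x hx
    exact ⟨rfl, rfl, hx⟩

end
end W

open Polynomial
set_option linter.unusedSectionVars false
namespace W
section
variable {K L : Type} [Field K] [Field L] [Fintype K] [Fintype L] [Algebra K L]

/-- monic irreducible factors of `X ^ n - 1` -/
noncomputable def SS (K : Type) [Field K] (n : ℕ) : Finset K[X] := by
  classical exact (UniqueFactorizationMonoid.normalizedFactors (X ^ n - 1 : K[X])).toFinset

lemma mem_SS {n : ℕ} (hn : 0 < n) {s : K[X]} : s ∈ SS K n ↔ s.Monic ∧ Irreducible s ∧ s ∣ X ^ n - 1 := by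
  classical
  have hX : (X ^ n - 1 : K[X]) ≠ 0 := X_pow_sub_C_ne_zero hn 1
  rw [SS, Multiset.mem_toFinset, Polynomial.mem_normalizedFactors_iff hX]
  tauto

theorem criterion {n : ℕ} (hn : 0 < n) (hL : Fintype.card L = Fintype.card K ^ n) (hL36 : 36 ≤ Fintype.card L)
    (cp : ℕ → Prop) (cs : K[X] → Prop) [DecidablePred cp] [DecidablePred cs] (c R : ℕ) (δ : ℝ)
    (hc : 2 * ((Fintype.card L - 1).primeFactors.filter cp).card + ((SS K n).filter cs).card ≤ c)
    (hR : 2 * ((Fintype.card L - 1).primeFactors.filter (fun p => ¬ cp p)).card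
      + ((SS K n).filter (fun p => ¬ cs p)).card ≤ R)
    (hδ0 : 0 < δ)
    (hδ : 2 * ∑ p ∈ (Fintype.card L - 1).primeFactors.filter (fun p => ¬ cp p), (1 / (p:ℝ)) +
      ∑ s ∈ (SS K n).filter (fun p => ¬ cs p), (1 / (Fintype.card K : ℝ) ^ s.natDegree) ≤ 1 - δ)
    (h1 : 12 * 2 ^ c ≤ √(Fintype.card L : ℝ))
    (h2 : 6 * 2 ^ c * ((R:ℝ) - 1) < δ * (√(Fintype.card L : ℝ) - 12 * 2 ^ c))
    {f1 f2 : L[X]} (h20 : f2 ≠ 0) (hd1 : f1.natDegree ≤ 3) (hd2 : f2.natDegree ≤ 2) (hco : IsCoprime f1 f2)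
    {k : ℕ} {g : L[X]} (hgm : g.Monic) (hg : Irreducible g) (hgX : g ≠ X)
    (hk : Nat.gcd k (Fintype.card L - 1) = 1) (hd : g ^ k ∣ f1 * f2) (hnd : ¬ g ^ (k+1) ∣ f1 * f2) :
    ∃ α : L, f2.eval α ≠ 0 ∧ orderOf α = Fintype.card L - 1 ∧ orderOf (f1.eval α / f2.eval α) = Fintype.card L - 1 ∧
      LinearIndependent K (fun i : Fin n => α ^ Fintype.card K ^ (i : ℕ)) ∧
      Submodule.span K (Set.range fun i : Fin n => α ^ Fintype.card K ^ (i : ℕ)) = ⊤ := by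
  classical
  have h10 : f1 ≠ 0 := by rintro rfl; exact hnd (by simp)
  set P := (Fintype.card L - 1).primeFactors with hPdef
  set S := SS K n with hSdef
  have : Fintype (MulChar L ℂ × MulChar L ℂ × AddChar L ℂ) := Fintype.ofFinite _
  set A := Finset.univ.filter (fun α : L => α ≠ 0 ∧ f1.eval α ≠ 0 ∧ f2.eval α ≠ 0) with hA
  have hP : ∀ p ∈ P, p.Prime ∧ p ∣ Fintype.card L - 1 := fun p hp =>
    ⟨Nat.prime_of_mem_primeFactors hp, Nat.dvd_of_mem_primeFactors hp⟩
  have hS : ∀ s ∈ S, s.Monic ∧ Irreducible s ∧ s ∣ X ^ n - 1 := fun s hs => (mem_SS hn).1 hs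
  have hcard := card_HH (K := K) (L := L) hn hL hP (fun s hs => (hS s hs).2.2)
  have hNN2 : ∀ i, 2 ≤ NN K P S i := by
    rintro (p | p | s)
    · exact (hP _ p.2).1.two_le
    · exact (hP _ p.2).1.two_le
    · have e1 : 1 < Fintype.card K := Fintype.one_lt_card
      have e2 : 0 < s.1.natDegree := (hS _ s.2).2.1.natDegree_pos
      calc 2 ≤ Fintype.card K ^ 1 := by rw [pow_one]; omega
        _ ≤ _ := Nat.pow_le_pow_right (by omega) e2
  let co : (P ⊕ P ⊕ S) → Prop := fun i => match i with
    | .inl p => cp p.1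
    | .inr (.inl p) => cp p.1
    | .inr (.inr s) => cs s.1
  let C : Finset (P ⊕ P ⊕ S) := Finset.univ.filter co
  have hsplit : ∀ (w : (P ⊕ P ⊕ S) → ℝ) (w1 : ℕ → ℝ) (w2 : K[X] → ℝ), (∀ p, w (.inl p) = w1 p.1) →
      (∀ p, w (.inr (.inl p)) = w1 p.1) → (∀ s, w (.inr (.inr s)) = w2 s.1) →
      ∑ i ∈ Cᶜ, w i = 2 * ∑ p ∈ P.filter (fun p => ¬ cp p), w1 p + ∑ s ∈ S.filter (fun p => ¬ cs p), w2 s := by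
    intro w w1 w2 e1 e2 e3
    have : Cᶜ = Finset.univ.filter (fun i => ¬ co i) := by ext; simp [C]
    rw [this, Finset.sum_filter, Fintype.sum_sum_type, Fintype.sum_sum_type, Finset.sum_filter, Finset.sum_filter]
    simp only [e1, e2, e3, co]
    rw [Finset.sum_coe_sort P (fun p => if ¬ cp p then w1 p else 0), Finset.sum_coe_sort S (fun p => if ¬ cs p then w2 p else 0)]
    ring
  have hCcard : C.card = 2 * (P.filter cp).card + (S.filter cs).card := by
    rw [Finset.card_filter, Fintype.sum_sum_type, Fintype.sum_sum_type, Finset.card_filter, Finset.card_filter]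
    simp only [co]
    rw [← Finset.sum_coe_sort P, ← Finset.sum_coe_sort S, two_mul, add_assoc]
    congr!
  have hCc : (Cᶜ.card : ℝ) = 2 * (P.filter (fun p => ¬ cp p)).card + (S.filter (fun p => ¬ cs p)).card := by
    have := hsplit (fun _ => 1) (fun _ => 1) (fun _ => 1) (fun _ => rfl) (fun _ => rfl) (fun _ => rfl)
    simpa using this
  have hsum1 : ∑ i ∈ Cᶜ, 1 / (NN K P S i : ℝ) ≤ 1 - δ := by
    refine le_trans (le_of_eq ?_) hδ
    exact hsplit _ (fun p => 1 / (p:ℝ)) (fun s => 1 / (Fintype.card K : ℝ) ^ s.natDegree) (fun _ => rfl) (fun _ => rfl)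
      (fun s => by simp [NN])
  have hsum2 : ∑ i ∈ Cᶜ, 1 / (Nat.card (HH K L P S i) : ℝ) ≤ 1 - δ := by
    refine le_trans (Finset.sum_le_sum fun i _ => ?_) hsum1
    apply one_div_le_one_div_of_le
    · have := hNN2 i; exact_mod_cast (by omega : 0 < NN K P S i)
    · exact_mod_cast hcard i
  have hmain := sieve A (fun γ α => γ.1 α * γ.2.1 (f1.eval α / f2.eval α) * γ.2.2 α)
    (by
      intro a _ g h
      simp only [Prod.fst_mul, Prod.snd_mul, MulChar.mul_apply, AddChar.mul_apply]; ring)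
    (by
      intro a ha
      simp only [hA, Finset.mem_filter, Finset.mem_univ, true_and] at ha
      simp only [Prod.fst_one, Prod.snd_one, AddChar.one_apply]
      rw [MulChar.one_apply (isUnit_iff_ne_zero.2 ha.1), MulChar.one_apply (isUnit_iff_ne_zero.2 (div_ne_zero ha.2.1 ha.2.2))]
      ring)
    (6 * √(Fintype.card L : ℝ)) (by positivity)
    (by
      rintro ⟨μ1, μ2, ψ⟩ hne
      exact charsum h10 h20 hco hd1 hd2 hgm hg hgX hk hd hnd μ1 μ2 ψ hne)
    (HH K L P S) (fun i => (hNN2 i).trans (hcard i))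
    (indep_HH (fun p hp => (hP p hp).1) (fun s hs => ⟨(hS s hs).1, (hS s hs).2.1⟩)) C
    (by
      have := real_cond (Q := (Fintype.card L : ℝ)) (B := 6 * √(Fintype.card L : ℝ)) (a := A.card)
        (δ := δ) (δ' := 1 - ∑ i ∈ Cᶜ, 1 / (Nat.card (HH K L P S i) : ℝ)) (c := c) (c' := C.card) (R := R) (R' := Cᶜ.card)
        (by exact_mod_cast hL36) rfl (by exact_mod_cast card_good h10 h20 hd1 hd2) (by rw [hCcard]; exact hc)
        (by
          have e : Cᶜ.card = 2 * (P.filter (fun p => ¬ cp p)).card + (S.filter (fun p => ¬ cs p)).card := by exact_mod_cast hCc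
          rw [e]; exact hR) hδ0 (by linarith) h1 h2
      convert this using 2
      rw [Finset.sum_sub_distrib]; simp)
    (by linarith)
  obtain ⟨α, hα, hev⟩ := hmain
  simp only [hA, Finset.mem_filter, Finset.mem_univ, true_and] at hα
  have hβ : f1.eval α / f2.eval α ≠ 0 := div_ne_zero hα.2.1 hα.2.2
  have hone : ∀ x : L, x ≠ 0 → (1 : MulChar L ℂ) x = 1 := fun x hx => MulChar.one_apply (isUnit_iff_ne_zero.2 hx)
  refine ⟨α, hα.2.2, ?_, ?_, ?_⟩
  · apply primitive_of hα.1
    intro l hl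
    obtain ⟨⟨a, b, c⟩, hγ, hne⟩ := hev (.inl ⟨l, hl⟩)
    obtain ⟨e1, e2⟩ : a ∈ Hmul L l ∧ ((b, c) : MulChar L ℂ × AddChar L ℂ) = 1 := hγ
    have e3 := Prod.ext_iff.1 e2
    obtain ⟨rfl, rfl⟩ : b = 1 ∧ c = 1 := e3
    refine event_mul (hP l hl).2 e1 hα.1 ?_
    simpa [hone _ hβ] using hne
  · apply primitive_of hβ
    intro l hl
    obtain ⟨⟨a, b, c⟩, hγ, hne⟩ := hev (.inr (.inl ⟨l, hl⟩))
    obtain ⟨rfl, e1, rfl⟩ : a = 1 ∧ b ∈ Hmul L l ∧ c = 1 := hγ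
    refine event_mul (hP l hl).2 e1 hβ ?_
    simp only [hone _ hα.1, AddChar.one_apply, mul_one, one_mul] at hne
    exact hne
  · apply normal_of hn hL
    intro h hm hi hdv
    obtain ⟨⟨a, b, c⟩, hγ, hne⟩ := hev (.inr (.inr ⟨h, (mem_SS hn).2 ⟨hm, hi, hdv⟩⟩))
    obtain ⟨rfl, rfl, e1⟩ : a = 1 ∧ b = 1 ∧ c ∈ Hadd K L h := hγ
    refine event_add e1 ?_
    simp only [hone _ hα.1, hone _ hβ, mul_one, one_mul] at hne
    exact hne
end
end W

open Polynomial
set_option linter.unusedSectionVars false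
namespace W
section
variable {K : Type} [Field K] [Fintype K]

lemma sum_deg_le (T : Finset K[X]) (G : ℕ) (hG : 0 < G)
    (h : ∀ s ∈ T, s.Monic ∧ Irreducible s ∧ s ∣ X ^ G - 1) : ∑ s ∈ T, s.natDegree ≤ G := by
  have hX : (X ^ G - 1 : K[X]) ≠ 0 := X_pow_sub_C_ne_zero hG 1
  have hdeg : (X ^ G - 1 : K[X]).natDegree = G := natDegree_X_pow_sub_C (r := (1:K))
  have hd : ∏ s ∈ T, s ∣ (X ^ G - 1 : K[X]) := by
    apply Finset.prod_dvd_of_coprime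
    · intro a ha b hb hab
      have ha' := h a ha
      have hb' := h b hb
      refine (ha'.2.1.coprime_iff_not_dvd).2 fun hdv => hab ?_
      exact eq_of_monic_of_associated ha'.1 hb'.1 (ha'.2.1.associated_of_dvd hb'.2.1 hdv)
    · exact fun s hs => (h s hs).2.2
  have := natDegree_le_of_dvd hd hX
  rwa [natDegree_prod_of_monic _ _ (fun s hs => (h s hs).1), hdeg] at this

lemma dvd_gcd_X {s : K[X]} {a b : ℕ} (hs : Irreducible s) (ha : s ∣ X ^ a - 1) (hb : s ∣ X ^ b - 1) :
    s ∣ X ^ (Nat.gcd a b) - 1 := by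
  have hf : Fact (Irreducible s) := ⟨hs⟩
  have key : ∀ m : ℕ, s ∣ X ^ m - 1 ↔ (AdjoinRoot.root s) ^ m = 1 := by
    intro m
    rw [← AdjoinRoot.mk_eq_zero]
    simp [sub_eq_zero]
  rw [key] at *
  rw [← orderOf_dvd_iff_pow_eq_one] at *
  exact Nat.dvd_gcd ha hb

lemma dvd_strip (hK : Fintype.card K = 5) {s : K[X]} {m : ℕ} (hs : Irreducible s) (h : s ∣ X ^ (5 * m) - 1) :
    s ∣ X ^ m - 1 := by
  have h5 : CharP K 5 := by
    have : Fact (Nat.Prime 5) := ⟨by norm_num⟩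
    exact charP_of_card_eq_prime (by rw [hK])
  have : Fact (Nat.Prime 5) := ⟨by norm_num⟩
  have e : (X ^ (5 * m) - 1 : K[X]) = (X ^ m - 1) ^ 5 := by
    rw [sub_pow_char, mul_comm, pow_mul]; simp
  rw [e] at h
  exact hs.prime.dvd_of_dvd_pow h

/-- strip one factor 5 -/
def N5 (n : ℕ) : ℕ := if n % 5 = 0 then n / 5 else n

lemma N5_pos {n : ℕ} (hn : 0 < n) : 0 < N5 n := by unfold N5; split <;> omega

lemma SS_N5 (hK : Fintype.card K = 5) {n : ℕ} (hn : 0 < n) {s : K[X]} (hs : s ∈ SS K n) :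
    s.Monic ∧ Irreducible s ∧ s ∣ X ^ (N5 n) - 1 := by
  obtain ⟨h1, h2, h3⟩ := (mem_SS hn).1 hs
  refine ⟨h1, h2, ?_⟩
  unfold N5
  split
  · rename_i h5
    apply dvd_strip hK h2
    rwa [show 5 * (n / 5) = n by omega]
  · exact h3

lemma SS_deg_sum (hK : Fintype.card K = 5) {n : ℕ} (hn : 0 < n) : ∑ s ∈ SS K n, s.natDegree ≤ N5 n :=
  sum_deg_le _ _ (N5_pos hn) fun _ hs => SS_N5 hK hn hs

lemma SS_deg_sum_k (hK : Fintype.card K = 5) {n : ℕ} (hn : 0 < n) (k : ℕ) :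
    ∑ s ∈ (SS K n).filter (fun s => s.natDegree ∣ k), s.natDegree ≤ Nat.gcd (N5 n) (5 ^ k - 1) := by
  apply sum_deg_le _ _ (Nat.gcd_pos_of_pos_left _ (N5_pos hn))
  intro s hs
  rw [Finset.mem_filter] at hs
  obtain ⟨h1, h2, h3⟩ := SS_N5 hK hn hs.1
  refine ⟨h1, h2, dvd_gcd_X h2 h3 ?_⟩
  have h4 := (h2.natDegree_dvd_iff_dvd_X_pow_card_pow_sub_X).1 hs.2
  rw [Nat.card_eq_fintype_card, hK] at h4
  have e : (X ^ 5 ^ k - X : K[X]) = X * (X ^ (5 ^ k - 1) - 1) := by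
    have : 5 ^ k = (5 ^ k - 1) + 1 := by have := Nat.one_le_pow k 5 (by norm_num); omega
    rw [mul_sub, ← pow_succ', ← this, mul_one]
  rw [e] at h4
  rcases h2.prime.dvd_or_dvd h4 with h | h
  · exfalso
    have h5 : s ∣ (X ^ N5 n : K[X]) := h.trans (dvd_pow_self _ (N5_pos hn).ne')
    have h6 : s ∣ (1 : K[X]) := by
      have := dvd_sub h5 h3
      simpa using this
    exact h2.not_isUnit (isUnit_of_dvd_one h6)
  · exact h

lemma deg_pos {n : ℕ} (hn : 0 < n) {s : K[X]} (hs : s ∈ SS K n) : 0 < s.natDegree :=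
  ((mem_SS hn).1 hs).2.1.natDegree_pos

/-- divisor weight -/
def wt (a1 a2 a3 a4 a5 d : ℕ) : ℕ :=
  a1 * (if d ∣ 1 then d else 0) + a2 * (if d ∣ 2 then d else 0) + a3 * (if d ∣ 3 then d else 0)
    + a4 * (if d ∣ 4 then d else 0) + a5 * d

lemma wt_sum (hK : Fintype.card K = 5) {n : ℕ} (hn : 0 < n) (a1 a2 a3 a4 a5 : ℕ) :
    ∑ s ∈ SS K n, wt a1 a2 a3 a4 a5 s.natDegree ≤
      a1 * Nat.gcd (N5 n) 4 + a2 * Nat.gcd (N5 n) 24 + a3 * Nat.gcd (N5 n) 124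
        + a4 * Nat.gcd (N5 n) 624 + a5 * N5 n := by
  have h1 := SS_deg_sum_k (K := K) hK hn 1
  have h2 := SS_deg_sum_k (K := K) hK hn 2
  have h3 := SS_deg_sum_k (K := K) hK hn 3
  have h4 := SS_deg_sum_k (K := K) hK hn 4
  have h5 := SS_deg_sum (K := K) hK hn
  rw [Finset.sum_filter] at h1 h2 h3 h4
  norm_num at h1 h2 h3 h4
  unfold wt
  simp only [Finset.sum_add_distrib, ← Finset.mul_sum]
  simp only [Nat.dvd_one]
  gcongr

lemma wt_count {d : ℕ} (hd : 0 < d) : 60 ≤ wt 22 15 8 3 12 d := by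
  rcases Nat.lt_or_ge d 5 with h | h
  · interval_cases d <;> decide
  · unfold wt; omega

lemma wt_inv0 {d : ℕ} (hd : 0 < d) : 187500 ≤ wt 33262 3675 488 63 12 d * 5 ^ d := by
  rcases Nat.lt_or_ge d 5 with h | h
  · interval_cases d <;> decide
  · have : 5 ^ 5 ≤ 5 ^ d := Nat.pow_le_pow_right (by norm_num) h
    have h2 : 60 ≤ wt 33262 3675 488 63 12 d := by unfold wt; omega
    nlinarith

lemma wt_inv1 {d : ℕ} (hd : 1 < d) : 187500 ≤ wt 0 3675 488 63 12 d * 5 ^ d := by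
  rcases Nat.lt_or_ge d 5 with h | h
  · interval_cases d <;> decide
  · have : 5 ^ 5 ≤ 5 ^ d := Nat.pow_le_pow_right (by norm_num) h
    have h2 : 60 ≤ wt 0 3675 488 63 12 d := by unfold wt; omega
    nlinarith

/-- bound for the number of polynomial factors -/
def tot (n : ℕ) : ℕ :=
  (22 * Nat.gcd (N5 n) 4 + 15 * Nat.gcd (N5 n) 24 + 8 * Nat.gcd (N5 n) 124
        + 3 * Nat.gcd (N5 n) 624 + 12 * N5 n) / 60

lemma card_SS_le (hK : Fintype.card K = 5) {n : ℕ} (hn : 0 < n) : (SS K n).card ≤ tot n := by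
  unfold tot
  rw [Nat.le_div_iff_mul_le (by norm_num)]
  refine le_trans ?_ (wt_sum (K := K) hK hn 22 15 8 3 12)
  rw [← smul_eq_mul]
  exact Finset.card_nsmul_le_sum _ _ _ fun s hs => wt_count (deg_pos hn hs)

/-- bound for the scaled sum of inverse norms of the non-core polynomial factors -/
def sinv (j n : ℕ) : ℕ :=
  (if j = 0 then 33262 else 0) * Nat.gcd (N5 n) 4 + 3675 * Nat.gcd (N5 n) 24 + 488 * Nat.gcd (N5 n) 124
        + 63 * Nat.gcd (N5 n) 624 + 12 * N5 n

lemma sinv_le (hK : Fintype.card K = 5) {n : ℕ} (hn : 0 < n) {j : ℕ} (hj : j ≤ 1) :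
    ∑ s ∈ (SS K n).filter (fun s => ¬ s.natDegree ≤ j), (1 / (Fintype.card K : ℝ) ^ s.natDegree)
      ≤ (sinv j n : ℝ) / 187500 := by
  rw [le_div_iff₀ (by norm_num), Finset.sum_mul]
  have key : ∑ s ∈ (SS K n).filter (fun s => ¬ s.natDegree ≤ j), (1 / (Fintype.card K : ℝ) ^ s.natDegree * 187500)
     ≤ ∑ s ∈ (SS K n).filter (fun s => ¬ s.natDegree ≤ j),
        ((wt (if j = 0 then 33262 else 0) 3675 488 63 12 s.natDegree : ℕ) : ℝ) := by
    apply Finset.sum_le_sum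
    intro s hs
    rw [Finset.mem_filter] at hs
    have h0 := deg_pos hn hs.1
    have h1 : 187500 ≤ wt (if j = 0 then 33262 else 0) 3675 488 63 12 s.natDegree * 5 ^ s.natDegree := by
      split
      · exact wt_inv0 h0
      · exact wt_inv1 (by omega)
    have h2 : (187500 : ℝ) ≤ (wt (if j = 0 then 33262 else 0) 3675 488 63 12 s.natDegree : ℕ) * 5 ^ s.natDegree := by
      exact_mod_cast h1
    rw [hK, div_mul_eq_mul_div, one_mul, div_le_iff₀ (by positivity)]
    exact_mod_cast h1
  refine key.trans ?_
  rw [← Nat.cast_sum]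
  have h3 : ∑ s ∈ (SS K n).filter (fun s => ¬ s.natDegree ≤ j), wt (if j = 0 then 33262 else 0) 3675 488 63 12 s.natDegree
      ≤ sinv j n :=
    le_trans (Finset.sum_le_sum_of_subset (Finset.filter_subset _ _)) (wt_sum (K := K) hK hn _ _ _ _ _)
  exact_mod_cast h3

/-- bound for the number of core polynomial factors -/
def corec (j n : ℕ) : ℕ := if j = 0 then 0 else Nat.gcd (N5 n) 4

lemma corec_le (hK : Fintype.card K = 5) {n : ℕ} (hn : 0 < n) {j : ℕ} (hj : j ≤ 1) :
    ((SS K n).filter (fun s => s.natDegree ≤ j)).card ≤ corec j n := by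
  unfold corec
  split
  · rename_i h
    subst h
    rw [Nat.le_zero, Finset.card_eq_zero, Finset.filter_eq_empty_iff]
    intro s hs
    have := deg_pos hn hs
    omega
  · have h1 := SS_deg_sum_k (K := K) hK hn 1
    norm_num at h1
    refine le_trans ?_ h1
    rw [Finset.card_eq_sum_ones]
    refine le_trans (le_of_eq ?_) (Finset.sum_le_sum (f := fun _ => 1) fun s hs => ?_)
    · congr 1
      ext s
      simp only [Finset.mem_filter]
      refine and_congr_right fun hs => ?_
      have := deg_pos hn hs
      omega
    · rw [Finset.mem_filter] at hs
      omega
end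
end W

open Polynomial
set_option linter.unusedSectionVars false
namespace W

/-- the primes below 150 -/
def ps : List ℕ := [2, 3, 5, 7, 11, 13, 17, 19, 23, 29, 31, 37, 41, 43, 47, 53, 59, 61, 67, 71, 73, 79, 83, 89,
  97, 101, 103, 107, 109, 113, 127, 131, 137, 139, 149]

/-- the primes below 150 dividing `5 ^ n - 1` -/
def sm (n : ℕ) : List ℕ := ps.filter fun p => decide (5 ^ n % p = 1)

/-- bound for the number of prime factors above 150 -/
def rr (n : ℕ) : ℕ := Nat.log 150 (5 ^ n / (sm n).prod)

lemma ps_nodup : ps.Nodup := by decide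

lemma ps_prime : ∀ p ∈ ps, p.Prime := by
  unfold ps
  simp only [List.forall_mem_cons]
  norm_num

lemma mem_ps {p : ℕ} (hp : p.Prime) (h : p < 150) : p ∈ ps := by
  have : ∀ p < 150, p ∈ ps ∨ p < 2 ∨ ∃ d < 13, 2 ≤ d ∧ d < p ∧ d ∣ p := by decide +kernel
  rcases this p h with h | h | ⟨d, -, h2, h3, h4⟩
  · exact h
  · have := hp.two_le; omega
  · rcases (Nat.dvd_prime hp).1 h4 with h | h <;> omega

lemma sm_nodup (n : ℕ) : (sm n).Nodup := ps_nodup.filter _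

lemma mem_sm {n p : ℕ} (hn : 0 < n) : p ∈ sm n ↔ p ∈ (5 ^ n - 1).primeFactors ∧ p < 150 := by
  have h5 : 5 ≤ 5 ^ n := by calc 5 = 5 ^ 1 := by norm_num
                              _ ≤ 5 ^ n := Nat.pow_le_pow_right (by norm_num) hn
  have hmod : ∀ p : ℕ, p.Prime → (5 ^ n % p = 1 ↔ p ∣ 5 ^ n - 1) := by
    intro p hp
    rw [← (Nat.modEq_iff_dvd' (show 1 ≤ 5 ^ n by omega)), Nat.ModEq, Nat.mod_eq_of_lt hp.one_lt]
    exact eq_comm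
  unfold sm
  rw [List.mem_filter, decide_eq_true_eq, Nat.mem_primeFactors]
  constructor
  · rintro ⟨h1, h2⟩
    have hp := ps_prime p h1
    refine ⟨⟨hp, (hmod p hp).1 h2, by omega⟩, ?_⟩
    have : ∀ p ∈ ps, p < 150 := by decide
    exact this p h1
  · rintro ⟨⟨hp, h1, h2⟩, h3⟩
    exact ⟨mem_ps hp h3, (hmod p hp).2 h1⟩

lemma filter_sm {n : ℕ} (hn : 0 < n) : (5 ^ n - 1).primeFactors.filter (fun p => p < 150) = (sm n).toFinset := by
  ext p
  rw [Finset.mem_filter, List.mem_toFinset, mem_sm hn]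

lemma prod_big {n b : ℕ} (hn : 0 < n)
    (hb : ∀ p ∈ (5 ^ n - 1).primeFactors.filter (fun p => ¬ p < 150), b ≤ p) :
    (sm n).prod * b ^ ((5 ^ n - 1).primeFactors.filter (fun p => ¬ p < 150)).card ≤ 5 ^ n := by
  have h5 : 5 ≤ 5 ^ n := by calc 5 = 5 ^ 1 := by norm_num
                              _ ≤ 5 ^ n := Nat.pow_le_pow_right (by norm_num) hn
  have h1 : ∏ p ∈ (5 ^ n - 1).primeFactors, p ≤ 5 ^ n - 1 := Nat.le_of_dvd (by omega) (Nat.prod_primeFactors_dvd _)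
  rw [← Finset.prod_filter_mul_prod_filter_not _ (fun p => p < 150), filter_sm hn] at h1
  have h2 : ∏ p ∈ (sm n).toFinset, p = (sm n).prod := by
    rw [List.prod_toFinset _ (sm_nodup n)]; simp
  rw [h2] at h1
  have h3 := Finset.pow_card_le_prod ((5 ^ n - 1).primeFactors.filter (fun p => ¬ p < 150)) (fun p => p) b hb
  calc _ ≤ _ := Nat.mul_le_mul_left _ h3
    _ ≤ _ := h1
    _ ≤ _ := by omega

lemma big_le {n : ℕ} (hn : 0 < n) : ((5 ^ n - 1).primeFactors.filter (fun p => ¬ p < 150)).card ≤ rr n := by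
  have h := prod_big (b := 150) hn (fun p hp => by rw [Finset.mem_filter] at hp; omega)
  have hpos : 0 < (sm n).prod := List.prod_pos fun p hp => (ps_prime p (List.mem_of_mem_filter hp)).pos
  unfold rr
  apply Nat.le_log_of_pow_le (by norm_num)
  rw [Nat.le_div_iff_mul_le hpos, mul_comm]
  exact h

lemma card_primes_le {n : ℕ} (hn : 0 < n) : (5 ^ n - 1).primeFactors.card ≤ (sm n).length + rr n := by
  rw [← Finset.card_filter_add_card_filter_not (fun p => p < 150), filter_sm hn]
  exact Nat.add_le_add (List.toFinset_card_le _) (big_le hn)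

/-- check with everything in the core -/
def checkB (n : ℕ) : Bool := decide (144 * 4 ^ (2 * (sm n).length + 2 * rr n + tot n) ≤ 5 ^ n)

/-- scaled sum -/
def TA (n j : ℕ) : ℕ :=
  2 * ((((sm n).filter (fun p => decide (¬ p < 8))).map (fun p => 1500000 / p + 1)).sum) + 2 * rr n * 10000 + 8 * sinv j n

/-- core size -/
def cA (n j : ℕ) : ℕ := 2 * ((sm n).filter (fun p => decide (p < 8))).length + corec j n

/-- sieve size -/
def RA (n : ℕ) : ℕ := 2 * ((sm n).filter (fun p => decide (¬ p < 8))).length + 2 * rr n + tot n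

/-- check with a small core -/
def checkA (n j : ℕ) : Bool :=
  decide (TA n j < 1500000) && decide (1 ≤ RA n) &&
  decide ((6 * 2 ^ cA n j * ((RA n - 1) * 1500000 + 2 * (1500000 - TA n j))) ^ 2
    < 5 ^ n * (1500000 - TA n j) ^ 2)

lemma filt_lt8 {n : ℕ} (hn : 0 < n) : (5 ^ n - 1).primeFactors.filter (fun p => p < 8) =
    ((sm n).filter (fun p => decide (p < 8))).toFinset := by
  ext p
  rw [Finset.mem_filter, List.mem_toFinset, List.mem_filter, mem_sm hn, decide_eq_true_eq]
  constructor
  · rintro ⟨h1, h2⟩; exact ⟨⟨h1, by omega⟩, h2⟩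
  · rintro ⟨⟨h1, -⟩, h2⟩; exact ⟨h1, h2⟩

lemma filt_ge8 {n : ℕ} (hn : 0 < n) : (5 ^ n - 1).primeFactors.filter (fun p => ¬ p < 8) =
    ((sm n).filter (fun p => decide (¬ p < 8))).toFinset ∪ (5 ^ n - 1).primeFactors.filter (fun p => ¬ p < 150) := by
  ext p
  rw [Finset.mem_union, Finset.mem_filter, Finset.mem_filter, List.mem_toFinset, List.mem_filter, mem_sm hn,
    decide_eq_true_eq]
  constructor
  · rintro ⟨h1, h2⟩
    by_cases h : p < 150
    · exact Or.inl ⟨⟨h1, h⟩, h2⟩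
    · exact Or.inr ⟨h1, h⟩
  · rintro (⟨⟨h1, -⟩, h2⟩ | ⟨h1, h2⟩)
    · exact ⟨h1, h2⟩
    · exact ⟨h1, by omega⟩

lemma inv_sum_le {n : ℕ} (hn : 0 < n) :
    ∑ p ∈ ((5 ^ n - 1).primeFactors.filter (fun p => ¬ p < 8) : Finset ℕ), (1 / (p : ℝ)) ≤
      (((((sm n).filter (fun p => decide (¬ p < 8))).map (fun p => 1500000 / p + 1)).sum + rr n * 10000 : ℕ) : ℝ) / 1500000 := by
  rw [le_div_iff₀ (by norm_num), Finset.sum_mul]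
  set l := (sm n).filter (fun p => decide (¬ p < 8)) with hl
  have hnd : l.Nodup := (sm_nodup n).filter _
  set B := (5 ^ n - 1).primeFactors.filter (fun p => ¬ p < 150) with hB
  have h0 : ∑ p ∈ l.toFinset, (1500000 / p + 1) = (l.map (fun p => 1500000 / p + 1)).sum := by
    rw [List.sum_toFinset _ hnd]
  have hdisj : Disjoint l.toFinset B := by
    rw [Finset.disjoint_left]
    intro p h1 h2
    rw [List.mem_toFinset, hl, List.mem_filter, mem_sm hn] at h1
    rw [hB, Finset.mem_filter] at h2
    exact h2.2 h1.1.2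
  rw [filt_ge8 hn, Finset.sum_union hdisj, ← h0]
  push_cast
  apply add_le_add
  · apply Finset.sum_le_sum
    intro p hp
    rw [List.mem_toFinset, hl, List.mem_filter] at hp
    have hp0 : 0 < p := (ps_prime p (List.mem_of_mem_filter hp.1)).pos
    have h1 : 1500000 < p * (1500000 / p + 1) := Nat.lt_mul_div_succ _ hp0
    have h2 : (1500000 : ℝ) ≤ p * (((1500000 / p : ℕ) : ℝ) + 1) := by exact_mod_cast h1.le
    rw [div_mul_eq_mul_div, one_mul, div_le_iff₀ (by exact_mod_cast hp0), mul_comm]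
    convert h2 using 2
  · calc ∑ p ∈ B, (1 / (p : ℝ) * 1500000) ≤ ∑ p ∈ B, (10000 : ℝ) := by
          apply Finset.sum_le_sum
          intro p hp
          rw [hB, Finset.mem_filter] at hp
          have h1 : (150 : ℝ) ≤ p := by exact_mod_cast (not_lt.1 hp.2)
          rw [div_mul_eq_mul_div, one_mul, div_le_iff₀ (by linarith)]
          linarith
      _ = (B.card : ℝ) * 10000 := by rw [Finset.sum_const, nsmul_eq_mul]
      _ ≤ _ := by
          have := big_le hn
          have h2 : (B.card : ℝ) ≤ rr n := by exact_mod_cast this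
          linarith

section
variable {K L : Type} [Field K] [Field L] [Fintype K] [Fintype L] [Algebra K L]

/-- the conclusion wanted -/
def Good (K L : Type) [Field K] [Field L] [Fintype K] [Fintype L] [Algebra K L] (n : ℕ) : Prop :=
  ∀ f1 f2 : L[X], f2 ≠ 0 → f1.natDegree ≤ 3 → f2.natDegree ≤ 2 → IsCoprime f1 f2 →
    ∀ (k : ℕ) (g : L[X]), g.Monic → Irreducible g → g ≠ X → Nat.gcd k (Fintype.card L - 1) = 1 → g ^ k ∣ f1 * f2 →
    ¬ g ^ (k + 1) ∣ f1 * f2 →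
    ∃ α : L, f2.eval α ≠ 0 ∧ orderOf α = Fintype.card L - 1 ∧ orderOf (f1.eval α / f2.eval α) = Fintype.card L - 1 ∧
      LinearIndependent K (fun i : Fin n => α ^ Fintype.card K ^ (i : ℕ)) ∧
      Submodule.span K (Set.range fun i : Fin n => α ^ Fintype.card K ^ (i : ℕ)) = ⊤

theorem good_core {n c : ℕ} (hn : 3 ≤ n) (hK : Fintype.card K = 5) (hL : Fintype.card L = 5 ^ n)
    (hc : 2 * (5 ^ n - 1).primeFactors.card + (SS K n).card ≤ c) (h : 144 * 4 ^ c ≤ 5 ^ n) : Good K L n := by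
  classical
  intro f1 f2 h20 hd1 hd2 hco k g hgm hg hgX hk hd hnd
  have h36 : 36 ≤ Fintype.card L := by
    rw [hL]; calc 36 ≤ 5 ^ 3 := by norm_num
              _ ≤ 5 ^ n := Nat.pow_le_pow_right (by norm_num) hn
  have hs : 12 * 2 ^ c ≤ √(Fintype.card L : ℝ) := by
    apply Real.le_sqrt_of_sq_le
    rw [mul_pow, ← pow_mul, mul_comm c 2, pow_mul, hL]
    norm_num
    exact_mod_cast h
  refine criterion (K := K) (by omega) (by rw [hL, hK]) h36 (fun _ => True) (fun _ => True) c 0 1 ?_ ?_ one_pos ?_ hs ?_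
    h20 hd1 hd2 hco hgm hg hgX hk hd hnd
  · rw [hL]; simpa using hc
  · simp
  · simp
  · have : (0:ℝ) < 2 ^ c := by positivity
    push_cast
    linarith

theorem good_B {n : ℕ} (hn : 3 ≤ n) (hK : Fintype.card K = 5) (hL : Fintype.card L = 5 ^ n)
    (h : checkB n = true) : Good K L n := by
  unfold checkB at h
  rw [decide_eq_true_eq] at h
  refine good_core hn hK hL ?_ h
  have h1 := card_primes_le (n := n) (by omega)
  have h2 := card_SS_le (K := K) hK (n := n) (by omega)
  omega

theorem good_A {n j : ℕ} (hn : 3 ≤ n) (hj : j ≤ 1) (hK : Fintype.card K = 5) (hL : Fintype.card L = 5 ^ n)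
    (h : checkA n j = true) : Good K L n := by
  classical
  intro f1 f2 h20 hd1 hd2 hco k g hgm hg hgX hk hd hnd
  have h36 : 36 ≤ Fintype.card L := by
    rw [hL]; calc 36 ≤ 5 ^ 3 := by norm_num
              _ ≤ 5 ^ n := Nat.pow_le_pow_right (by norm_num) hn
  have hn0 : 0 < n := by omega
  unfold checkA at h
  simp only [Bool.and_eq_true, decide_eq_true_eq] at h
  obtain ⟨⟨hT, hR1⟩, h⟩ := h
  set c := cA n j with hcdef
  set R := RA n with hRdef
  set T := TA n j with hTdef
  have hD : (0:ℝ) < 1500000 - (T : ℝ) := by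
    have : (T : ℝ) < 1500000 := by exact_mod_cast hT
    linarith
  have key : 6 * 2 ^ c * (((R : ℝ) - 1) * 1500000 + 2 * (1500000 - T)) < (1500000 - T) * √(Fintype.card L : ℝ) := by
    have h' : ((6 * 2 ^ c * (((R - 1 : ℕ) : ℝ) * 1500000 + 2 * ((1500000 - T : ℕ) : ℝ))) ^ 2 : ℝ)
      < 5 ^ n * ((1500000 - T : ℕ) : ℝ) ^ 2 := by exact_mod_cast h
    rw [Nat.cast_sub hR1, Nat.cast_sub hT.le] at h'
    push_cast at h'
    apply lt_of_pow_lt_pow_left₀ 2 (by positivity)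
    rw [mul_pow (1500000 - (T:ℝ)), Real.sq_sqrt (by positivity), hL]
    push_cast
    linarith
  have hR1' : (1 : ℝ) ≤ R := by exact_mod_cast hR1
  have h2c : (0:ℝ) < 2 ^ c := by positivity
  have h2 : 6 * 2 ^ c * ((R:ℝ) - 1) < (1500000 - (T:ℝ)) / 1500000 * (√(Fintype.card L : ℝ) - 12 * 2 ^ c) := by
    rw [div_mul_eq_mul_div, lt_div_iff₀ (by norm_num)]
    linarith
  have h1 : 12 * 2 ^ c ≤ √(Fintype.card L : ℝ) := by
    by_contra hcon
    push Not at hcon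
    have e1 : 0 ≤ 6 * 2 ^ c * ((R:ℝ) - 1) := by
      apply mul_nonneg (by positivity); linarith
    have e2 : (1500000 - (T:ℝ)) / 1500000 * (√(Fintype.card L : ℝ) - 12 * 2 ^ c) ≤ 0 := by
      apply mul_nonpos_of_nonneg_of_nonpos
      · positivity
      · linarith
    linarith
  refine criterion (K := K) hn0 (by rw [hL, hK]) h36 (fun p => p < 8) (fun s => s.natDegree ≤ j) c R
    ((1500000 - (T:ℝ)) / 1500000) ?_ ?_ (by positivity) ?_ h1 h2
    h20 hd1 hd2 hco hgm hg hgX hk hd hnd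
  · rw [hL, filt_lt8 hn0]
    have e1 := List.toFinset_card_le ((sm n).filter (fun p => decide (p < 8)))
    have e2 := corec_le (K := K) hK hn0 hj
    rw [hcdef, cA]
    omega
  · rw [hL, filt_ge8 hn0]
    have e0 := Finset.card_union_le ((sm n).filter (fun p => decide (¬ p < 8))).toFinset
      ((5 ^ n - 1).primeFactors.filter (fun p => ¬ p < 150))
    have e1 := List.toFinset_card_le ((sm n).filter (fun p => decide (¬ p < 8)))
    have e2 := big_le hn0
    have e3 := card_SS_le (K := K) hK hn0
    have e4 := Finset.card_filter_le (SS K n) (fun s => ¬ s.natDegree ≤ j)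
    rw [hRdef, RA]
    omega
  · rw [hL]
    have e1 := inv_sum_le hn0
    have e2 := sinv_le (K := K) hK hn0 hj
    have e3 : (T : ℝ) = 2 * (((((sm n).filter (fun p => decide (¬ p < 8))).map (fun p => 1500000 / p + 1)).sum
      + rr n * 10000 : ℕ) : ℝ) + 8 * (sinv j n : ℝ) := by
      rw [hTdef, TA]
      push_cast
      ring
    have e4 : 1 - (1500000 - (T:ℝ)) / 1500000 = 2 * ((((((sm n).filter (fun p => decide (¬ p < 8))).map (fun p => 1500000 / p + 1)).sum
      + rr n * 10000 : ℕ) : ℝ) / 1500000) + (sinv j n : ℝ) / 187500 := by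
      rw [e3]; ring
    rw [e4]
    linarith
end
end W

open Polynomial
set_option linter.unusedSectionVars false
namespace W

lemma pw_aux (A B C m : ℕ) : 2 ^ A * 4 ^ B * 5 ^ m * 4 ^ C = 2 ^ (A + 2 * B + 2 * C) * 5 ^ m := by
  rw [show (4:ℕ) = 2 ^ 2 by norm_num, ← pow_mul, ← pow_mul, pow_add, pow_add]
  ac_rfl

lemma tot_le (n : ℕ) : 60 * tot n ≤ 12 * n + 3312 := by
  have h1 := Nat.le_of_dvd (by norm_num) (Nat.gcd_dvd_right (N5 n) 4)
  have h2 := Nat.le_of_dvd (by norm_num) (Nat.gcd_dvd_right (N5 n) 24)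
  have h3 := Nat.le_of_dvd (by norm_num) (Nat.gcd_dvd_right (N5 n) 124)
  have h4 := Nat.le_of_dvd (by norm_num) (Nat.gcd_dvd_right (N5 n) 624)
  have h5 : N5 n ≤ n := by unfold N5; split <;> omega
  unfold tot
  omega

lemma sm_length {n : ℕ} (hn : 0 < n) : (sm n).length ≤ 34 := by
  have h1 : sm n ⊆ ps.erase 5 := by
    intro p hp
    rw [ps_nodup.mem_erase_iff]
    refine ⟨?_, List.mem_of_mem_filter hp⟩
    rintro rfl
    unfold sm at hp
    rw [List.mem_filter, decide_eq_true_eq] at hp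
    have : 5 ^ n % 5 = 0 := Nat.mod_eq_zero_of_dvd (dvd_pow_self 5 hn.ne')
    omega
  have := ((sm_nodup n).subperm h1).length_le
  exact this.trans (by decide)

section
variable {K L : Type} [Field K] [Field L] [Fintype K] [Fintype L] [Algebra K L]

theorem good_large {n : ℕ} (hn : 408 ≤ n) (hK : Fintype.card K = 5) (hL : Fintype.card L = 5 ^ n) : Good K L n := by
  have hn0 : 0 < n := by omega
  set r := ((5 ^ n - 1).primeFactors.filter (fun p => ¬ p < 150)).card with hr
  have h1 : 151 ^ r ≤ 5 ^ n := by
    have h := prod_big (b := 151) hn0 (fun p hp => by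
      rw [Finset.mem_filter, Nat.mem_primeFactors] at hp
      have : p ≠ 150 := by rintro rfl; exact absurd hp.1.1 (by norm_num)
      omega)
    have hpos : 0 < (sm n).prod := List.prod_pos fun p hp => (ps_prime p (List.mem_of_mem_filter hp)).pos
    exact (Nat.le_mul_of_pos_left _ hpos).trans h
  have hc : (5 ^ n - 1).primeFactors.card ≤ 34 + r := by
    rw [← Finset.card_filter_add_card_filter_not (fun p => p < 150), filter_sm hn0]
    exact Nat.add_le_add ((List.toFinset_card_le _).trans (sm_length hn0)) le_rfl
  have e4 : 323 + 2 * 3060 + 2 * (9 * n + 2484) ≤ 46 * n := by linarith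
  have ht := tot_le n
  have hs := card_SS_le (K := K) hK hn0
  refine good_core (c := 68 + 2 * r + tot n) (by omega) hK hL (by omega) ?_
  have e1 : 16 ^ (45 * r) ≤ 5 ^ (25 * n) := by
    calc 16 ^ (45 * r) = (16 ^ 9) ^ (5 * r) := by rw [← pow_mul]; congr 1; ring
      _ ≤ (151 ^ 5) ^ (5 * r) := Nat.pow_le_pow_left (by norm_num) _
      _ = (151 ^ r) ^ 25 := by rw [← pow_mul, ← pow_mul]; congr 1; ring
      _ ≤ (5 ^ n) ^ 25 := Nat.pow_le_pow_left h1 _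
      _ = _ := by rw [← pow_mul]; congr 1; ring
  have e2 : 4 ^ (45 * tot n) ≤ 4 ^ (9 * n + 2484) := Nat.pow_le_pow_right (by norm_num) (by omega)
  have e0 : 144 ^ 45 ≤ 2 ^ 323 := by decide +kernel
  have e3 : 2 ^ (46 * n) ≤ 5 ^ (20 * n) := by
    rw [pow_mul, pow_mul]; exact Nat.pow_le_pow_left (by norm_num) _
  rw [← Nat.pow_le_pow_iff_left (n := 45) (by norm_num)]
  calc (144 * 4 ^ (68 + 2 * r + tot n)) ^ 45
      = 144 ^ 45 * 4 ^ 3060 * 16 ^ (45 * r) * 4 ^ (45 * tot n) := by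
        rw [mul_pow, ← pow_mul, show (16:ℕ) = 4 ^ 2 by norm_num, ← pow_mul, mul_assoc, mul_assoc, ← pow_add, ← pow_add]
        congr 2; ring
    _ ≤ 2 ^ 323 * 4 ^ 3060 * 5 ^ (25 * n) * 4 ^ (9 * n + 2484) :=
        Nat.mul_le_mul (Nat.mul_le_mul (Nat.mul_le_mul_right _ e0) e1) e2
    _ = 2 ^ (323 + 2 * 3060 + 2 * (9 * n + 2484)) * 5 ^ (25 * n) := pw_aux _ _ _ _
    _ ≤ 2 ^ (46 * n) * 5 ^ (25 * n) :=
        Nat.mul_le_mul (Nat.pow_le_pow_right (by norm_num) e4) le_rfl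
    _ ≤ 5 ^ (20 * n) * 5 ^ (25 * n) := by gcongr
    _ = (5 ^ n) ^ 45 := by rw [← pow_add, ← pow_mul]; congr 1; ring

lemma check_all : (List.range 408).all (fun n => checkB n || (checkA n 0 || checkA n 1) || decide (n < 7)
    || decide (n = 8) || decide (n = 12)) = true := by
  decide +kernel

theorem good_all {n : ℕ} (h : 13 ≤ n ∨ n ∈ ({7, 9, 10, 11} : Finset ℕ)) (hK : Fintype.card K = 5)
    (hL : Fintype.card L = 5 ^ n) : Good K L n := by
  simp only [Finset.mem_insert, Finset.mem_singleton] at h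
  have hn : 3 ≤ n := by omega
  rcases Nat.lt_or_ge n 408 with hlt | hge
  · have h1 := (List.all_eq_true.1 check_all) n (List.mem_range.2 hlt)
    simp only [Bool.or_eq_true, decide_eq_true_eq] at h1
    rcases h1 with (((h1 | h1 | h1) | h1) | h1) | h1
    · exact good_B hn hK hL h1
    · exact good_A hn (by norm_num) hK hL h1
    · exact good_A hn (by norm_num) hK hL h1
    · omega
    · omega
    · omega
  · exact good_large hge hK hL
end
end W

theorem stmt14 (n : ℕ) (hn : 3 ≤ n)
    (h : 13 ≤ n ∨ n ∈ ({7, 9, 10, 11} : Finset ℕ)) :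
    memB 3 2 5 n := by
  intro K L _ _ _ _ _ hK hL f hf
  obtain ⟨f1, f2, h20, rfl, hd1, hd2, hco, k, g, -, hgm, hg, hgX, hk, hd, hnd⟩ := hf
  obtain ⟨α, h1, h2, h3, h4, h5⟩ := W.good_all (K := K) (L := L) h hK hL f1 f2 h20 hd1 hd2 hco k g hgm hg hgX hk hd hnd
  refine ⟨α, h2, ⟨h4, h5⟩, ?_⟩
  unfold IsPrimitiveElem ratEval
  rw [W.ratEval_eq h20 α h1]
  exact h3
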